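/- arXiv:1503.03536 — 5 statements merged into one kernel-verified Lean document; each statement's English description precedes it below -/
import Mathlib

section
/- Let Γ be an infinite set, X a Banach space, and T : ℓ∞(Γ) → X a bounded linear operator such that inf_{γ∈Γ} ‖T(e_γ)‖ > 0. Then there exists a subset Γ' ⊆ Γ with the same cardinality as Γ such that the restriction of T to ℓ∞(Γ') is an isomorphism onto its image, i.e., there exists l > 0 such that ‖T(z)‖ ≥ l‖z‖ for all z ∈ ℓ∞(Γ'). -/
/-- The linear functional `μ` on `ℓ∞(Γ)` has norm at most `c` on the functions supported
in `A`. -/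
def BoundedOnSupport {Γ : Type*} (μ : lp (fun _ : Γ => ℝ) ⊤ →L[ℝ] ℝ) (A : Set Γ) (c : ℝ) :
    Prop :=
  ∀ z : lp (fun _ : Γ => ℝ) ⊤, (∀ γ ∉ A, z γ = 0) → |μ z| ≤ c * ‖z‖

/-- Functions with disjoint supports satisfy the triangle inequality with a maximum. -/
theorem lp_infty_norm_add_le_of_disjoint {Γ : Type*} {A B : Set Γ} (hAB : Disjoint A B)
    {z w : lp (fun _ : Γ => ℝ) ⊤} (hz : ∀ γ ∉ A, z γ = 0) (hw : ∀ γ ∉ B, w γ = 0)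
    {c : ℝ} (hzc : ‖z‖ ≤ c) (hwc : ‖w‖ ≤ c) : ‖z + w‖ ≤ c := by
  refine lp.norm_le_of_forall_le ((norm_nonneg z).trans hzc) fun γ => ?_
  rw [lp.coeFn_add, Pi.add_apply]
  by_cases h : γ ∈ A
  · rw [hw γ (Set.disjoint_left.1 hAB h), add_zero]
    exact (lp.norm_apply_le_norm ENNReal.top_ne_zero z γ).trans hzc
  · rw [hz γ h, zero_add]
    exact (lp.norm_apply_le_norm ENNReal.top_ne_zero w γ).trans hwc

/-- Superadditivity of the variation of a functional on `ℓ∞(Γ)`. -/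
theorem BoundedOnSupport.sub_of_disjoint {Γ : Type*} {μ : lp (fun _ : Γ => ℝ) ⊤ →L[ℝ] ℝ}
    {A B S : Set Γ} {c ε : ℝ} (hS : BoundedOnSupport μ S c) (hA : A ⊆ S) (hB : B ⊆ S)
    (hAB : Disjoint A B) (hε : 0 ≤ ε) (hn : ¬ BoundedOnSupport μ A ε) :
    BoundedOnSupport μ B (c - ε) := by
  intro w hw
  simp only [BoundedOnSupport, not_forall, not_le] at hn
  obtain ⟨z, hz, hlt⟩ := hn
  have hz0 : 0 < ‖z‖ := by
    rw [norm_pos_iff]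
    rintro rfl
    simp at hlt
  have key : ∀ s : ℝ, |s| = 1 →
      |‖w‖ * μ z + s * ‖z‖ * μ w| ≤ c * (‖z‖ * ‖w‖) := by
    intro s hs
    have hz' : ∀ γ ∉ A, (‖w‖ • z) γ = 0 := fun γ hγ => by
      simp [lp.coeFn_smul, hz γ hγ]
    have hw' : ∀ γ ∉ B, ((s * ‖z‖) • w) γ = 0 := fun γ hγ => by
      simp [lp.coeFn_smul, hw γ hγ]
    have hnorm := lp_infty_norm_add_le_of_disjoint hAB hz' hw' (c := ‖z‖ * ‖w‖)
      (by rw [norm_smul, norm_norm, mul_comm])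
      (by rw [norm_smul, norm_mul, Real.norm_eq_abs, hs, one_mul, norm_norm])
    have hb := hS (‖w‖ • z + (s * ‖z‖) • w) fun γ hγ => by
      rw [lp.coeFn_add, Pi.add_apply, hz' γ fun h => hγ (hA h), hw' γ fun h => hγ (hB h),
        add_zero]
    rw [map_add, map_smul, map_smul, smul_eq_mul, smul_eq_mul] at hb
    by_cases hc : 0 ≤ c
    · exact hb.trans (mul_le_mul_of_nonneg_left hnorm hc)
    · have := hS z fun γ hγ => hz γ fun h => hγ (hA h)
      have := abs_nonneg (μ z)
      nlinarith
  have h1 := abs_le.1 (key 1 (by simp))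
  have h2 := abs_le.1 (key (-1) (by simp))
  have hsum : ‖w‖ * |μ z| + ‖z‖ * |μ w| ≤ c * (‖z‖ * ‖w‖) := by
    rcases abs_cases (μ z) with ⟨e, -⟩ | ⟨e, -⟩ <;>
    rcases abs_cases (μ w) with ⟨e', -⟩ | ⟨e', -⟩ <;> rw [e, e'] <;> linarith
  have h3 := mul_le_mul_of_nonneg_left hlt.le (norm_nonneg w)
  refine le_of_mul_le_mul_left ?_ hz0
  linarith

/-- **Rosenthal's disjointification lemma**, with the bound on the variations given as a
multiple of `ε`. -/
theorem exists_subset_boundedOnSupport {Γ : Type*} [Infinite Γ]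
    (μ : Γ → lp (fun _ : Γ => ℝ) ⊤ →L[ℝ] ℝ) {ε : ℝ} (hε : 0 ≤ ε) (n : ℕ) (S : Set Γ)
    (hcard : Cardinal.mk S = Cardinal.mk Γ)
    (hS : ∀ α ∈ S, BoundedOnSupport (μ α) (S \ {α}) (n * ε)) :
    ∃ S' : Set Γ, Cardinal.mk S' = Cardinal.mk Γ ∧
      ∀ α ∈ S', BoundedOnSupport (μ α) (S' \ {α}) ε := by
  induction n generalizing S with
  | zero =>
    refine ⟨S, hcard, fun α hα z hz => (hS α hα z hz).trans ?_⟩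
    simpa using mul_nonneg hε (norm_nonneg z)
  | succ n ih =>
    have hprod : Cardinal.mk (Γ × Γ) = Cardinal.mk S := by
      rw [hcard, Cardinal.mk_prod, Cardinal.lift_id, Cardinal.mul_eq_self (Cardinal.aleph0_le_mk Γ)]
    obtain ⟨e⟩ := Cardinal.eq.1 hprod
    have he : ∀ {p q}, (e p : Γ) = e q → p = q := fun h => e.injective (Subtype.ext h)
    let M : Γ → Set Γ := fun p => Set.range fun q => (e (p, q) : Γ)
    by_cases hgood : ∃ p, ∀ α ∈ M p, BoundedOnSupport (μ α) (M p \ {α}) ε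
    · obtain ⟨p, hp⟩ := hgood
      refine ⟨M p, Cardinal.mk_range_eq _ fun q q' h => ?_, hp⟩
      exact (Prod.ext_iff.1 (he h)).2
    · push Not at hgood
      choose k hkM hk using hgood
      choose q hq using hkM
      have hinj : Function.Injective k := fun p p' h => by
        rw [← hq p, ← hq p'] at h
        exact (Prod.ext_iff.1 (he h)).1
      refine ih (Set.range k) (Cardinal.mk_range_eq _ hinj) ?_
      rintro _ ⟨p, rfl⟩
      have hkS : ∀ p, k p ∈ S := fun p => hq p ▸ (e (p, q p)).2
      have := (hS (k p) (hkS p)).sub_of_disjoint (A := M p \ {k p})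
        (B := Set.range k \ {k p}) (Set.sdiff_subset_sdiff_left ?_)
        (Set.sdiff_subset_sdiff_left ?_) ?_ hε (hk p)
      · convert this using 1
        push_cast
        ring
      · rintro _ ⟨r, rfl⟩
        exact (e (p, r)).2
      · rintro _ ⟨r, rfl⟩
        exact hkS r
      · rw [Set.disjoint_left]
        rintro _ ⟨⟨r, rfl⟩, -⟩ ⟨⟨p', h⟩, hne⟩
        rw [← hq p'] at h
        have hp : p' = p := (Prod.ext_iff.1 (he h)).1
        subst hp
        exact hne (h.symm.trans (hq p'))

/-- **Rosenthal's theorem.** If `Γ` is an infinite set, `X` a Banach space and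
`T : ℓ∞(Γ) → X` a bounded linear operator with `inf_γ ‖T e_γ‖ > 0`, then there is
`Γ' ⊆ Γ` of the same cardinality as `Γ` on which `T` is an isomorphism onto its image,
i.e. `T` is bounded below on the subspace of functions supported in `Γ'`. -/
theorem rosenthal_ell_infty {Γ : Type*} [Infinite Γ] [DecidableEq Γ]
    {X : Type*} [NormedAddCommGroup X] [NormedSpace ℝ X] [CompleteSpace X]
    (T : lp (fun _ : Γ => ℝ) ⊤ →L[ℝ] X)
    (hT : 0 < ⨅ γ : Γ, ‖T (lp.single ⊤ γ 1)‖) :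
    ∃ Γ' : Set Γ, Cardinal.mk Γ' = Cardinal.mk Γ ∧
      ∃ l : ℝ, 0 < l ∧ ∀ z : lp (fun _ : Γ => ℝ) ⊤,
        (∀ γ ∉ Γ', z γ = 0) → l * ‖z‖ ≤ ‖T z‖ := by
  set δ := ⨅ γ : Γ, ‖T (lp.single ⊤ γ 1)‖ with hδ
  have hle : ∀ γ, δ ≤ ‖T (lp.single ⊤ γ 1)‖ := fun γ =>
    ciInf_le ⟨0, by rintro _ ⟨_, rfl⟩; exact norm_nonneg _⟩ γ
  choose φ hφ hφT using fun γ => exists_dual_vector'' ℝ (T (lp.single ⊤ γ 1))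
  have hφle : ∀ γ x, |φ γ x| ≤ ‖x‖ := fun γ x => by
    simpa using (φ γ).le_of_opNorm_le (hφ γ) x
  obtain ⟨n, hn⟩ := exists_nat_ge (‖T‖ / (δ / 2))
  rw [div_le_iff₀ (half_pos hT)] at hn
  obtain ⟨S, hcard, hS⟩ := exists_subset_boundedOnSupport (fun γ => (φ γ).comp T)
    (half_pos hT).le n Set.univ Cardinal.mk_univ fun γ _ z _ =>
      (hφle γ (T z)).trans ((T.le_opNorm z).trans
        (mul_le_mul_of_nonneg_right hn (norm_nonneg z)))
  refine ⟨S, hcard, δ / 2, half_pos hT, fun z hz => ?_⟩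
  have hpt : ∀ γ, δ * ‖z γ‖ ≤ ‖T z‖ + δ / 2 * ‖z‖ := by
    intro γ
    by_cases hγ : γ ∈ S
    swap
    · rw [hz γ hγ, norm_zero, mul_zero]
      positivity
    set w : lp (fun _ : Γ => ℝ) ⊤ := z - z γ • lp.single ⊤ γ 1 with hw
    have hwapp : ∀ β, w β = z β - z γ * lp.single (E := fun _ : Γ => ℝ) ⊤ γ 1 β := fun _ => rfl
    have hwγ : w γ = 0 := by
      rw [hwapp, lp.single_apply_self, mul_one, sub_self]
    have hwne : ∀ β, β ≠ γ → w β = z β := fun β hβ => by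
      rw [hwapp, lp.single_apply_ne _ _ _ hβ, mul_zero, sub_zero]
    have hwnorm : ‖w‖ ≤ ‖z‖ := by
      refine lp.norm_le_of_forall_le (norm_nonneg z) fun β => ?_
      by_cases hβ : β = γ
      · rw [hβ, hwγ, norm_zero]
        exact norm_nonneg z
      · rw [hwne β hβ]
        exact lp.norm_apply_le_norm ENNReal.top_ne_zero z β
    have hwb : |φ γ (T w)| ≤ δ / 2 * ‖w‖ := hS γ hγ w fun β hβ => by
      by_cases h : β = γ
      · rw [h, hwγ]
      · rw [hwne β h]
        exact hz β fun hβS => hβ ⟨hβS, h⟩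
    have hsplit : z γ * ‖T (lp.single ⊤ γ 1)‖ = φ γ (T z) - φ γ (T w) := by
      have := hφT γ
      simp only [RCLike.ofReal_real_eq_id, id_eq] at this
      rw [hw, map_sub, map_sub, map_smul, map_smul, this, smul_eq_mul]
      ring
    calc δ * ‖z γ‖ ≤ ‖T (lp.single ⊤ γ 1)‖ * ‖z γ‖ :=
          mul_le_mul_of_nonneg_right (hle γ) (norm_nonneg _)
      _ = |φ γ (T z) - φ γ (T w)| := by
          rw [← hsplit, abs_mul, abs_norm, mul_comm, Real.norm_eq_abs]
      _ ≤ |φ γ (T z)| + |φ γ (T w)| := abs_sub _ _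
      _ ≤ ‖T z‖ + δ / 2 * ‖z‖ := add_le_add (hφle γ _)
          (hwb.trans (mul_le_mul_of_nonneg_left hwnorm (half_pos hT).le))
  have hnorm : ‖z‖ ≤ (‖T z‖ + δ / 2 * ‖z‖) / δ :=
    lp.norm_le_of_forall_le (by positivity) fun γ => by
      rw [le_div_iff₀ hT, mul_comm]
      exact hpt γ
  rw [le_div_iff₀ hT] at hnorm
  linarith
end

section
/- For each modulus ω, every L > 0 and every ε > 0, there is a natural number M(ω, L, ε) such that: if n ≥ M(ω, L, ε) and f : B_{ℓ∞^n} → ℝ is an L-Lipschitz function, continuous on the closed unit ball B_{ℓ∞^n}, Fréchet differentiable on the open unit ball, whose derivative df has modulus of continuity ω, then there exists j ∈ {1, …, n} for which |f(η e_j) − f(0)| < ε whenever |η| ≤ 1. -/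
open Metric

/-- A modulus: a non-decreasing function `ω : [0,∞) → [0,∞)` with `ω 0 = 0`,
continuous at `0`. -/
def IsModulus (ω : ℝ → ℝ) : Prop :=
  (∀ t, 0 ≤ t → 0 ≤ ω t) ∧ MonotoneOn ω (Set.Ici 0) ∧ ω 0 = 0 ∧
    ContinuousWithinAt ω (Set.Ici 0) 0

/-- `g` is differentiable at each point of the closed unit ball of `ℓ∞(ι)`, and its derivative
`g'` is bounded by `L` and has modulus of continuity `ω` there. -/
structure IsUniformlySmooth {ι : Type*} [Fintype ι] (ω : ℝ → ℝ) (L : ℝ) (g : (ι → ℝ) → ℝ)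
    (g' : (ι → ℝ) → ((ι → ℝ) →L[ℝ] ℝ)) : Prop where
  hasFDerivAt : ∀ x, ‖x‖ ≤ 1 → HasFDerivAt g (g' x) x
  norm_le : ∀ x, ‖x‖ ≤ 1 → ‖g' x‖ ≤ L
  modulus : ∀ x y, ‖x‖ ≤ 1 → ‖y‖ ≤ 1 → ‖g' x - g' y‖ ≤ ω ‖x - y‖

/-- The linear isometry of `ℓ∞(ι)` permuting the coordinates by `σ`. -/
def permCoord {ι : Type*} (σ : Equiv.Perm ι) : (ι → ℝ) →L[ℝ] (ι → ℝ) :=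
  ContinuousLinearMap.pi fun i => ContinuousLinearMap.proj (σ i)

theorem permCoord_apply {ι : Type*} (σ : Equiv.Perm ι) (x : ι → ℝ) (i : ι) :
    permCoord σ x i = x (σ i) := rfl

theorem permCoord_single {ι : Type*} [DecidableEq ι] (σ : Equiv.Perm ι) (j : ι) (c : ℝ) :
    permCoord σ (Pi.single j c) = Pi.single (σ.symm j) c := by
  ext i
  simp only [permCoord_apply, Pi.single_apply, Equiv.eq_symm_apply]

theorem norm_permCoord_le {ι : Type*} [Fintype ι] (σ : Equiv.Perm ι) (x : ι → ℝ) :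
    ‖permCoord σ x‖ ≤ ‖x‖ :=
  (pi_norm_le_iff_of_nonneg (norm_nonneg x)).2 fun i => norm_le_pi_norm x (σ i)

theorem opNorm_permCoord_le {ι : Type*} [Fintype ι] (σ : Equiv.Perm ι) :
    ‖(permCoord σ : (ι → ℝ) →L[ℝ] (ι → ℝ))‖ ≤ 1 :=
  ContinuousLinearMap.opNorm_le_bound _ zero_le_one fun x => by
    simpa using norm_permCoord_le σ x

/-- The average of `g` over all permutations of the coordinates. -/
noncomputable def symmetrize {ι : Type*} [Fintype ι] [DecidableEq ι] (g : (ι → ℝ) → ℝ)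
    (x : ι → ℝ) : ℝ :=
  (Fintype.card (Equiv.Perm ι) : ℝ)⁻¹ * ∑ σ : Equiv.Perm ι, g (permCoord σ x)

theorem symmetrize_permCoord {ι : Type*} [Fintype ι] [DecidableEq ι] (g : (ι → ℝ) → ℝ)
    (τ : Equiv.Perm ι) (x : ι → ℝ) : symmetrize g (permCoord τ x) = symmetrize g x := by
  unfold symmetrize
  congr 1
  exact Fintype.sum_equiv (Equiv.mulLeft τ) _ _ fun σ => rfl

theorem symmetrize_zero {ι : Type*} [Fintype ι] [DecidableEq ι] (g : (ι → ℝ) → ℝ) :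
    symmetrize g 0 = g 0 := by
  simp [symmetrize, Finset.card_univ]

theorem sum_symmetrize_single {ι : Type*} [Fintype ι] [DecidableEq ι] (g : (ι → ℝ) → ℝ) :
    ∑ j, symmetrize g (Pi.single j 1) = ∑ j, g (Pi.single j 1) := by
  have h (σ : Equiv.Perm ι) :
      ∑ j, g (permCoord σ (Pi.single j 1)) = ∑ j, g (Pi.single j 1) := by
    simp only [permCoord_single]
    exact Equiv.sum_comp σ.symm fun j => g (Pi.single j 1)
  have hc : (Fintype.card (Equiv.Perm ι) : ℝ) ≠ 0 := by
    exact_mod_cast Fintype.card_ne_zero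
  unfold symmetrize
  rw [← Finset.mul_sum, Finset.sum_comm, Finset.sum_congr rfl fun σ _ => h σ, Finset.sum_const,
    Finset.card_univ, nsmul_eq_mul, inv_mul_cancel_left₀ hc]

theorem norm_inv_card_smul_sum_le {κ E : Type*} [Fintype κ] [Nonempty κ]
    [NormedAddCommGroup E] [NormedSpace ℝ E] {v : κ → E} {C : ℝ} (h : ∀ k, ‖v k‖ ≤ C) :
    ‖(Fintype.card κ : ℝ)⁻¹ • ∑ k, v k‖ ≤ C := by
  have hc : (0 : ℝ) < Fintype.card κ := by exact_mod_cast Fintype.card_pos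
  have hs : ‖∑ k, v k‖ ≤ Fintype.card κ * C := by
    simpa [Finset.card_univ] using norm_sum_le_of_le Finset.univ fun k _ => h k
  rw [norm_smul, norm_inv, Real.norm_of_nonneg hc.le, inv_mul_le_iff₀ hc]
  exact hs

namespace IsUniformlySmooth

variable {ι : Type*} [Fintype ι] {ω : ℝ → ℝ} {L : ℝ} {g : (ι → ℝ) → ℝ}
  {g' : (ι → ℝ) → ((ι → ℝ) →L[ℝ] ℝ)}

theorem bound_nonneg (hg : IsUniformlySmooth ω L g g') : 0 ≤ L :=
  (norm_nonneg _).trans (hg.norm_le 0 (by simp))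

theorem exists_symmetrize [DecidableEq ι] (hω : IsModulus ω) (hg : IsUniformlySmooth ω L g g') :
    ∃ h', IsUniformlySmooth ω L (symmetrize g) h' := by
  have hcomp (A : (ι → ℝ) →L[ℝ] ℝ) (σ : Equiv.Perm ι) : ‖A.comp (permCoord σ)‖ ≤ ‖A‖ :=
    (A.opNorm_comp_le _).trans
      (mul_le_of_le_one_right (norm_nonneg _) (opNorm_permCoord_le σ))
  have hp (σ : Equiv.Perm ι) {x : ι → ℝ} (hx : ‖x‖ ≤ 1) : ‖permCoord σ x‖ ≤ 1 :=
    (norm_permCoord_le σ x).trans hx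
  refine ⟨fun x => (Fintype.card (Equiv.Perm ι) : ℝ)⁻¹ •
    ∑ σ : Equiv.Perm ι, (g' (permCoord σ x)).comp (permCoord σ), ?_, ?_, ?_⟩
  · intro x hx
    exact (HasFDerivAt.fun_sum fun σ _ =>
      (hg.hasFDerivAt _ (hp σ hx)).comp x (permCoord σ).hasFDerivAt).const_mul _
  · intro x hx
    exact norm_inv_card_smul_sum_le fun σ => (hcomp _ σ).trans (hg.norm_le _ (hp σ hx))
  · intro x y hx hy
    have hsub : ∀ (c : ℝ) (A B : (ι → ℝ) →L[ℝ] ℝ), c • A - c • B = c • (A - B) :=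
      fun c A B => (smul_sub c A B).symm
    rw [hsub, ← Finset.sum_sub_distrib]
    refine norm_inv_card_smul_sum_le fun σ => ?_
    rw [← ContinuousLinearMap.sub_comp]
    refine (hcomp _ σ).trans ((hg.modulus _ _ (hp σ hx) (hp σ hy)).trans ?_)
    rw [← map_sub]
    exact hω.2.1 (norm_nonneg _) (norm_nonneg _) (norm_permCoord_le σ _)

theorem fderiv_single_eq [DecidableEq ι] (hg : IsUniformlySmooth ω L g g')
    (hsymm : ∀ (σ : Equiv.Perm ι) x, g (permCoord σ x) = g x) {x : ι → ℝ} (hx : ‖x‖ ≤ 1)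
    {i j : ι} (hij : x i = x j) : g' x (Pi.single i 1) = g' x (Pi.single j 1) := by
  set σ := Equiv.swap i j
  have hσx : permCoord σ x = x := by
    ext k
    rw [permCoord_apply]
    by_cases hki : k = i
    · simp [σ, hki, hij]
    · by_cases hkj : k = j
      · simp [σ, hkj, hij]
      · simp [σ, Equiv.swap_apply_of_ne_of_ne hki hkj]
  have h1 : HasFDerivAt (fun y => g (permCoord σ y)) ((g' x).comp (permCoord σ)) x := by
    have := hg.hasFDerivAt (permCoord σ x) (by rwa [hσx])
    rw [hσx] at this
    exact HasFDerivAt.comp x (by rwa [hσx]) (permCoord σ).hasFDerivAt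
  have h2 : (g' x).comp (permCoord σ) = g' x := by
    refine h1.unique ?_
    simpa only [hsymm] using hg.hasFDerivAt x hx
  have h3 := congrArg (fun A : (ι → ℝ) →L[ℝ] ℝ => A (Pi.single j 1)) h2
  simpa [permCoord_single, σ] using h3

theorem abs_fderiv_indicator_le [DecidableEq ι] (hg : IsUniformlySmooth ω L g g')
    (hsymm : ∀ (σ : Equiv.Perm ι) x, g (permCoord σ x) = g x) {x : ι → ℝ} (hx : ‖x‖ ≤ 1)
    {B C : Finset ι} (hCB : C ⊆ B) (hB : ∀ i ∈ B, ∀ j ∈ B, x i = x j) {N : ℕ} (hN : 0 < N)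
    (hcard : N * C.card ≤ B.card) :
    |g' x (fun i => if i ∈ C then 1 else 0)| ≤ L / N := by
  have hsum (D : Finset ι) : g' x (fun i => if i ∈ D then 1 else 0) =
      ∑ i ∈ D, g' x (Pi.single i 1) := by
    rw [← map_sum]
    congr 1
    ext i
    simp [Finset.sum_apply, Pi.single_apply]
  rcases C.eq_empty_or_nonempty with rfl | ⟨c, hc⟩
  · rw [hsum]
    simpa using div_nonneg hg.bound_nonneg N.cast_nonneg
  · set a := g' x (Pi.single c 1)
    have hconst (D : Finset ι) (hD : D ⊆ B) :
        g' x (fun i => if i ∈ D then 1 else 0) = D.card * a := by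
      rw [hsum, Finset.sum_congr rfl fun i hi =>
        hg.fderiv_single_eq hsymm hx (hB i (hD hi) c (hCB hc)), Finset.sum_const, nsmul_eq_mul]
    have hnorm : ‖(fun i => if i ∈ B then (1 : ℝ) else 0)‖ ≤ 1 :=
      (pi_norm_le_iff_of_nonneg zero_le_one).2 fun i => by split_ifs <;> simp
    have hL : B.card * |a| ≤ L := by
      have h := (g' x).le_of_opNorm_le (hg.norm_le x hx) (fun i => if i ∈ B then (1 : ℝ) else 0)
      rw [hconst B subset_rfl, Real.norm_eq_abs, abs_mul, Nat.abs_cast] at h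
      exact h.trans (mul_le_of_le_one_right hg.bound_nonneg hnorm)
    rw [hconst C hCB, abs_mul, Nat.abs_cast, le_div_iff₀ (by exact_mod_cast hN)]
    have hcard' : (N : ℝ) * C.card ≤ B.card := by exact_mod_cast hcard
    calc C.card * |a| * N = (N * C.card) * |a| := by ring
      _ ≤ B.card * |a| := by gcongr
      _ ≤ L := hL

theorem abs_sub_le_of_step [DecidableEq ι] (hω : IsModulus ω) (hg : IsUniformlySmooth ω L g g')
    (hsymm : ∀ (σ : Equiv.Perm ι) x, g (permCoord σ x) = g x) {x y : ι → ℝ} (hx : ‖x‖ ≤ 1)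
    (hy : ‖y‖ ≤ 1) {B C : Finset ι} (hCB : C ⊆ B) (hB : ∀ i ∈ B, ∀ j ∈ B, x i = x j)
    {N : ℕ} (hN : 0 < N) (hcard : N * C.card ≤ B.card) {δ : ℝ} (hδ : 0 ≤ δ)
    (hxy : ∀ i, y i = x i + if i ∈ C then δ else 0) :
    |g y - g x| ≤ δ * (L / N + ω δ) := by
  have hdiff : y - x = δ • fun i => if i ∈ C then (1 : ℝ) else 0 := by
    ext i
    simp [hxy i]
  have hnorm : ‖y - x‖ ≤ δ :=
    (pi_norm_le_iff_of_nonneg hδ).2 fun i => by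
      rw [Pi.sub_apply, hxy i]
      split_ifs <;> simp [abs_of_nonneg hδ, hδ]
  have hball {z : ι → ℝ} (hz : z ∈ segment ℝ x y) : ‖z‖ ≤ 1 := by
    simpa using (convex_closedBall (0 : ι → ℝ) 1).segment_subset (by simpa using hx)
      (by simpa using hy) hz
  have hmv : ‖g y - g x - g' x (y - x)‖ ≤ ω δ * ‖y - x‖ := by
    refine (convex_segment x y).norm_image_sub_le_of_norm_hasFDerivWithin_le' (f' := g')
      (fun z hz => (hg.hasFDerivAt z (hball hz)).hasFDerivWithinAt) (fun z hz => ?_)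
      (left_mem_segment ℝ x y) (right_mem_segment ℝ x y)
    refine (hg.modulus z x (hball hz) hx).trans (hω.2.1 (norm_nonneg _) hδ ?_)
    exact (norm_sub_le_of_mem_segment hz).trans hnorm
  have hlin : |g' x (y - x)| ≤ δ * (L / N) := by
    rw [hdiff, map_smul, smul_eq_mul, abs_mul, abs_of_nonneg hδ]
    exact mul_le_mul_of_nonneg_left
      (hg.abs_fderiv_indicator_le hsymm hx hCB hB hN hcard) hδ
  have hmv' : |g y - g x - g' x (y - x)| ≤ ω δ * δ :=
    hmv.trans (mul_le_mul_of_nonneg_left hnorm (hω.1 δ hδ))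
  have h := abs_add_le (g y - g x - g' x (y - x)) (g' x (y - x))
  rw [sub_add_cancel] at h
  linarith

end IsUniformlySmooth

open Finset in
theorem exists_geometric_levels {ι : Type*} [DecidableEq ι] (S : Finset ι) {N m : ℕ} (hN : 2 ≤ N)
    (hS : N ^ m ≤ #S) :
    ∃ r : ι → ℕ, (∀ i, r i ≤ m) ∧ ∀ k < m,
      N * #{i ∈ S | k + 1 ≤ r i} ≤ #{i ∈ S | k ≤ r i} ∧ N ≤ #{i ∈ S | r i = k} + 1 := by
  obtain ⟨q, hq⟩ : ∃ q : ι → ℕ, ∀ t ≤ #S, #{i ∈ S | q i < t} = t := by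
    refine ⟨fun i => if h : i ∈ S then S.equivFin ⟨i, h⟩ else 0, fun t ht => ?_⟩
    calc _ = #(range t) := ?_
      _ = t := card_range t
    refine card_bij (fun i _ => if h : i ∈ S then S.equivFin ⟨i, h⟩ else 0) ?_ ?_ ?_
    · intro i hi
      simpa using (mem_filter.1 hi).2
    · intro i hi i' hi' h
      simp only [(mem_filter.1 hi).1, (mem_filter.1 hi').1, dite_true] at h
      simpa using S.equivFin.injective (Fin.ext h)
    · intro b hb
      have hbt := mem_range.1 hb
      refine ⟨S.equivFin.symm ⟨b, hbt.trans_le ht⟩, ?_, ?_⟩ <;> simp [hbt]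
  set r : ι → ℕ := fun i => m - Nat.clog N (q i + 1) with hr
  have hle {k : ℕ} (hk : k < m) (i : ι) : k + 1 ≤ r i ↔ q i < N ^ (m - (k + 1)) := by
    rw [← Nat.succ_le_iff, ← Nat.clog_le_iff_le_pow (by omega : 1 < N)]
    simp only [hr, Nat.succ_eq_add_one]
    omega
  have hcard {k : ℕ} (hk : k < m) : #{i ∈ S | k + 1 ≤ r i} = N ^ (m - (k + 1)) := by
    simp only [hle hk]
    exact hq _ ((Nat.pow_le_pow_right (by omega) (Nat.sub_le _ _)).trans hS)
  have hge {k : ℕ} (hk : k < m) : N * N ^ (m - (k + 1)) ≤ #{i ∈ S | k ≤ r i} := by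
    rw [← pow_succ', show m - (k + 1) + 1 = m - k by omega]
    cases k with
    | zero => simpa using hS
    | succ k => rw [hcard (by omega)]
  refine ⟨r, fun i => Nat.sub_le _ _, fun k hk => ⟨by rw [hcard hk]; exact hge hk, ?_⟩⟩
  have hsplit : #{i ∈ S | k ≤ r i} ≤ #{i ∈ S | r i = k} + #{i ∈ S | k + 1 ≤ r i} := by
    refine le_trans (card_le_card fun i hi => ?_) (card_union_le _ _)
    simp only [mem_union, mem_filter] at hi ⊢
    have := hi.2
    rcases this.eq_or_lt with h | h
    · exact Or.inl ⟨hi.1, h.symm⟩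
    · exact Or.inr ⟨hi.1, h⟩
  have hpos : 1 ≤ N ^ (m - (k + 1)) := Nat.one_le_pow _ _ (by omega)
  have := hge hk
  rw [hcard hk] at hsplit
  nlinarith

theorem abs_sub_le_mul_of_steps {u : ℕ → ℝ} {m : ℕ} {c : ℝ}
    (h : ∀ k < m, |u (k + 1) - u k| ≤ c) : |u m - u 0| ≤ m * c := by
  have := dist_le_range_sum_of_dist_le (f := u) m (d := fun _ => c) fun {k} hk => by
    rw [dist_comm]
    exact h k hk
  rw [dist_comm] at this
  simpa [Real.dist_eq] using this

namespace IsUniformlySmooth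

variable {ι : Type*} [Fintype ι] [DecidableEq ι] {ω : ℝ → ℝ} {L : ℝ} {g : (ι → ℝ) → ℝ}
  {g' : (ι → ℝ) → ((ι → ℝ) →L[ℝ] ℝ)}

open Finset in
theorem abs_single_sub_le_of_symm (hω : IsModulus ω) (hg : IsUniformlySmooth ω L g g')
    (hsymm : ∀ (σ : Equiv.Perm ι) x, g (permCoord σ x) = g x) {N m : ℕ} (hN : 2 ≤ N)
    (hm : 0 < m) (hcard : N ^ m + 1 ≤ Fintype.card ι) (j : ι) :
    |g (Pi.single j 1) - g 0| ≤ 3 * (L / N + ω (1 / m)) := by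
  obtain ⟨r, hrm, hr⟩ := exists_geometric_levels (univ.erase j) hN
    (m := m) (by rw [card_erase_of_mem (mem_univ j), card_univ]; omega)
  have hm0 : (0 : ℝ) < m := by exact_mod_cast hm
  set δ : ℝ := 1 / m with hδdef
  have hδ : 0 ≤ δ := by positivity
  have hmδ : m * δ = 1 := by rw [hδdef]; field_simp
  have hmin {k : ℕ} (hk : k ≤ m) : |k * δ| ≤ 1 := by
    rw [abs_of_nonneg (by positivity), ← hmδ]
    gcongr
  let z (a : ℝ) (b : ℕ) (i : ι) : ℝ := if i = j then a else (min (r i) b : ℕ) * δ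
  have hz {a : ℝ} (ha : |a| ≤ 1) (b : ℕ) : ‖z a b‖ ≤ 1 := by
    refine (pi_norm_le_iff_of_nonneg zero_le_one).2 fun i => ?_
    simp only [z, Real.norm_eq_abs]
    split_ifs
    · exact ha
    · exact hmin ((min_le_left _ _).trans (hrm i))
  have hmc (c : ℝ) : m * (δ * c) = c := by rw [← mul_assoc, hmδ, one_mul]
  have hbulk {a : ℝ} (ha : |a| ≤ 1) : |g (z a m) - g (z a 0)| ≤ L / N + ω δ := by
    rw [← hmc (L / N + ω δ)]
    refine abs_sub_le_mul_of_steps (u := fun k => g (z a k)) fun k hk => ?_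
    refine hg.abs_sub_le_of_step hω hsymm (hz ha k) (hz ha (k + 1))
      (B := {i ∈ univ.erase j | k ≤ r i}) (C := {i ∈ univ.erase j | k + 1 ≤ r i})
      (monotone_filter_right _ fun i _ hi => by omega) ?_ (by omega) (hr k hk).1 hδ ?_
    · intro i hi i' hi'
      simp only [mem_filter, mem_erase] at hi hi'
      simp only [z, hi.1.1, hi'.1.1, if_false, min_eq_right hi.2, min_eq_right hi'.2]
    · intro i
      by_cases hij : i = j
      · simp [z, hij]
      · by_cases hk' : k + 1 ≤ r i
        · simp only [z, hij, mem_filter, mem_erase, mem_univ, hk', min_eq_right hk',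
            min_eq_right (Nat.le_of_succ_le hk')]
          simp [hij, add_mul]
        · simp only [z, hij, mem_filter, hk', min_eq_left (by omega : r i ≤ k),
            min_eq_left (by omega : r i ≤ k + 1)]
          simp
  have hcoord : |g (z 1 m) - g (z 0 m)| ≤ L / N + ω δ := by
    have h := abs_sub_le_mul_of_steps (u := fun k => g (z (k * δ) m)) (m := m)
      (c := δ * (L / N + ω δ)) fun k hk => by
        refine hg.abs_sub_le_of_step hω hsymm (hz (hmin hk.le) m) (hz (hmin hk) m)
          (B := insert j {i ∈ univ.erase j | r i = k}) (C := {j}) (by simp) ?_ (by omega) ?_ hδ ?_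
        · have hval : ∀ i ∈ insert j {i ∈ univ.erase j | r i = k}, z (k * δ) m i = k * δ := by
            intro i hi
            simp only [mem_insert, mem_filter] at hi
            by_cases hij : i = j
            · simp [z, hij]
            · have hik : r i = k := (hi.resolve_left hij).2
              simp [z, hij, hik, hk.le]
          intro i hi i' hi'
          rw [hval i hi, hval i' hi']
        · rw [card_insert_of_notMem (by simp), card_singleton, mul_one]
          exact (hr k hk).2
        · intro i
          by_cases hij : i = j
          · simp [z, hij, add_mul]
          · simp [z, hij]
    simpa [hmc, hmδ] using h
  have h0 : z 0 0 = 0 := by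
    ext i
    simp [z]
  have h1 : z 1 0 = Pi.single j 1 := by
    ext i
    simp [z, Pi.single_apply]
  have hb0 := hbulk (a := 0) (by simp)
  have hb1 := hbulk (a := 1) (by simp)
  rw [h0] at hb0
  rw [h1] at hb1
  rw [abs_le] at hb0 hb1 hcoord ⊢
  constructor <;> linarith [hb0.1, hb0.2, hb1.1, hb1.2, hcoord.1, hcoord.2]

theorem abs_sum_single_sub_le (hω : IsModulus ω) (hg : IsUniformlySmooth ω L g g') {N m : ℕ}
    (hN : 2 ≤ N) (hm : 0 < m) (hcard : N ^ m + 1 ≤ Fintype.card ι) :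
    |∑ j, (g (Pi.single j 1) - g 0)| ≤ Fintype.card ι * (3 * (L / N + ω (1 / m))) := by
  obtain ⟨h', hh⟩ := hg.exists_symmetrize hω
  have hsum : ∑ j, (g (Pi.single j 1) - g 0) =
      ∑ j, (symmetrize g (Pi.single j 1) - symmetrize g 0) := by
    rw [Finset.sum_sub_distrib, Finset.sum_sub_distrib, sum_symmetrize_single, symmetrize_zero]
  rw [hsum]
  refine (Finset.abs_sum_le_sum_abs _ _).trans ((Finset.sum_le_card_nsmul _ _ _ fun j _ =>
    hh.abs_single_sub_le_of_symm hω (symmetrize_permCoord g) hN hm hcard j).trans_eq ?_)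
  rw [Finset.card_univ, nsmul_eq_mul]

end IsUniformlySmooth

/-- The diagonal operator on `ℓ∞(ι)` with entries `d`. -/
def diagCoord {ι : Type*} (d : ι → ℝ) : (ι → ℝ) →L[ℝ] (ι → ℝ) :=
  ContinuousLinearMap.pi fun i => d i • ContinuousLinearMap.proj i

theorem diagCoord_apply {ι : Type*} (d x : ι → ℝ) (i : ι) : diagCoord d x i = d i * x i := rfl

theorem diagCoord_single {ι : Type*} [DecidableEq ι] (d : ι → ℝ) (j : ι) :
    diagCoord d (Pi.single j 1) = d j • (Pi.single j 1 : ι → ℝ) := by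
  ext i
  by_cases hij : i = j
  · simp [diagCoord_apply, hij]
  · simp [diagCoord_apply, hij]

theorem norm_diagCoord_le {ι : Type*} [Fintype ι] {d : ι → ℝ} {c : ℝ} (hc : 0 ≤ c)
    (hd : ∀ i, |d i| ≤ c) (x : ι → ℝ) : ‖diagCoord d x‖ ≤ c * ‖x‖ :=
  (pi_norm_le_iff_of_nonneg (by positivity)).2 fun i => by
    rw [diagCoord_apply, norm_mul]
    exact mul_le_mul (hd i) (norm_le_pi_norm x i) (norm_nonneg _) hc

theorem isUniformlySmooth_comp_diagCoord {ι : Type*} [Fintype ι] {ω : ℝ → ℝ} (hω : IsModulus ω)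
    {L : ℝ} (hL : 0 ≤ L) {f : (ι → ℝ) → ℝ} {f' : (ι → ℝ) → ((ι → ℝ) →L[ℝ] ℝ)}
    (hlip : ∀ x ∈ closedBall (0 : ι → ℝ) 1, ∀ y ∈ closedBall (0 : ι → ℝ) 1,
      ‖f x - f y‖ ≤ L * ‖x - y‖)
    (hf : ∀ x ∈ ball (0 : ι → ℝ) 1, HasFDerivAt f (f' x) x)
    (hf' : ∀ x ∈ ball (0 : ι → ℝ) 1, ∀ y ∈ ball (0 : ι → ℝ) 1, ‖f' x - f' y‖ ≤ ω ‖x - y‖)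
    {d : ι → ℝ} {c : ℝ} (hc0 : 0 ≤ c) (hc1 : c < 1) (hd : ∀ i, |d i| ≤ c) :
    IsUniformlySmooth ω L (fun x => f (diagCoord d x))
      fun x => (f' (diagCoord d x)).comp (diagCoord d) := by
  have hle (x : ι → ℝ) : ‖diagCoord d x‖ ≤ ‖x‖ :=
    (norm_diagCoord_le hc0 hd x).trans (mul_le_of_le_one_left (norm_nonneg _) hc1.le)
  have hop : ‖(diagCoord d : (ι → ℝ) →L[ℝ] (ι → ℝ))‖ ≤ 1 :=
    ContinuousLinearMap.opNorm_le_bound _ zero_le_one fun x => by simpa using hle x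
  have hcomp (A : (ι → ℝ) →L[ℝ] ℝ) : ‖A.comp (diagCoord d)‖ ≤ ‖A‖ :=
    (A.opNorm_comp_le _).trans (mul_le_of_le_one_right (norm_nonneg _) hop)
  have hmem {x : ι → ℝ} (hx : ‖x‖ ≤ 1) : diagCoord d x ∈ ball (0 : ι → ℝ) 1 := by
    rw [mem_ball_zero_iff]
    exact ((norm_diagCoord_le hc0 hd x).trans (mul_le_of_le_one_right hc0 hx)).trans_lt hc1
  refine ⟨fun x hx => (hf _ (hmem hx)).comp x (diagCoord d).hasFDerivAt, fun x hx => ?_,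
    fun x y hx hy => ?_⟩
  · refine (hcomp _).trans ((hf _ (hmem hx)).le_of_lip' hL ?_)
    filter_upwards [isOpen_ball.mem_nhds (hmem hx)] with y hy
    exact hlip y (ball_subset_closedBall hy) _ (ball_subset_closedBall (hmem hx))
  · rw [← ContinuousLinearMap.sub_comp]
    refine (hcomp _).trans ((hf' _ (hmem hx) _ (hmem hy)).trans ?_)
    rw [← map_sub]
    exact hω.2.1 (norm_nonneg _) (norm_nonneg _) (hle _)

/-- For each modulus `ω`, every `L > 0` and every `ε > 0` there is `M` such that for
`n ≥ M`, every `L`-Lipschitz function `f ∈ C^{1,+}(B_{ℓ∞^n})` whose derivative has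
modulus of continuity `ω` is almost constant (up to `ε`) along some segment
`[-e_j, e_j]`. -/
theorem exists_flat_coordinate (ω : ℝ → ℝ) (hω : IsModulus ω)
    (L ε : ℝ) (hL : 0 < L) (hε : 0 < ε) :
    ∃ M : ℕ, ∀ n : ℕ, M ≤ n →
      ∀ (f : (Fin n → ℝ) → ℝ) (f' : (Fin n → ℝ) → ((Fin n → ℝ) →L[ℝ] ℝ)),
        ContinuousOn f (closedBall 0 1) →
        (∀ x ∈ closedBall (0 : Fin n → ℝ) 1, ∀ y ∈ closedBall (0 : Fin n → ℝ) 1,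
          ‖f x - f y‖ ≤ L * ‖x - y‖) →
        (∀ x ∈ ball (0 : Fin n → ℝ) 1, HasFDerivAt f (f' x) x) →
        (∀ x ∈ ball (0 : Fin n → ℝ) 1, ∀ y ∈ ball (0 : Fin n → ℝ) 1,
          ‖f' x - f' y‖ ≤ ω ‖x - y‖) →
        ∃ j : Fin n, ∀ η : ℝ, |η| ≤ 1 →
          |f (η • (Pi.single j 1 : Fin n → ℝ)) - f 0| < ε := by
  obtain ⟨N, hN2, hN⟩ : ∃ N : ℕ, 2 ≤ N ∧ L / N < ε / 32 := by
    have h := (tendsto_const_div_atTop_nhds_zero_nat L).eventually_lt_const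
      (by positivity : 0 < ε / 32)
    exact ((Filter.eventually_ge_atTop 2).and h).exists
  obtain ⟨m, hm, hωm⟩ : ∃ m : ℕ, 0 < m ∧ ω (1 / m) < ε / 32 := by
    have h0 : Filter.Tendsto (fun m : ℕ => 1 / (m : ℝ)) Filter.atTop
        (nhdsWithin 0 (Set.Ici 0)) :=
      tendsto_nhdsWithin_iff.2 ⟨tendsto_const_div_atTop_nhds_zero_nat 1,
        Filter.Eventually.of_forall fun m => by simp⟩
    have h := hω.2.2.2.tendsto.comp h0
    rw [hω.2.2.1] at h
    exact ((Filter.eventually_gt_atTop 0).and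
      (h.eventually_lt_const (by positivity : 0 < ε / 32))).exists
  refine ⟨N ^ m + 1, fun n hn f f' _ hlip hf hf' => ?_⟩
  by_contra! hcon
  choose η hη hε' using hcon
  obtain ⟨c, hc0, hc1, hcL⟩ : ∃ c : ℝ, 0 ≤ c ∧ c < 1 ∧ (1 - c) * L ≤ ε / 2 := by
    have hp : 0 < min (1 : ℝ) (ε / (2 * L)) := by positivity
    refine ⟨1 - min 1 (ε / (2 * L)), by simp, by linarith, ?_⟩
    rw [sub_sub_cancel]
    calc min 1 (ε / (2 * L)) * L ≤ ε / (2 * L) * L := by gcongr; exact min_le_right _ _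
      _ = ε / 2 := by field_simp
  set v : Fin n → ℝ := fun j => f ((c * η j) • (Pi.single j 1 : Fin n → ℝ)) - f 0
  have hv (j : Fin n) : ε / 2 ≤ |v j| := by
    have hmem {a : ℝ} (ha : |a| ≤ 1) :
        a • (Pi.single j 1 : Fin n → ℝ) ∈ closedBall (0 : Fin n → ℝ) 1 := by
      rw [mem_closedBall_zero_iff, norm_smul, Pi.norm_single]
      simpa using ha
    have hcη : |c * η j| ≤ 1 := by
      rw [abs_mul, abs_of_nonneg hc0]
      exact mul_le_one₀ hc1.le (abs_nonneg _) (hη j)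
    have h := hlip _ (hmem (hη j)) _ (hmem hcη)
    rw [← sub_smul, norm_smul, Pi.norm_single, norm_one, mul_one,
      show η j - c * η j = (1 - c) * η j by ring, norm_mul, Real.norm_eq_abs, Real.norm_eq_abs,
      Real.norm_eq_abs, abs_of_pos (sub_pos.2 hc1)] at h
    have h2 : L * ((1 - c) * |η j|) ≤ ε / 2 := by
      refine le_trans ?_ hcL
      rw [mul_comm]
      exact mul_le_mul_of_nonneg_right
        (mul_le_of_le_one_right (sub_pos.2 hc1).le (hη j)) hL.le
    have h3 := abs_sub_le (f (η j • Pi.single j 1)) (f ((c * η j) • Pi.single j 1)) (f 0)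
    have h4 := hε' j
    simp only [v]
    linarith
  have hbound (s : Finset (Fin n)) : |∑ j ∈ s, v j| ≤ n * (3 * (ε / 16)) := by
    set d : Fin n → ℝ := fun j => if j ∈ s then c * η j else 0 with hd
    have hdc (j : Fin n) : |d j| ≤ c := by
      simp only [hd]
      split_ifs
      · rw [abs_mul, abs_of_nonneg hc0]
        exact mul_le_of_le_one_right hc0 (hη j)
      · simpa using hc0
    have h := (isUniformlySmooth_comp_diagCoord hω hL.le hlip hf hf' hc0 hc1
      hdc).abs_sum_single_sub_le hω hN2 hm (by simpa using hn)
    have hsum : ∑ j, (f (diagCoord d (Pi.single j 1)) - f (diagCoord d 0)) = ∑ j ∈ s, v j := by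
      rw [← Finset.sum_filter_add_sum_filter_not Finset.univ (· ∈ s)]
      rw [Finset.sum_eq_zero (s := Finset.univ.filter (· ∉ s)), add_zero]
      · rw [Finset.filter_univ_mem]
        refine Finset.sum_congr rfl fun j hj => ?_
        simp [diagCoord_single, hd, hj, v]
      · intro j hj
        have hj' := (Finset.mem_filter.1 hj).2
        simp [diagCoord_single, hd, hj']
    rw [hsum, Fintype.card_fin] at h
    refine h.trans ?_
    gcongr
    linarith
  have hpos := (abs_le.1 (hbound (Finset.univ.filter (0 ≤ v ·)))).2
  have hneg := (abs_le.1 (hbound (Finset.univ.filter (¬ 0 ≤ v ·)))).1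
  have habs : ∑ j, |v j| = ∑ j with 0 ≤ v j, v j - ∑ j with ¬ 0 ≤ v j, v j := by
    rw [← Finset.sum_filter_add_sum_filter_not Finset.univ (0 ≤ v ·), sub_eq_add_neg,
      ← Finset.sum_neg_distrib]
    congr 1
    · exact Finset.sum_congr rfl fun j hj => abs_of_nonneg (Finset.mem_filter.1 hj).2
    · exact Finset.sum_congr rfl fun j hj =>
        abs_of_neg (not_le.1 (Finset.mem_filter.1 hj).2)
  have hlow : n * (ε / 2) ≤ ∑ j, |v j| := by
    simpa using Finset.card_nsmul_le_sum Finset.univ (fun j => |v j|) (ε / 2) fun j _ => hv j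
  have hn0 : (0 : ℝ) < n := by
    exact_mod_cast (Nat.succ_pos _).trans_le hn
  nlinarith [mul_pos hn0 hε]
end

section
/- For each modulus ω, every L > 0 and every ε > 0, there is a natural number N(ω, L, ε) such that: if n ≥ N(ω, L, ε), Γ is an infinite regular cardinal, and f : B_{ℓ∞(Γ)} → ℝ is an L-Lipschitz function, continuous on the closed unit ball, Fréchet differentiable on the open unit ball, whose derivative df has modulus of continuity ω, then given any vectors v_1, …, v_n in B_{ℓ∞(Γ)} with pairwise disjoint supports (supp(v_k) ∩ supp(v_l) = ∅ for k ≠ l), there exists k ∈ {3, …, n} such that |f(λ v_1 + μ v_2 + η v_k) − f(λ v_1 + μ v_2)| < ε whenever |λ|, |μ|, |η| ≤ 1. -/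
open Metric

/-- A linear functional invariant under the permutations fixing `y` takes small values on indicators
of small subsets of a level set of `y`. -/
theorem abs_apply_indicator_le_of_symmetric {ι : Type*} [Fintype ι] [DecidableEq ι]
    {φ : (ι → ℝ) →ₗ[ℝ] ℝ} {y : ι → ℝ} {L : ℝ} (hL0 : 0 ≤ L)
    (hsym : ∀ σ : Equiv.Perm ι, y ∘ σ = y → ∀ h, φ (h ∘ σ) = φ h)
    (hL : ∀ h, |φ h| ≤ L * ‖h‖) {A B : Finset ι} (hBA : B ⊆ A) {c : ℝ} (hA : ∀ i ∈ A, y i = c)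
    {q : ℕ} (hq : 0 < q) (hcard : B.card * q ≤ A.card) :
    |φ (∑ i ∈ B, Pi.single i 1)| ≤ L / q := by
  rcases A.eq_empty_or_nonempty with rfl | ⟨a, ha⟩
  · obtain rfl : B = ∅ := Finset.subset_empty.1 hBA
    simp only [Finset.sum_empty, map_zero, abs_zero]
    positivity
  have heq : ∀ i ∈ A, φ (Pi.single i 1) = φ (Pi.single a 1) := by
    intro i hi
    rw [← hsym (Equiv.swap a i) ?_ (Pi.single a 1)]
    · congr 1
      ext j
      simp only [Function.comp, Pi.single_apply]
      congr 1
      rw [Equiv.swap_apply_eq_iff, Equiv.swap_apply_left]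
    · ext j
      simp only [Function.comp]
      rcases eq_or_ne j a with rfl | h1
      · rw [Equiv.swap_apply_left, hA _ hi, hA _ ha]
      rcases eq_or_ne j i with rfl | h2
      · rw [Equiv.swap_apply_right, hA _ hi, hA _ ha]
      rw [Equiv.swap_apply_of_ne_of_ne h1 h2]
  have hsum : ∀ C ⊆ A, φ (∑ i ∈ C, Pi.single i 1) = C.card * φ (Pi.single a 1) := by
    intro C hC
    rw [map_sum, Finset.sum_congr rfl fun i hi => heq i (hC hi)]
    simp
  have hnorm : ‖∑ i ∈ A, (Pi.single i 1 : ι → ℝ)‖ ≤ 1 := by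
    refine (pi_norm_le_iff_of_nonneg zero_le_one).2 fun j => ?_
    rw [Finset.sum_apply]
    simp only [Pi.single_apply, Finset.sum_ite_eq]
    split_ifs <;> simp
  have hAL : |φ (∑ i ∈ A, Pi.single i 1)| ≤ L :=
    (hL _).trans (mul_le_of_le_one_right hL0 hnorm)
  rw [hsum A subset_rfl, abs_mul, Nat.abs_cast] at hAL
  rw [hsum B hBA, abs_mul, Nat.abs_cast, le_div_iff₀ (by positivity)]
  have : (B.card * q : ℝ) ≤ A.card := by exact_mod_cast hcard
  nlinarith [mul_le_mul_of_nonneg_right this (abs_nonneg (φ (Pi.single a 1)))]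

/-- A uniformly smooth symmetric function varies little along a staircase built on rapidly shrinking
nested sets of coordinates. -/
theorem abs_sub_le_of_staircase {ι : Type*} [Fintype ι] [DecidableEq ι]
    {F : (ι → ℝ) → ℝ} {D : (ι → ℝ) → (ι → ℝ) →ₗ[ℝ] ℝ} {L κ d ρ : ℝ} (hL0 : 0 ≤ L)
    (hsym : ∀ (σ : Equiv.Perm ι) y h, D (y ∘ σ) (h ∘ σ) = D y h)
    (hL : ∀ y, ‖y‖ ≤ ρ → ∀ h, |D y h| ≤ L * ‖h‖)
    (hT : ∀ y h, ‖y‖ ≤ ρ → ‖y + h‖ ≤ ρ → ‖h‖ ≤ |d| → |F (y + h) - F y - D y h| ≤ κ * |d|)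
    {K : ℕ} (hKd : K * |d| ≤ ρ) {q : ℕ} (hq : 0 < q) {A : ℕ → Finset ι} (hA : Antitone A)
    (hcard : ∀ j < K, (A (j + 1)).card * q ≤ (A j).card)
    {y : ι → ℝ} (hy : ‖y‖ ≤ ρ) (hyA : ∀ i ∈ A 0, y i = 0) :
    |F (y + d • ∑ l ∈ Finset.range K, ∑ i ∈ A (l + 1), Pi.single i 1) - F y| ≤
      K * |d| * (L / q + κ) := by
  set S : ℕ → ι → ℝ :=
    fun j => y + d • ∑ l ∈ Finset.range j, ∑ i ∈ A (l + 1), Pi.single i 1 with hS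
  have hρ : 0 ≤ ρ := (norm_nonneg _).trans hy
  have hind : ∀ l j, (∑ i ∈ A l, (Pi.single i 1 : ι → ℝ)) j = if j ∈ A l then 1 else 0 := by
    intro l j
    rw [Finset.sum_apply]
    simp only [Pi.single_apply, Finset.sum_ite_eq]
  have happ : ∀ j i, S j i = y i + d * ∑ l ∈ Finset.range j, if i ∈ A (l + 1) then 1 else 0 := by
    intro j i
    simp only [hS, Pi.add_apply, Pi.smul_apply, smul_eq_mul, Finset.sum_apply (a := i)
      (s := Finset.range j), hind]
  have hlevel : ∀ j, ∀ i ∈ A j, S j i = d * j := by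
    intro j i hi
    rw [happ, hyA i (hA (Nat.zero_le j) hi), Finset.sum_congr rfl fun l hl =>
      if_pos (hA (Nat.succ_le_of_lt (Finset.mem_range.1 hl)) hi)]
    simp
  have hSnorm : ∀ j ≤ K, ‖S j‖ ≤ ρ := by
    intro j hj
    refine (pi_norm_le_iff_of_nonneg hρ).2 fun i => ?_
    rw [happ]
    by_cases hi : i ∈ A 0
    · rw [hyA i hi, zero_add, norm_mul, Real.norm_eq_abs]
      have h1 : ‖∑ l ∈ Finset.range j, if i ∈ A (l + 1) then (1 : ℝ) else 0‖ ≤ K := by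
        refine (norm_sum_le_of_le (n := fun _ => 1) _ fun l _ => ?_).trans ?_
        · split_ifs <;> simp
        · simpa using hj
      calc _ ≤ |d| * K := by gcongr
        _ ≤ ρ := by linarith
    · rw [Finset.sum_congr rfl fun l _ => if_neg fun h => hi (hA (Nat.zero_le _) h)]
      simpa using (norm_le_pi_norm y i).trans hy
  have hstep : ∀ j < K, |F (S (j + 1)) - F (S j)| ≤ |d| * (L / q + κ) := by
    intro j hj
    have hsucc : S (j + 1) = S j + d • ∑ i ∈ A (j + 1), Pi.single i 1 := by
      simp only [hS, Finset.sum_range_succ, smul_add, add_assoc]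
    have hn : ‖d • ∑ i ∈ A (j + 1), (Pi.single i 1 : ι → ℝ)‖ ≤ |d| := by
      rw [norm_smul, Real.norm_eq_abs]
      refine mul_le_of_le_one_right (abs_nonneg _)
        ((pi_norm_le_iff_of_nonneg zero_le_one).2 fun i => ?_)
      rw [hind]
      split_ifs <;> simp
    have h1 := hT (S j) _ (hSnorm j hj.le) (hsucc ▸ hSnorm (j + 1) hj) hn
    have h2 := abs_apply_indicator_le_of_symmetric (φ := D (S j)) hL0
      (fun σ hσ h => by rw [← hsym σ (S j) h, hσ]) (hL _ (hSnorm j hj.le))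
      (hA (Nat.le_succ j)) (hlevel j) hq (hcard j hj)
    rw [← hsucc, map_smul, smul_eq_mul] at h1
    have h3 : |d * D (S j) (∑ i ∈ A (j + 1), Pi.single i 1)| ≤ |d| * (L / q) := by
      rw [abs_mul]
      gcongr
    rw [abs_le] at h1 h3 ⊢
    constructor <;> linarith
  have hall : ∀ j ≤ K, |F (S j) - F y| ≤ j * (|d| * (L / q + κ)) := by
    intro j
    induction j with
    | zero => intro _; simp [hS]
    | succ j ih =>
      intro hj
      refine (abs_sub_le _ (F (S j)) _).trans ?_
      have h1 := hstep j hj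
      have h2 := ih (Nat.le_of_succ_le hj)
      push_cast
      linarith
  rw [mul_assoc]
  exact hall K le_rfl

/-- A uniformly smooth symmetric function of many variables is almost constant on the axes. -/
theorem abs_single_sub_zero_le_of_symmetric {q K : ℕ} (hq : 0 < q) (hK : 0 < K)
    {F : (Fin (q ^ K) → ℝ) → ℝ} {D : (Fin (q ^ K) → ℝ) → (Fin (q ^ K) → ℝ) →ₗ[ℝ] ℝ}
    {L κ η ρ : ℝ} (hL0 : 0 ≤ L)
    (hsym : ∀ (σ : Equiv.Perm (Fin (q ^ K))) y h, D (y ∘ σ) (h ∘ σ) = D y h)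
    (hL : ∀ y, ‖y‖ ≤ ρ → ∀ h, |D y h| ≤ L * ‖h‖)
    (hT : ∀ y h, ‖y‖ ≤ ρ → ‖y + h‖ ≤ ρ → ‖h‖ ≤ |η / K| →
      |F (y + h) - F y - D y h| ≤ κ * |η / K|)
    (hη : |η| ≤ ρ) :
    |F (Pi.single ⟨0, pow_pos hq K⟩ η) - F 0| ≤ 2 * (|η| * (L / q + κ)) := by
  set o : Fin (q ^ K) := ⟨0, pow_pos hq K⟩ with ho
  set A : ℕ → Finset (Fin (q ^ K)) :=
    fun j => Finset.univ.filter fun i => (i : ℕ) < q ^ (K - j) with hAdef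
  have hA : Antitone A := by
    intro a b hab i hi
    simp only [hAdef, Finset.mem_filter, Finset.mem_univ, true_and] at hi ⊢
    exact hi.trans_le (Nat.pow_le_pow_right hq (by omega))
  have hoA : ∀ j, o ∈ A j := fun j => by simp [hAdef, ho, hq]
  have hAcard : ∀ j, (A j).card = q ^ (K - j) := by
    intro j
    simp only [hAdef]
    rw [Fin.card_filter_val_lt]
    exact min_eq_right (Nat.pow_le_pow_right hq (by omega))
  have hcard : ∀ j < K, (A (j + 1)).card * q ≤ (A j).card := by
    intro j hj
    rw [hAcard, hAcard, ← pow_succ, show K - (j + 1) + 1 = K - j by omega]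
  have hcard' : ∀ j < K, ((A (j + 1)).erase o).card * q ≤ ((A j).erase o).card := by
    intro j hj
    rw [Finset.card_erase_of_mem (hoA _), Finset.card_erase_of_mem (hoA _), Nat.sub_mul]
    have := hcard j hj
    omega
  have hK' : (K : ℝ) ≠ 0 := by positivity
  have hKd : K * |η / K| = |η| := by
    rw [abs_div, Nat.abs_cast]
    field_simp
  have h1 := abs_sub_le_of_staircase hL0 hsym hL hT (hKd.trans_le hη) hq hA hcard
    (y := 0) (by simpa using (abs_nonneg _).trans hη) (by simp)
  have h2 := abs_sub_le_of_staircase hL0 hsym hL hT (hKd.trans_le hη) hq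
    (A := fun j => (A j).erase o) (fun a b hab => Finset.erase_subset_erase _ (hA hab)) hcard'
    (y := Pi.single o η) (by rwa [Pi.norm_single])
    (fun i hi => Pi.single_eq_of_ne (Finset.ne_of_mem_erase hi) _)
  have hend : (Pi.single o η : Fin (q ^ K) → ℝ) + (η / K) • ∑ l ∈ Finset.range K,
        ∑ i ∈ (A (l + 1)).erase o, Pi.single i 1 =
      0 + (η / K) • ∑ l ∈ Finset.range K, ∑ i ∈ A (l + 1), Pi.single i 1 := by
    have : ∀ l, ∑ i ∈ A (l + 1), (Pi.single i 1 : Fin (q ^ K) → ℝ) =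
        ∑ i ∈ (A (l + 1)).erase o, Pi.single i 1 + Pi.single o 1 := fun l =>
      (Finset.sum_erase_add _ _ (hoA _)).symm
    simp only [this, Finset.sum_add_distrib, Finset.sum_const, Finset.card_range, smul_add]
    rw [zero_add, add_comm]
    congr 1
    ext i
    rcases eq_or_ne i o with rfl | hi
    · simp [div_mul_cancel₀ _ hK']
    · simp [hi]
  rw [hend, hKd] at h2
  rw [hKd] at h1
  rw [abs_le] at h1 h2 ⊢
  constructor <;> linarith

/-- A uniformly smooth function cannot increase much in each of many directions spanning a copy of a
finite-dimensional sup-norm space. -/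
theorem exists_apply_add_smul_sub_le {E : Type*} [NormedAddCommGroup E] [NormedSpace ℝ E]
    {f : E → ℝ} {f' : E → E →L[ℝ] ℝ} {L κ δ ρ : ℝ} (hL0 : 0 ≤ L) (hκ : 0 ≤ κ)
    (hL : ∀ p ∈ ball (0 : E) 1, ‖f' p‖ ≤ L)
    (hT : ∀ p ∈ ball (0 : E) 1, ∀ h, p + h ∈ ball (0 : E) 1 → ‖h‖ ≤ δ →
      |f (p + h) - f p - f' p h| ≤ κ * ‖h‖)
    {q K : ℕ} (hq : 0 < q) (hK : 0 < K) {x : E} {u : Fin (q ^ K) → E}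
    (hxu : ∀ a : Fin (q ^ K) → ℝ, ‖a‖ ≤ ρ → x + ∑ i, a i • u i ∈ ball (0 : E) 1)
    (hu : ∀ a : Fin (q ^ K) → ℝ, ‖∑ i, a i • u i‖ ≤ ‖a‖)
    {η : ℝ} (hη : |η| ≤ ρ) (hδ : |η / K| ≤ δ) :
    ∃ i, f (x + η • u i) - f x ≤ 2 * (|η| * (L / q + κ)) := by
  by_contra! hcon
  set T := Fintype.linearCombination ℝ u with hTdef
  have hTa : ∀ a, T a = ∑ i, a i • u i := fun a => Fintype.linearCombination_apply ℝ u a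
  simp only [← hTa] at hxu hu
  set N : ℝ := (Fintype.card (Equiv.Perm (Fin (q ^ K))) : ℝ) with hN
  have hN0 : 0 < N := by
    rw [hN]
    exact_mod_cast Fintype.card_pos
  have hperm : ∀ (σ : Equiv.Perm (Fin (q ^ K))) (y : Fin (q ^ K) → ℝ), ‖y ∘ σ‖ ≤ ‖y‖ :=
    fun σ y => (pi_norm_le_iff_of_nonneg (norm_nonneg _)).2 fun i => norm_le_pi_norm y (σ i)
  set F : (Fin (q ^ K) → ℝ) → ℝ := fun y => ∑ σ : Equiv.Perm (Fin (q ^ K)), f (x + T (y ∘ σ))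
    with hF
  set D : (Fin (q ^ K) → ℝ) → (Fin (q ^ K) → ℝ) →ₗ[ℝ] ℝ := fun y =>
    ∑ σ : Equiv.Perm (Fin (q ^ K)),
      (f' (x + T (y ∘ σ))).toLinearMap ∘ₗ T ∘ₗ LinearMap.funLeft ℝ ℝ σ with hD
  have hDa : ∀ y h, D y h = ∑ σ : Equiv.Perm (Fin (q ^ K)), f' (x + T (y ∘ σ)) (T (h ∘ σ)) := by
    intro y h
    simp only [hD, LinearMap.sum_apply]
    rfl
  have hsum : ∀ (g : Equiv.Perm (Fin (q ^ K)) → ℝ) (C : ℝ), (∀ σ, |g σ| ≤ C) →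
      |∑ σ, g σ| ≤ N * C := by
    intro g C hg
    refine (Finset.abs_sum_le_sum_abs _ _).trans ((Finset.sum_le_sum fun σ _ => hg σ).trans ?_)
    simp [hN]
  have key := abs_single_sub_zero_le_of_symmetric hq hK (F := F) (D := D) (L := N * L)
    (κ := N * κ) (η := η) (ρ := ρ) (by positivity) ?_ ?_ ?_ hη
  · have hlt : N * (2 * (|η| * (L / q + κ))) <
        F (Pi.single ⟨0, pow_pos hq K⟩ η) - F 0 := by
      have hlt' : ∑ _σ : Equiv.Perm (Fin (q ^ K)), 2 * (|η| * (L / q + κ)) <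
          ∑ σ : Equiv.Perm (Fin (q ^ K)),
            (f (x + T ((Pi.single ⟨0, pow_pos hq K⟩ η : Fin (q ^ K) → ℝ) ∘ σ)) -
              f (x + T ((0 : Fin (q ^ K) → ℝ) ∘ σ))) := by
        refine Finset.sum_lt_sum_of_nonempty Finset.univ_nonempty fun σ _ => ?_
        have h1 : (Pi.single ⟨0, pow_pos hq K⟩ η : Fin (q ^ K) → ℝ) ∘ σ =
            Pi.single (σ.symm ⟨0, pow_pos hq K⟩) η := by
          ext j
          simp only [Function.comp, Pi.single_apply]
          congr 1
          rw [Equiv.eq_symm_apply]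
        have h2 : (0 : Fin (q ^ K) → ℝ) ∘ σ = 0 := rfl
        rw [h1, h2, map_zero, add_zero, hTdef, Fintype.linearCombination_apply_single]
        exact hcon _
      rw [Finset.sum_sub_distrib, Finset.sum_const, Finset.card_univ, nsmul_eq_mul] at hlt'
      exact hlt'
    have h3 := hlt.trans_le ((le_abs_self _).trans key)
    rw [mul_div_assoc, ← mul_add] at h3
    linarith
  · intro σ y h
    rw [hDa, hDa]
    exact Fintype.sum_equiv (Equiv.mulLeft σ) _ _ fun τ => rfl
  · intro y hy h
    rw [hDa, mul_assoc]
    refine hsum _ _ fun σ => ?_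
    refine ((f' _).le_opNorm _).trans (mul_le_mul (hL _ (hxu _ ((hperm σ y).trans hy)))
      ((hu _).trans (hperm σ h)) (norm_nonneg _) hL0)
  · intro y h hy hyh hh
    have hrw : F (y + h) - F y - D y h = ∑ σ : Equiv.Perm (Fin (q ^ K)),
        (f (x + T (y ∘ σ) + T (h ∘ σ)) - f (x + T (y ∘ σ)) -
          f' (x + T (y ∘ σ)) (T (h ∘ σ))) := by
      rw [hDa, Finset.sum_sub_distrib, Finset.sum_sub_distrib]
      simp only [hF, add_assoc, ← map_add]
      rfl
    rw [hrw, mul_assoc]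
    refine hsum _ _ fun σ => ?_
    have hn : ‖T (h ∘ σ)‖ ≤ |η / K| := ((hu _).trans (hperm σ h)).trans hh
    refine (hT _ (hxu _ ((hperm σ y).trans hy)) _ ?_ (hn.trans hδ)).trans (by gcongr)
    rw [add_assoc, ← map_add]
    exact hxu _ ((hperm σ (y + h)).trans hyh)

/-- Linear combinations of disjointly supported vectors in the unit ball of `ℓ∞`. -/
theorem norm_sum_smul_le_of_disjoint_support {Γ ι : Type*} [Fintype ι]
    {w : ι → lp (fun _ : Γ => ℝ) ⊤} (hw : ∀ i, ‖w i‖ ≤ 1)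
    (hdisj : ∀ i j, i ≠ j → Disjoint (Function.support (w i)) (Function.support (w j)))
    (a : ι → ℝ) : ‖∑ i, a i • w i‖ ≤ ‖a‖ := by
  refine lp.norm_le_of_forall_le (norm_nonneg _) fun γ => ?_
  have happ : (∑ i, a i • w i : lp (fun _ : Γ => ℝ) ⊤) γ = ∑ i, a i * w i γ := by
    rw [lp.coeFn_sum, Finset.sum_apply]
    rfl
  rw [happ]
  by_cases h : ∃ i, w i γ ≠ 0
  · obtain ⟨i, hi⟩ := h
    rw [Finset.sum_eq_single i, norm_mul]
    · exact (mul_le_of_le_one_right (norm_nonneg _)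
        ((lp.norm_apply_le_norm ENNReal.top_ne_zero (w i) γ).trans (hw i))).trans
        (norm_le_pi_norm a i)
    · intro j _ hj
      have : γ ∉ Function.support (w j) := fun h => Set.disjoint_left.1 (hdisj j i hj) h hi
      rw [Function.notMem_support.1 this, mul_zero]
    · simp
  · push Not at h
    simp [h]

/-- First-order Taylor estimate on the unit ball from a modulus of continuity of the derivative. -/
theorem abs_sub_sub_le_of_modulus {E : Type*} [NormedAddCommGroup E] [NormedSpace ℝ E]
    {f : E → ℝ} {f' : E → E →L[ℝ] ℝ} {ω : ℝ → ℝ} {κ δ : ℝ}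
    (hf : ∀ p ∈ ball (0 : E) 1, HasFDerivAt f (f' p) p)
    (hf' : ∀ p ∈ ball (0 : E) 1, ∀ p' ∈ ball (0 : E) 1, ‖f' p - f' p'‖ ≤ ω ‖p - p'‖)
    (hω : ∀ t, 0 ≤ t → t ≤ δ → ω t ≤ κ) {p h : E} (hp : p ∈ ball (0 : E) 1)
    (hph : p + h ∈ ball (0 : E) 1) (hh : ‖h‖ ≤ δ) :
    |f (p + h) - f p - f' p h| ≤ κ * ‖h‖ := by
  have hseg : segment ℝ p (p + h) ⊆ ball (0 : E) 1 := (convex_ball 0 1).segment_subset hp hph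
  have := (convex_segment p (p + h)).norm_image_sub_le_of_norm_hasFDerivWithin_le'
    (f := f) (f' := f') (φ := f' p) (C := κ) (fun z hz => (hf z (hseg hz)).hasFDerivWithinAt)
    (fun z hz => (hf' z (hseg hz) p hp).trans (hω _ (norm_nonneg _) ?_))
    (left_mem_segment ℝ p (p + h)) (right_mem_segment ℝ p (p + h))
  · simpa using this
  · have := norm_sub_le_of_mem_segment hz
    refine this.trans ?_
    simpa using hh

/-- For fixed coefficients, `f` increases substantially in boundedly many of the directions of a
disjointly supported family in `ℓ∞`. -/
theorem card_filter_le_apply_add_smul_sub_lt {Γ : Type*} {f : lp (fun _ : Γ => ℝ) ⊤ → ℝ}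
    {f' : lp (fun _ : Γ => ℝ) ⊤ → (lp (fun _ : Γ => ℝ) ⊤ →L[ℝ] ℝ)} {L κ δ ρ : ℝ}
    (hL0 : 0 ≤ L) (hκ : 0 ≤ κ)
    (hL : ∀ p ∈ ball (0 : lp (fun _ : Γ => ℝ) ⊤) 1, ‖f' p‖ ≤ L)
    (hT : ∀ p ∈ ball (0 : lp (fun _ : Γ => ℝ) ⊤) 1, ∀ h,
      p + h ∈ ball (0 : lp (fun _ : Γ => ℝ) ⊤) 1 → ‖h‖ ≤ δ →
      |f (p + h) - f p - f' p h| ≤ κ * ‖h‖)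
    {q K : ℕ} (hq : 0 < q) (hK : 0 < K) {n : ℕ} {v : ℕ → lp (fun _ : Γ => ℝ) ⊤}
    (hv : ∀ k < n, ‖v k‖ ≤ 1)
    (hdisj : ∀ k < n, ∀ l < n, k ≠ l →
      Disjoint (Function.support (v k)) (Function.support (v l)))
    {lam mu eta : ℝ} (hρ : ρ < 1) (hlam : |lam| ≤ ρ) (hmu : |mu| ≤ ρ) (heta : |eta| ≤ ρ)
    (hδ : |eta / K| ≤ δ) {ε : ℝ} (hε : 2 * (|eta| * (L / q + κ)) < ε) :
    ((Finset.Ico 2 n).filter fun k =>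
      ε ≤ f (lam • v 0 + mu • v 1 + eta • v k) - f (lam • v 0 + mu • v 1)).card < q ^ K := by
  by_contra! hcard
  obtain ⟨B, hB, hBcard⟩ := Finset.exists_subset_card_eq hcard
  set k : Fin (q ^ K) ↪o ℕ := B.orderEmbOfFin hBcard with hk
  have hkB : ∀ i, 2 ≤ k i ∧ k i < n ∧ ε ≤ f (lam • v 0 + mu • v 1 + eta • v (k i)) -
      f (lam • v 0 + mu • v 1) := fun i => by
    simpa [and_assoc] using hB (B.orderEmbOfFin_mem hBcard i)
  have hn : 2 < n := (hkB ⟨0, pow_pos hq K⟩).1.trans_lt (hkB _).2.1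
  set g : Bool ⊕ Fin (q ^ K) → ℕ := Sum.elim (fun b => if b then 0 else 1) k with hg
  have hginj : Function.Injective g := by
    refine Function.Injective.sumElim (by decide) k.injective fun b i h => ?_
    have := (hkB i).1
    cases b <;> simp at h <;> omega
  have hgn : ∀ i, g i < n := by
    rintro (b | i)
    · cases b <;> simp [hg] <;> omega
    · exact (hkB i).2.1
  have hρ0 : 0 ≤ ρ := (abs_nonneg _).trans hlam
  have hxu : ∀ a : Fin (q ^ K) → ℝ, ‖a‖ ≤ ρ →
      lam • v 0 + mu • v 1 + ∑ i, a i • v (k i) ∈ ball (0 : lp (fun _ : Γ => ℝ) ⊤) 1 := by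
    intro a ha
    have h1 := norm_sum_smul_le_of_disjoint_support (w := fun i => v (g i))
      (fun i => hv _ (hgn i)) (fun i j hij => hdisj _ (hgn i) _ (hgn j) (hginj.ne hij))
      (Sum.elim (fun b => if b then lam else mu) a)
    have h2 : ‖Sum.elim (fun b => if b = true then lam else mu) a‖ ≤ ρ := by
      refine (pi_norm_le_iff_of_nonneg hρ0).2 ?_
      rintro (b | i)
      · cases b <;> simpa
      · exact (norm_le_pi_norm a i).trans ha
    rw [mem_ball_zero_iff]
    simp only [Fintype.sum_sum_type, hg, Sum.elim_inl, Sum.elim_inr, Fintype.sum_bool] at h1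
    exact (h1.trans h2).trans_lt hρ
  obtain ⟨i, hi⟩ := exists_apply_add_smul_sub_le hL0 hκ hL hT hq hK hxu
    (norm_sum_smul_le_of_disjoint_support (fun i => hv _ (hkB i).2.1) fun i j hij =>
      hdisj _ (hkB i).2.1 _ (hkB j).2.1 (k.injective.ne hij)) heta hδ
  linarith [(hkB i).2.2]

/-- For each modulus `ω`, every `L > 0` and `ε > 0`, there is `N` such that if `n ≥ N`,
`Γ` is an infinite regular cardinal and `f ∈ C^{1,+}(B_{ℓ∞(Γ)})` is `L`-Lipschitz with
derivative of modulus of continuity `ω`, then for any vectors `v 0, …, v (n-1)` in the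
closed unit ball with pairwise disjoint supports there is `k ∈ {2, …, n-1}` (the third
vector onwards) such that adding `η • v k` to `λ • v 0 + μ • v 1` changes `f` by less
than `ε`, for all `|λ|, |μ|, |η| ≤ 1`. -/
theorem exists_flat_disjoint_vector (ω : ℝ → ℝ) (hω : IsModulus ω)
    (L ε : ℝ) (hL : 0 < L) (hε : 0 < ε) :
    ∃ N : ℕ, ∀ n : ℕ, N ≤ n →
      ∀ (Γ : Type*), (Cardinal.mk Γ).IsRegular →
      ∀ (f : lp (fun _ : Γ => ℝ) ⊤ → ℝ)
        (f' : lp (fun _ : Γ => ℝ) ⊤ → (lp (fun _ : Γ => ℝ) ⊤ →L[ℝ] ℝ)),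
        ContinuousOn f (closedBall 0 1) →
        (∀ x ∈ closedBall (0 : lp (fun _ : Γ => ℝ) ⊤) 1,
          ∀ y ∈ closedBall (0 : lp (fun _ : Γ => ℝ) ⊤) 1,
          ‖f x - f y‖ ≤ L * ‖x - y‖) →
        (∀ x ∈ ball (0 : lp (fun _ : Γ => ℝ) ⊤) 1, HasFDerivAt f (f' x) x) →
        (∀ x ∈ ball (0 : lp (fun _ : Γ => ℝ) ⊤) 1, ∀ y ∈ ball (0 : lp (fun _ : Γ => ℝ) ⊤) 1,
          ‖f' x - f' y‖ ≤ ω ‖x - y‖) →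
        ∀ v : ℕ → lp (fun _ : Γ => ℝ) ⊤,
          (∀ k < n, ‖v k‖ ≤ 1) →
          (∀ k < n, ∀ l < n, k ≠ l →
            Disjoint (Function.support (v k)) (Function.support (v l))) →
          ∃ k, 2 ≤ k ∧ k < n ∧
            ∀ lam mu eta : ℝ, |lam| ≤ 1 → |mu| ≤ 1 → |eta| ≤ 1 →
              |f (lam • v 0 + mu • v 1 + eta • v k) - f (lam • v 0 + mu • v 1)| < ε := by
  obtain ⟨-, -, hω0, hωc⟩ := hω
  obtain ⟨δ, hδ, hωδ⟩ : ∃ δ > 0, ∀ t, 0 ≤ t → t ≤ δ → ω t ≤ ε / 16 := by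
    obtain ⟨δ, hδ, h⟩ := Metric.continuousWithinAt_iff.1 hωc (ε / 16) (by positivity)
    refine ⟨δ / 2, by positivity, fun t ht htδ => ?_⟩
    have := h (x := t) ht (by rw [Real.dist_eq, sub_zero, abs_of_nonneg ht]; linarith)
    rw [hω0, Real.dist_eq, sub_zero] at this
    exact (le_abs_self _).trans this.le
  obtain ⟨q, hq⟩ := exists_nat_gt (16 * L / ε)
  obtain ⟨K, hK⟩ := exists_nat_gt (1 / δ)
  have hq0 : (0 : ℝ) < q := lt_trans (by positivity) hq
  have hK0 : (0 : ℝ) < K := lt_trans (by positivity) hK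
  have hLq : L / q ≤ ε / 16 := by
    rw [div_lt_iff₀ hε] at hq
    rw [div_le_iff₀ hq0]
    linarith
  have hKδ : 1 / K ≤ δ := by
    rw [div_lt_iff₀ hδ] at hK
    rw [div_le_iff₀ hK0]
    linarith
  obtain ⟨s, hs0, hs1, hsL⟩ : ∃ s : ℝ, 0 < s ∧ s ≤ 1 ∧ 4 * L * s ≤ ε / 2 := by
    refine ⟨min 1 (ε / (8 * L)), by positivity, min_le_left _ _, ?_⟩
    calc 4 * L * min 1 (ε / (8 * L)) ≤ 4 * L * (ε / (8 * L)) := by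
          gcongr
          exact min_le_right _ _
      _ = ε / 2 := by
          field_simp
          norm_num
  obtain ⟨t, ht1, htfin, ht⟩ :=
    finite_cover_balls_of_compact (isCompact_closedBall (0 : ℝ × ℝ × ℝ) 1) hs0
  lift t to Finset (ℝ × ℝ × ℝ) using htfin
  refine ⟨2 + t.card * (q ^ K + q ^ K) + 1, ?_⟩
  intro n hn Γ _ f f' _ hlip hf hf' v hv hdisj
  by_contra! hcon
  have hL' : ∀ p ∈ ball (0 : lp (fun _ : Γ => ℝ) ⊤) 1, ‖f' p‖ ≤ L := by
    intro p hp
    refine (hf p hp).le_of_lip' hL.le ?_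
    filter_upwards [isOpen_ball.mem_nhds hp] with z hz
    exact hlip z (ball_subset_closedBall hz) p (ball_subset_closedBall hp)
  have hT : ∀ p ∈ ball (0 : lp (fun _ : Γ => ℝ) ⊤) 1, ∀ h,
      p + h ∈ ball (0 : lp (fun _ : Γ => ℝ) ⊤) 1 → ‖h‖ ≤ δ →
      |f (p + h) - f p - f' p h| ≤ ε / 16 * ‖h‖ := fun p hp h hph hh =>
    abs_sub_sub_le_of_modulus hf hf' hωδ hp hph hh
  have hcoord : ∀ c : ℝ × ℝ × ℝ, ‖c‖ ≤ 1 → |c.1| ≤ 1 ∧ |c.2.1| ≤ 1 ∧ |c.2.2| ≤ 1 := fun c hc =>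
    ⟨(norm_fst_le c).trans hc, (norm_fst_le c.2).trans ((norm_snd_le c).trans hc),
      (norm_snd_le c.2).trans ((norm_snd_le c).trans hc)⟩
  set r : ℝ := 1 - s with hr
  set G : ℝ → ℝ → ℝ → ℕ → ℝ := fun a b c k =>
    f (a • v 0 + b • v 1 + c • v k) - f (a • v 0 + b • v 1) with hG
  set U : ℝ × ℝ × ℝ → Finset ℕ := fun c =>
    (Finset.Ico 2 n).filter fun k => ε / 2 ≤ G (r * c.1) (r * c.2.1) (r * c.2.2) k with hU
  set V : ℝ × ℝ × ℝ → Finset ℕ := fun c =>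
    (Finset.Ico 2 n).filter fun k => ε / 2 ≤ -G (r * c.1) (r * c.2.1) (r * c.2.2) k with hV
  have hr0 : 0 ≤ r := by linarith
  have hr1 : r < 1 := by linarith
  have hscale : ∀ a : ℝ, |a| ≤ 1 → |r * a| ≤ r := fun a ha => by
    rw [abs_mul, abs_of_nonneg hr0]
    exact mul_le_of_le_one_right hr0 ha
  have hstep : ∀ a : ℝ, |a| ≤ 1 → |r * a / K| ≤ δ := fun a ha => by
    rw [abs_div, Nat.abs_cast]
    refine le_trans ?_ hKδ
    gcongr
    exact (hscale a ha).trans hr1.le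
  have hsmall : ∀ a : ℝ, |a| ≤ 1 → 2 * (|r * a| * (L / q + ε / 16)) < ε / 2 := fun a ha => by
    have h1 : |r * a| * (L / q + ε / 16) ≤ 1 * (ε / 16 + ε / 16) := by
      gcongr
      exact (hscale a ha).trans hr1.le
    linarith
  have hUcard : ∀ c ∈ t, (U c).card ≤ q ^ K := by
    intro c hc
    obtain ⟨h1, h2, h3⟩ := hcoord c (mem_closedBall_zero_iff.1 (ht1 hc))
    exact (card_filter_le_apply_add_smul_sub_lt hL.le (by positivity) hL' hT
      (by exact_mod_cast hq0) (by exact_mod_cast hK0) hv hdisj hr1 (hscale _ h1) (hscale _ h2)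
      (hscale _ h3) (hstep _ h3) (hsmall _ h3)).le
  have hVcard : ∀ c ∈ t, (V c).card ≤ q ^ K := by
    intro c hc
    obtain ⟨h1, h2, h3⟩ := hcoord c (mem_closedBall_zero_iff.1 (ht1 hc))
    have := (card_filter_le_apply_add_smul_sub_lt (f := fun p => -f p) (f' := fun p => -f' p)
      hL.le (κ := ε / 16) (δ := δ) (by positivity) (fun p hp => by simpa using hL' p hp)
      (fun p hp h hph hh => by
        rw [← abs_neg]
        refine le_of_eq_of_le ?_ (hT p hp h hph hh)
        congr 1
        simp only [neg_apply]
        ring)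
      (by exact_mod_cast hq0) (by exact_mod_cast hK0) hv hdisj hr1 (hscale _ h1) (hscale _ h2)
      (hscale _ h3) (hstep _ h3) (hsmall _ h3)).le
    refine le_of_eq_of_le ?_ this
    simp only [hV, hG]
    congr 1
    refine Finset.filter_congr fun k _ => ?_
    rw [neg_sub, neg_sub_neg]
  have hnorm : ∀ k, 2 ≤ k → k < n → ∀ m a b c : ℝ, |a| ≤ m → |b| ≤ m → |c| ≤ m →
      ‖a • v 0 + b • v 1 + c • v k‖ ≤ m := by
    intro k hk2 hkn m a b c ha hb hc
    have hgn : ∀ i, (![0, 1, k] : Fin 3 → ℕ) i < n := by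
      intro i
      fin_cases i <;> simp <;> omega
    have hginj : ∀ i j, i ≠ j → (![0, 1, k] : Fin 3 → ℕ) i ≠ ![0, 1, k] j := by
      intro i j
      fin_cases i <;> fin_cases j <;> simp <;> omega
    have h1 := norm_sum_smul_le_of_disjoint_support (w := fun i => v (![0, 1, k] i))
      (fun i => hv _ (hgn i)) (fun i j hij => hdisj _ (hgn i) _ (hgn j) (hginj i j hij)) ![a, b, c]
    rw [Fin.sum_univ_three] at h1
    refine h1.trans ((pi_norm_le_iff_of_nonneg ((abs_nonneg a).trans ha)).2 fun i => ?_)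
    fin_cases i <;> simpa
  have hlip' : ∀ k, 2 ≤ k → k < n → ∀ a b c a' b' c' : ℝ, |a| ≤ 1 → |b| ≤ 1 → |c| ≤ 1 →
      |a'| ≤ 1 → |b'| ≤ 1 → |c'| ≤ 1 → |a - a'| ≤ 2 * s → |b - b'| ≤ 2 * s → |c - c'| ≤ 2 * s →
      |f (a • v 0 + b • v 1 + c • v k) - f (a' • v 0 + b' • v 1 + c' • v k)| ≤ L * (2 * s) := by
    intro k hk2 hkn a b c a' b' c' ha hb hc ha' hb' hc' d1 d2 d3
    refine (hlip _ (mem_closedBall_zero_iff.2 (hnorm k hk2 hkn 1 a b c ha hb hc)) _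
      (mem_closedBall_zero_iff.2 (hnorm k hk2 hkn 1 a' b' c' ha' hb' hc'))).trans ?_
    gcongr
    refine le_of_eq_of_le ?_ (hnorm k hk2 hkn (2 * s) _ _ _ d1 d2 d3)
    congr 1
    module
  have hcover : Finset.Ico 2 n ⊆ t.biUnion fun c => U c ∪ V c := by
    intro k hk
    obtain ⟨hk2, hkn⟩ := Finset.mem_Ico.1 hk
    obtain ⟨a, b, c, ha, hb, hc, habc⟩ := hcon k hk2 hkn
    have hmem : (a, b, c) ∈ closedBall (0 : ℝ × ℝ × ℝ) 1 := by
      rw [mem_closedBall_zero_iff]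
      exact norm_prod_le_iff.2 ⟨ha, norm_prod_le_iff.2 ⟨hb, hc⟩⟩
    obtain ⟨p, hp, hpball⟩ := Set.mem_iUnion₂.1 (ht hmem)
    obtain ⟨h1, h2, h3⟩ := hcoord p (mem_closedBall_zero_iff.1 (ht1 hp))
    rw [mem_ball, dist_eq_norm] at hpball
    have hclose : ∀ x y : ℝ, |y| ≤ 1 → |x - y| ≤ s → |x - r * y| ≤ 2 * s := by
      intro x y hy hxy
      have : x - r * y = (x - y) + s * y := by rw [hr]; ring
      rw [this]
      refine (abs_add_le _ _).trans ?_
      rw [abs_mul, abs_of_pos hs0]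
      nlinarith
    have d1 := hclose a p.1 h1 ((norm_fst_le _).trans hpball.le)
    have d2 := hclose b p.2.1 h2
      ((norm_fst_le (_ : ℝ × ℝ)).trans ((norm_snd_le _).trans hpball.le))
    have d3 := hclose c p.2.2 h3
      ((norm_snd_le (_ : ℝ × ℝ)).trans ((norm_snd_le _).trans hpball.le))
    have e1 := hlip' k hk2 hkn _ _ _ _ _ _ ha hb hc ((hscale _ h1).trans hr1.le)
      ((hscale _ h2).trans hr1.le) ((hscale _ h3).trans hr1.le) d1 d2 d3
    have e2 := hlip' k hk2 hkn a b 0 (r * p.1) (r * p.2.1) 0 ha hb (by simp)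
      ((hscale _ h1).trans hr1.le) ((hscale _ h2).trans hr1.le) (by simp) d1 d2
      (by simpa using hs0.le)
    simp only [zero_smul, add_zero] at e2
    refine Finset.mem_biUnion.2 ⟨p, hp, Finset.mem_union.2 ?_⟩
    simp only [hU, hV, hG, Finset.mem_filter]
    rw [abs_le] at e1 e2
    rcases le_abs.1 habc with h | h
    · exact Or.inl ⟨hk, by linarith⟩
    · exact Or.inr ⟨hk, by linarith⟩
  have hfinal := (Finset.card_le_card hcover).trans
    (Finset.card_biUnion_le_card_mul _ _ (q ^ K + q ^ K) fun c hc =>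
      (Finset.card_union_le _ _).trans (add_le_add (hUcard c hc) (hVcard c hc)))
  rw [Nat.card_Ico] at hfinal
  omega
end

section
/- Assume GCH. Let X be a Banach space and Γ an infinite regular cardinal. Suppose F ∈ C^{1,+}(B_{ℓ∞(Γ)}; X) satisfies inf_{γ<Γ} ‖F(e_γ) − F(0)‖ > 0. Then there exist a point x in the open unit ball of ℓ∞(Γ) and a subset Γ' ⊆ Γ of the same cardinality as Γ such that the bounded linear operator dF(x) restricted to ℓ∞(Γ') is bounded below, i.e., there is l > 0 with ‖dF(x)[z]‖ ≥ l‖z‖ for all z ∈ ℓ∞(Γ'). In particular, X contains a subspace isomorphic to ℓ∞(Γ). -/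
open Metric

universe u v

/-- Rosenthal-type disjointification: if no point of a set `A` of full cardinality has `n`
pairwise disjoint bad subsets of `A` avoiding it, then `A` has a subset `Γ'` of full cardinality
such that `Γ' \ {γ}` is not bad for any `γ ∈ Γ'`. -/
theorem exists_subset_forall_not_bad {Γ : Type u} [Infinite Γ] (Bad : Γ → Set Γ → Prop) (n : ℕ) :
    ∀ A : Set Γ, Cardinal.mk A = Cardinal.mk Γ →
      (∀ γ ∈ A, ∀ B : Fin n → Set Γ, Pairwise (fun i j => Disjoint (B i) (B j)) →
        (∀ i, B i ⊆ A \ {γ}) → ¬ ∀ i, Bad γ (B i)) →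
      ∃ Γ' ⊆ A, Cardinal.mk Γ' = Cardinal.mk Γ ∧ ∀ γ ∈ Γ', ¬ Bad γ (Γ' \ {γ}) := by
  induction n with
  | zero =>
    intro A hA h
    have : Nonempty A := by
      rw [← Cardinal.mk_ne_zero_iff, hA]
      exact Cardinal.mk_ne_zero Γ
    obtain ⟨γ, hγ⟩ := this
    exact absurd (fun i => i.elim0) (h γ hγ (fun i => i.elim0) (fun i => i.elim0) (fun i => i.elim0))
  | succ n ih =>
    intro A hA h
    have hcard : Cardinal.mk (Γ × Γ) = Cardinal.mk A := by
      rw [hA, Cardinal.mk_prod, Cardinal.lift_id, Cardinal.mul_eq_self (Cardinal.aleph0_le_mk Γ)]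
    obtain ⟨e⟩ := Cardinal.eq.1 hcard
    have hinj : Function.Injective fun p : Γ × Γ => (e p : Γ) :=
      Subtype.val_injective.comp e.injective
    let P : Γ → Set Γ := fun i => Set.range fun j => (e (i, j) : Γ)
    have hPcard : ∀ i, Cardinal.mk (P i) = Cardinal.mk Γ := fun i =>
      Cardinal.mk_range_eq _ fun a b hab => (Prod.ext_iff.1 (hinj hab)).2
    have hPA : ∀ i, P i ⊆ A := by
      rintro i _ ⟨j, rfl⟩
      exact (e (i, j)).2
    have hPeq : ∀ i j x, x ∈ P i → x ∈ P j → i = j := by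
      rintro i j _ ⟨a, rfl⟩ ⟨b, hb⟩
      exact (Prod.ext_iff.1 (hinj hb)).1.symm
    by_cases hgood : ∃ i, ∀ γ ∈ P i, ¬ Bad γ (P i \ {γ})
    · obtain ⟨i, hi⟩ := hgood
      exact ⟨P i, hPA i, hPcard i, hi⟩
    push Not at hgood
    choose g hgP hgBad using hgood
    have hginj : Function.Injective g := fun i j hij => hPeq i j (g i) (hgP i) (hij ▸ hgP j)
    obtain ⟨Γ', hΓ', h1, h2⟩ := ih (Set.range g) (Cardinal.mk_range_eq _ hginj) (by
      rintro _ ⟨i, rfl⟩ B hB hBsub hBbad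
      have hdisj : ∀ k, Disjoint (P i \ {g i}) (B k) := by
        intro k
        rw [Set.disjoint_left]
        rintro x ⟨hxP, hx⟩ hxB
        obtain ⟨⟨j, rfl⟩, -⟩ := hBsub k hxB
        exact hx (by rw [hPeq i j _ hxP (hgP j)]; rfl)
      refine h (g i) (hPA i (hgP i)) (Fin.cons (P i \ {g i}) B) ?_ ?_ ?_
      · intro a b hab
        induction a using Fin.cases with
        | zero =>
          induction b using Fin.cases with
          | zero => exact absurd rfl hab
          | succ b => simpa using hdisj b
        | succ a =>
          induction b using Fin.cases with
          | zero => simpa using (hdisj a).symm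
          | succ b => simpa using hB fun hh => hab (congrArg Fin.succ hh)
      · intro a
        induction a using Fin.cases with
        | zero => exact Set.sdiff_subset_sdiff_left (hPA i)
        | succ a =>
          refine (hBsub a).trans (Set.sdiff_subset_sdiff_left ?_)
          rintro _ ⟨j, rfl⟩
          exact hPA j (hgP j)
      · intro a
        induction a using Fin.cases with
        | zero => simpa using hgBad i
        | succ a => simpa using hBbad a)
    refine ⟨Γ', hΓ'.trans ?_, h1, h2⟩
    rintro _ ⟨j, rfl⟩
    exact hPA j (hgP j)

/-- A lattice function on `{0, …, m}^ι` with a first-order expansion along unit steps whose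
coefficients are summable and agree at coordinates of equal height changes little in passing from
`0` to `m • e_i`, provided there is a pyramid `lam` with rapidly decreasing layers. -/
theorem sub_single_le_of_symmetric {ι : Type*} [Fintype ι] [DecidableEq ι] {m R : ℕ} (hR : 0 < R)
    {C η : ℝ} (u : (ι → ℕ) → ℝ) (D : (ι → ℕ) → ι → ℝ)
    (hu : ∀ a b : ι → ℕ, (∀ i, b i = a i ∨ b i = a i + 1) → (∀ i, b i ≤ m) →
      |u b - u a - ∑ i, ((b i : ℝ) - a i) * D a i| ≤ η)
    (hD : ∀ a : ι → ℕ, (∀ i, a i ≤ m) → ∑ i, |D a i| ≤ C)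
    (hsymm : ∀ a i j, a i = a j → D a i = D a j)
    (i : ι) (lam : ι → ℕ) (hlam_i : lam i = 0) (hlam : ∀ j, lam j ≤ m)
    (hratio : ∀ k < m, R * (Finset.univ.filter fun j => k + 1 ≤ lam j).card ≤
      (Finset.univ.filter fun j => j ≠ i ∧ k ≤ lam j).card)
    (hlevel : ∀ k < m, R ≤ (Finset.univ.filter fun j => j ≠ i ∧ lam j = k).card) :
    u 0 - u (Pi.single i m) ≤ 3 * (m * (η + C / R)) := by
  have hR' : (0 : ℝ) < R := by exact_mod_cast hR
  -- a telescoping estimate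
  have tele : ∀ w : ℕ → ι → ℕ, (∀ k < m, |u (w (k + 1)) - u (w k)| ≤ η + C / R) →
      |u (w m) - u (w 0)| ≤ m * (η + C / R) := by
    intro w hw
    rw [← Finset.sum_range_sub (fun k => u (w k))]
    refine (Finset.abs_sum_le_sum_abs _ _).trans ?_
    refine (Finset.sum_le_sum fun k hk => hw k (Finset.mem_range.1 hk)).trans ?_
    rw [Finset.sum_const, Finset.card_range, nsmul_eq_mul]
  -- building the pyramid over a prescribed height of the coordinate `i`
  have build : ∀ p ≤ m, |u (Function.update (fun j => min m (lam j)) i p) -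
      u (Function.update (fun j => min 0 (lam j)) i p)| ≤ m * (η + C / R) := by
    intro p hp
    refine tele (fun k => Function.update (fun j => min k (lam j)) i p) fun k hk => ?_
    set a : ι → ℕ := Function.update (fun j => min k (lam j)) i p with ha
    set b : ι → ℕ := Function.update (fun j => min (k + 1) (lam j)) i p with hb
    have ham : ∀ j, a j ≤ m := by
      intro j
      by_cases hj : j = i
      · subst hj; simpa [ha] using hp
      · simp only [ha, Function.update_of_ne hj]; have := hlam j; omega
    have hbm : ∀ j, b j ≤ m := by
      intro j
      by_cases hj : j = i
      · subst hj; simpa [hb] using hp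
      · simp only [hb, Function.update_of_ne hj]; have := hlam j; omega
    have hstep := hu a b (fun j => by
      by_cases hj : j = i
      · subst hj; simp [ha, hb]
      · simp only [ha, hb, Function.update_of_ne hj]; omega) hbm
    have hsum : |∑ j, ((b j : ℝ) - a j) * D a j| ≤ C / R := by
      set S := Finset.univ.filter fun j => k + 1 ≤ lam j with hS
      set S' := Finset.univ.filter fun j => j ≠ i ∧ k ≤ lam j with hS'
      have hval : ∀ j ∈ S', a j = k := by
        intro j hj
        simp only [hS', Finset.mem_filter, Finset.mem_univ, true_and] at hj
        simp only [ha, Function.update_of_ne hj.1]; omega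
      have hSS' : S ⊆ S' := by
        intro j hj
        simp only [hS, hS', Finset.mem_filter, Finset.mem_univ, true_and] at hj ⊢
        refine ⟨?_, by omega⟩
        rintro rfl
        omega
      have h1 : |∑ j, ((b j : ℝ) - a j) * D a j| ≤ ∑ j ∈ S, |D a j| := by
        have : ∑ j, ((b j : ℝ) - a j) * D a j = ∑ j ∈ S, D a j := by
          rw [hS, Finset.sum_filter]
          refine Finset.sum_congr rfl fun j _ => ?_
          by_cases hj : j = i
          · subst hj; simp [ha, hb, hlam_i]
          · simp only [ha, hb, Function.update_of_ne hj]
            split_ifs with h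
            · rw [min_eq_left h, min_eq_left (by omega)]; push_cast; ring
            · rw [min_eq_right (by omega), min_eq_right (by omega)]; ring
        rw [this]
        exact Finset.abs_sum_le_sum_abs _ _
      refine h1.trans ?_
      have hCa : ∑ j ∈ S', |D a j| ≤ C :=
        (Finset.sum_le_sum_of_subset_of_nonneg (Finset.subset_univ _)
          fun _ _ _ => abs_nonneg _).trans (hD a ham)
      rw [le_div_iff₀ hR']
      rcases S.eq_empty_or_nonempty with he | ⟨j₀, hj₀⟩
      · rw [he]
        simpa using (Finset.sum_nonneg fun _ _ => abs_nonneg _).trans hCa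
      have hconst : ∀ j ∈ S', |D a j| = |D a j₀| := fun j hj => by
        rw [hsymm a j j₀ ((hval j hj).trans (hval j₀ (hSS' hj₀)).symm)]
      rw [Finset.sum_congr rfl fun j hj => hconst j (hSS' hj)]
      rw [Finset.sum_congr rfl hconst] at hCa
      simp only [Finset.sum_const, nsmul_eq_mul] at hCa ⊢
      have hr : (R : ℝ) * S.card ≤ S'.card := by exact_mod_cast hratio k hk
      nlinarith [mul_le_mul_of_nonneg_right hr (abs_nonneg (D a j₀))]
    have := abs_le.1 hstep
    have := abs_le.1 hsum
    exact abs_le.2 ⟨by linarith, by linarith⟩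
  -- raising the coordinate `i` on top of the finished pyramid
  have raise : |u (Function.update lam i m) - u (Function.update lam i 0)| ≤
      m * (η + C / R) := by
    refine tele (fun k => Function.update lam i k) fun k hk => ?_
    set a : ι → ℕ := Function.update lam i k with ha
    have ham : ∀ j, a j ≤ m := by
      intro j
      by_cases hj : j = i
      · subst hj; simpa [ha] using hk.le
      · simpa only [ha, Function.update_of_ne hj] using hlam j
    have hstep := hu a (Function.update lam i (k + 1)) (fun j => by
      by_cases hj : j = i
      · subst hj; simp [ha]
      · simp [ha, Function.update_of_ne hj]) (fun j => by
      by_cases hj : j = i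
      · subst hj; simpa using hk
      · simpa only [Function.update_of_ne hj] using hlam j)
    have hsum : ∑ j, (((Function.update lam i (k + 1) : ι → ℕ) j : ℝ) - a j) * D a j = D a i := by
      rw [Finset.sum_eq_single i]
      · simp [ha]
      · intro j _ hj
        simp [ha, Function.update_of_ne hj]
      · simp
    rw [hsum] at hstep
    have hDi : |D a i| ≤ C / R := by
      set S := Finset.univ.filter fun j => j ≠ i ∧ lam j = k with hS
      have hconst : ∀ j ∈ S, |D a j| = |D a i| := by
        intro j hj
        simp only [hS, Finset.mem_filter, Finset.mem_univ, true_and] at hj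
        rw [hsymm a j i (by simp [ha, Function.update_of_ne hj.1, hj.2])]
      have hCa : ∑ j ∈ S, |D a j| ≤ C :=
        (Finset.sum_le_sum_of_subset_of_nonneg (Finset.subset_univ _)
          fun _ _ _ => abs_nonneg _).trans (hD a ham)
      rw [Finset.sum_congr rfl hconst] at hCa
      simp only [Finset.sum_const, nsmul_eq_mul] at hCa
      have hr : (R : ℝ) ≤ S.card := by exact_mod_cast hlevel k hk
      rw [le_div_iff₀ hR']
      nlinarith [mul_le_mul_of_nonneg_right hr (abs_nonneg (D a i))]
    have := abs_le.1 hstep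
    have := abs_le.1 hDi
    exact abs_le.2 ⟨by linarith, by linarith⟩
  have hmin : (fun j => min m (lam j)) = lam := funext fun j => min_eq_right (hlam j)
  have hzero : (fun j => min 0 (lam j)) = 0 := funext fun j => Nat.zero_min _
  have e1 := abs_le.1 (build 0 (Nat.zero_le m))
  have e2 := abs_le.1 (build m le_rfl)
  rw [hmin, hzero] at e1 e2
  have hupd : Function.update (0 : ι → ℕ) i 0 = 0 := Function.update_eq_self_iff.2 rfl
  rw [hupd] at e1
  have e3 := abs_le.1 raise
  rw [Pi.single]
  linarith [e1.1, e1.2, e2.1, e2.2, e3.1, e3.2]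

/-- The symmetry assumption of `sub_single_le_of_symmetric` can be dropped at the price of
controlling all coordinates. -/
theorem exists_sub_single_le {ι : Type*} [Fintype ι] [DecidableEq ι] {m R : ℕ} (hR : 0 < R)
    {C η ε : ℝ} (hε : 3 * (m * (η + C / R)) < ε) (u : (ι → ℕ) → ℝ) (D : (ι → ℕ) → ι → ℝ)
    (hu : ∀ a b : ι → ℕ, (∀ i, b i = a i ∨ b i = a i + 1) → (∀ i, b i ≤ m) →
      |u b - u a - ∑ i, ((b i : ℝ) - a i) * D a i| ≤ η)
    (hD : ∀ a : ι → ℕ, (∀ i, a i ≤ m) → ∑ i, |D a i| ≤ C)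
    (i : ι) (lam : ι → ℕ) (hlam_i : lam i = 0) (hlam : ∀ j, lam j ≤ m)
    (hratio : ∀ k < m, R * (Finset.univ.filter fun j => k + 1 ≤ lam j).card ≤
      (Finset.univ.filter fun j => j ≠ i ∧ k ≤ lam j).card)
    (hlevel : ∀ k < m, R ≤ (Finset.univ.filter fun j => j ≠ i ∧ lam j = k).card) :
    ∃ j, u 0 - u (Pi.single j m) < ε := by
  by_contra! hbig
  set M : ℝ := (Fintype.card (Equiv.Perm ι) : ℝ) with hM
  have hMpos : 0 < M := by rw [hM]; exact_mod_cast Fintype.card_pos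
  have key := sub_single_le_of_symmetric (m := m) hR (C := M * C) (η := M * η)
    (fun a => ∑ s : Equiv.Perm ι, u (a ∘ s))
    (fun a j => ∑ s : Equiv.Perm ι, D (a ∘ s) (s⁻¹ j)) ?_ ?_ ?_ i lam hlam_i hlam hratio hlevel
  · rw [← Finset.sum_sub_distrib] at key
    have h1 : M * ε ≤ ∑ s : Equiv.Perm ι,
        (u ((0 : ι → ℕ) ∘ s) - u ((Pi.single i m : ι → ℕ) ∘ s)) := by
      have : ∑ _s : Equiv.Perm ι, ε = M * ε := by simp [hM]
      rw [← this]
      refine Finset.sum_le_sum fun s _ => ?_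
      have h2 : (Pi.single i m : ι → ℕ) ∘ s = Pi.single (s⁻¹ i) m := by
        funext j
        simp only [Function.comp, Pi.single_apply, Equiv.Perm.eq_inv_iff_eq]
      rw [h2]
      exact hbig _
    have h2 : 3 * (m * (M * η + M * C / R)) = M * (3 * (m * (η + C / R))) := by ring
    rw [h2] at key
    exact absurd (h1.trans key) (not_le.2 (mul_lt_mul_of_pos_left hε hMpos))
  · intro a b hab hb
    have hrew : ∑ j, ((b j : ℝ) - a j) * ∑ s : Equiv.Perm ι, D (a ∘ s) (s⁻¹ j) =
        ∑ s : Equiv.Perm ι, ∑ j, (((b ∘ s) j : ℝ) - (a ∘ s) j) * D (a ∘ s) j := by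
      simp_rw [Finset.mul_sum]
      rw [Finset.sum_comm]
      refine Finset.sum_congr rfl fun s _ => ?_
      rw [← Equiv.sum_comp s]
      simp
    rw [hrew, ← Finset.sum_sub_distrib, ← Finset.sum_sub_distrib]
    refine (Finset.abs_sum_le_sum_abs _ _).trans ?_
    refine (Finset.sum_le_sum fun (s : Equiv.Perm ι) _ => hu (a ∘ s) (b ∘ s) (fun j => hab (s j))
      fun j => hb (s j)).trans ?_
    simp [hM]
  · intro a ha
    calc ∑ j, |∑ s : Equiv.Perm ι, D (a ∘ s) (s⁻¹ j)|
        ≤ ∑ j, ∑ s : Equiv.Perm ι, |D (a ∘ s) (s⁻¹ j)| :=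
          Finset.sum_le_sum fun j _ => Finset.abs_sum_le_sum_abs _ _
      _ = ∑ s : Equiv.Perm ι, ∑ j, |D (a ∘ s) j| := by
          rw [Finset.sum_comm]
          refine Finset.sum_congr rfl fun s _ => ?_
          rw [← Equiv.sum_comp s]
          simp
      _ ≤ M * C := by
          refine (Finset.sum_le_sum fun (s : Equiv.Perm ι) _ => hD (a ∘ s) fun j => ha (s j)).trans ?_
          simp [hM]
  · intro a j k hjk
    have hswap : a ∘ Equiv.swap j k = a := by
      funext l
      simp only [Function.comp]
      rcases eq_or_ne l j with rfl | hlj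
      · simp [hjk]
      rcases eq_or_ne l k with rfl | hlk
      · simp [hjk]
      · rw [Equiv.swap_apply_of_ne_of_ne hlj hlk]
    rw [← Equiv.sum_comp (Equiv.mulLeft (Equiv.swap j k))]
    refine Finset.sum_congr rfl fun s _ => ?_
    simp [← Function.comp_assoc, hswap]

/-- In a lattice function on `{0, …, m}^N` with `N` large and controlled first-order expansions,
some coordinate direction has little influence. -/
theorem exists_card_forall_exists_sub_single_lt (m : ℕ) {C η ε : ℝ} (hε : 3 * (m * η) < ε) :
    ∃ N : ℕ, ∀ (u : (Fin N → ℕ) → ℝ) (D : (Fin N → ℕ) → Fin N → ℝ),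
      (∀ a b : Fin N → ℕ, (∀ i, b i = a i ∨ b i = a i + 1) → (∀ i, b i ≤ m) →
        |u b - u a - ∑ i, ((b i : ℝ) - a i) * D a i| ≤ η) →
      (∀ a : Fin N → ℕ, (∀ i, a i ≤ m) → ∑ i, |D a i| ≤ C) →
      ∃ j, u 0 - u (Pi.single j m) < ε := by
  obtain ⟨R, hR, hRε⟩ : ∃ R : ℕ, 0 < R ∧ 3 * (m * (η + C / R)) < ε := by
    have h1 : Filter.Tendsto (fun R : ℕ => 3 * (m * (η + C / (R : ℝ)))) Filter.atTop
        (nhds (3 * (m * (η + 0)))) :=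
      ((tendsto_const_nhds.add (tendsto_const_div_atTop_nhds_zero_nat C)).const_mul _).const_mul _
    rw [add_zero] at h1
    obtain ⟨R, h2, h3⟩ := ((h1.eventually_lt_const hε).and (Filter.eventually_gt_atTop 0)).exists
    exact ⟨R, h3, h2⟩
  have hQ : 1 < R + 1 := by omega
  have hpow : ∀ k, 0 < (R + 1) ^ k := fun k => pow_pos (by omega) k
  set N := (R + 1) ^ (m + 1) with hN
  refine ⟨N, fun u D hu hD => ?_⟩
  have hcount : ∀ k ≤ m + 1, (Finset.univ.filter fun j : Fin N => (j : ℕ) < (R + 1) ^ k).card =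
      (R + 1) ^ k := by
    intro k hk
    rw [Fin.card_filter_val_lt]
    exact min_eq_right (Nat.pow_le_pow_right (by omega) hk)
  set lam : Fin N → ℕ := fun j => m - Nat.log (R + 1) j with hlam
  have hle : ∀ k, 0 < k → k ≤ m → ∀ j, k ≤ lam j ↔ (j : ℕ) < (R + 1) ^ (m - k + 1) := by
    intro k hk hkm j
    have h1 : k ≤ lam j ↔ Nat.log (R + 1) j < m - k + 1 := by simp only [hlam]; omega
    rw [h1]
    rcases Nat.eq_zero_or_pos (j : ℕ) with h0 | h0
    · simp [h0]
    · exact Nat.log_lt_iff_lt_pow hQ h0.ne'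
  have hle' : ∀ k ≤ m, ∀ j, k ≤ lam j ↔ (j : ℕ) < (R + 1) ^ (m - k + 1) := by
    intro k hk j
    rcases Nat.eq_zero_or_pos k with rfl | h0
    · simp [← hN]
    · exact hle k h0 hk j
  let i : Fin N := ⟨N - 1, by have := hpow (m + 1); omega⟩
  have hcardle : ∀ k ≤ m, (Finset.univ.filter fun j => k ≤ lam j).card = (R + 1) ^ (m - k + 1) := by
    intro k hk
    simp_rw [hle' k hk]
    exact hcount _ (by omega)
  have herase : ∀ S : Finset (Fin N), S.card - 1 ≤ (S.erase i).card := fun S =>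
    Finset.pred_card_le_card_erase
  refine exists_sub_single_le hR hRε u D hu hD i lam ?_ (fun j => Nat.sub_le _ _) ?_ ?_
  · have h1 : m ≤ Nat.log (R + 1) (N - 1) := by
      refine Nat.le_log_of_pow_le hQ ?_
      have := hpow m
      have h2 : N = (R + 1) ^ m * R + (R + 1) ^ m := by rw [hN]; ring
      have h3 : 0 < (R + 1) ^ m * R := Nat.mul_pos (hpow m) hR
      omega
    simp only [hlam, i]
    omega
  · intro k hk
    rw [hcardle (k + 1) hk]
    have h1 : (Finset.univ.filter fun j => j ≠ i ∧ k ≤ lam j) =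
        (Finset.univ.filter fun j => k ≤ lam j).erase i := by
      ext j; simp
    rw [h1]
    refine le_trans ?_ (herase _)
    rw [hcardle k hk.le]
    obtain ⟨p, rfl⟩ : ∃ p, m = k + 1 + p := ⟨m - (k + 1), by omega⟩
    have e1 : k + 1 + p - (k + 1) + 1 = p + 1 := by omega
    have e2 : k + 1 + p - k + 1 = p + 1 + 1 := by omega
    rw [e1, e2, pow_succ (R + 1) (p + 1)]
    have := hpow (p + 1)
    have h3 : (R + 1) ^ (p + 1) * (R + 1) = R * (R + 1) ^ (p + 1) + (R + 1) ^ (p + 1) := by ring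
    omega
  · intro k hk
    have h1 : (Finset.univ.filter fun j => j ≠ i ∧ lam j = k) =
        ((Finset.univ.filter fun j => k ≤ lam j) \
          (Finset.univ.filter fun j => k + 1 ≤ lam j)).erase i := by
      ext j; simp; omega
    rw [h1]
    refine le_trans ?_ (herase _)
    rw [Finset.card_sdiff_of_subset, hcardle k hk.le, hcardle (k + 1) hk]
    · obtain ⟨p, rfl⟩ : ∃ p, m = k + 1 + p := ⟨m - (k + 1), by omega⟩
      have e1 : k + 1 + p - (k + 1) + 1 = p + 1 := by omega
      have e2 : k + 1 + p - k + 1 = p + 1 + 1 := by omega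
      rw [e1, e2, pow_succ (R + 1) (p + 1)]
      have h3 : (R + 1) ^ (p + 1) * (R + 1) = R * (R + 1) ^ (p + 1) + (R + 1) ^ (p + 1) := by ring
      have h4 : R + 1 ≤ (R + 1) ^ (p + 1) := Nat.le_self_pow (by omega) _
      have h5 : R * (R + 1) ≤ R * (R + 1) ^ (p + 1) := Nat.mul_le_mul_left _ h4
      have h6 : R + 1 ≤ R * (R + 1) := by nlinarith
      omega
    · intro j
      simp only [Finset.mem_filter, Finset.mem_univ, true_and]
      omega

/-- A first-order expansion with error controlled by the oscillation of the derivative, valid up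
to the boundary of the unit ball. -/
theorem norm_sub_sub_le_of_closedBall {E : Type u} {X : Type v} [NormedAddCommGroup E]
    [NormedSpace ℝ E] [NormedAddCommGroup X] [NormedSpace ℝ X] {F : E → X} {F' : E → E →L[ℝ] X}
    (hFcont : ContinuousOn F (closedBall 0 1)) (hFderiv : ∀ x ∈ ball (0 : E) 1, HasFDerivAt F (F' x) x)
    {δ η : ℝ} (hδ : ∀ x ∈ ball (0 : E) 1, ∀ y ∈ ball (0 : E) 1, dist x y < δ → ‖F' x - F' y‖ ≤ η)
    {x h : E} (hx : x ∈ ball (0 : E) 1) (hxh : x + h ∈ closedBall (0 : E) 1) (hh : ‖h‖ < δ) :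
    ‖F (x + h) - F x - F' x h‖ ≤ η * ‖h‖ := by
  rw [mem_ball_zero_iff] at hx
  rw [mem_closedBall_zero_iff] at hxh
  have hnorm : ∀ t : ℝ, x + t • h = (1 - t) • x + t • (x + h) := fun t => by module
  have hmem : ∀ t ∈ Set.Ico (0 : ℝ) 1, x + t • h ∈ ball (0 : E) 1 := by
    rintro t ⟨h0, h1⟩
    rw [mem_ball_zero_iff, hnorm]
    refine (norm_add_le _ _).trans_lt ?_
    rw [norm_smul, norm_smul, Real.norm_of_nonneg h0, Real.norm_of_nonneg (by linarith)]
    nlinarith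
  have hmem' : ∀ t ∈ Set.Icc (0 : ℝ) 1, x + t • h ∈ closedBall (0 : E) 1 := by
    rintro t ⟨h0, h1⟩
    rw [mem_closedBall_zero_iff, hnorm]
    refine (norm_add_le _ _).trans ?_
    rw [norm_smul, norm_smul, Real.norm_of_nonneg h0, Real.norm_of_nonneg (by linarith)]
    nlinarith
  have key := norm_image_sub_le_of_norm_deriv_right_le_segment (a := (0 : ℝ)) (b := 1)
    (f := fun t : ℝ => F (x + t • h) - t • F' x h) (f' := fun t => F' (x + t • h) h - F' x h)
    (C := η * ‖h‖) ?_ ?_ ?_ 1 (by simp)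
  · simpa [sub_right_comm] using key
  · refine (hFcont.comp (by fun_prop) hmem').sub (by fun_prop)
  · intro t ht
    have h1 : HasDerivAt (fun t : ℝ => x + t • h) h t := by
      simpa using ((hasDerivAt_id t).smul_const h).const_add x
    have h2 : HasDerivAt (fun t : ℝ => t • F' x h) (F' x h) t := by
      simpa using (hasDerivAt_id t).smul_const (F' x h)
    exact (((hFderiv _ (hmem t ht)).comp_hasDerivAt t h1).sub h2).hasDerivWithinAt
  · intro t ht
    rw [← sub_apply]
    refine (ContinuousLinearMap.le_opNorm _ _).trans ?_
    refine mul_le_mul_of_nonneg_right (hδ _ (hmem t ht) _ (mem_ball_zero_iff.2 hx) ?_)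
      (norm_nonneg _)
    rw [dist_eq_norm, add_sub_cancel_left, norm_smul, Real.norm_of_nonneg ht.1]
    exact lt_of_le_of_lt (mul_le_of_le_one_left (norm_nonneg _) ht.2.le) hh

/-- A uniformly continuous map on the unit ball of a normed space is bounded. -/
theorem exists_norm_le_of_uniformContinuousOn_ball {E : Type u} {Y : Type v}
    [NormedAddCommGroup E] [NormedSpace ℝ E] [NormedAddCommGroup Y] {f : E → Y}
    (hf : UniformContinuousOn f (ball 0 1)) : ∃ C, 0 ≤ C ∧ ∀ x ∈ ball (0 : E) 1, ‖f x‖ ≤ C := by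
  obtain ⟨δ, hδ, hfδ⟩ := Metric.uniformContinuousOn_iff.1 hf 1 one_pos
  obtain ⟨n, hn⟩ := exists_nat_one_div_lt hδ
  have hn0 : (0 : ℝ) < n + 1 := by positivity
  refine ⟨‖f 0‖ + (n + 1), by positivity, fun x hx => ?_⟩
  rw [mem_ball_zero_iff] at hx
  have hmem : ∀ k ≤ n + 1, ((k : ℝ) / (n + 1)) • x ∈ ball (0 : E) 1 := by
    intro k hk
    have : (k : ℝ) / (n + 1) ≤ 1 := (div_le_one hn0).2 (by exact_mod_cast hk)
    rw [mem_ball_zero_iff, norm_smul, Real.norm_of_nonneg (by positivity)]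
    exact lt_of_le_of_lt (mul_le_of_le_one_left (norm_nonneg _) this) hx
  have key : ∀ k ≤ n + 1, ‖f (((k : ℝ) / (n + 1)) • x)‖ ≤ ‖f 0‖ + k := by
    intro k
    induction k with
    | zero => simp
    | succ k ih =>
      intro hk
      have h1 := hfδ _ (hmem (k + 1) hk) _ (hmem k (by omega)) (by
        rw [dist_eq_norm, ← sub_smul, norm_smul]
        have : ((k + 1 : ℕ) : ℝ) / (n + 1) - k / (n + 1) = 1 / (n + 1) := by
          push_cast; ring
        rw [this, Real.norm_of_nonneg (by positivity)]
        exact lt_of_le_of_lt (mul_le_of_le_one_right (by positivity) hx.le) hn)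
      rw [dist_eq_norm] at h1
      have h2 := ih (by omega)
      have h3 := norm_le_norm_add_norm_sub' (f (((k + 1 : ℕ) / (n + 1) : ℝ) • x))
        (f (((k : ℝ) / (n + 1)) • x))
      push_cast at h1 h3 ⊢
      linarith
  have := key (n + 1) le_rfl
  push_cast at this
  rwa [div_self hn0.ne', one_smul] at this

/-- The Banach space of bounded real functions on `Γ`. -/
abbrev EllInfty (Γ : Type u) : Type u := lp (fun _ : Γ => ℝ) ⊤

namespace EllInfty

variable {Γ : Type u}

/-- The indicator function of a set, as an element of `ℓ∞(Γ)`. -/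
noncomputable def ind (B : Set Γ) : EllInfty Γ :=
  ⟨B.indicator 1, memℓp_infty ⟨1, by
    rintro _ ⟨γ, rfl⟩
    by_cases h : γ ∈ B <;> simp [h]⟩⟩

theorem ind_apply_of_mem {B : Set Γ} {γ : Γ} (h : γ ∈ B) : ind B γ = 1 :=
  Set.indicator_of_mem h 1

theorem ind_apply_of_notMem {B : Set Γ} {γ : Γ} (h : γ ∉ B) : ind B γ = 0 :=
  Set.indicator_of_notMem h 1

theorem norm_ind_le (B : Set Γ) : ‖ind B‖ ≤ 1 := by
  refine lp.norm_le_of_forall_le zero_le_one fun γ => ?_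
  by_cases h : γ ∈ B
  · simp [ind_apply_of_mem h]
  · simp [ind_apply_of_notMem h]

theorem abs_apply_le_norm (z : EllInfty Γ) (γ : Γ) : |z γ| ≤ ‖z‖ :=
  lp.norm_apply_le_norm ENNReal.top_ne_zero z γ

theorem add_apply (x y : EllInfty Γ) (γ : Γ) : (x + y) γ = x γ + y γ := rfl

theorem smul_apply (c : ℝ) (x : EllInfty Γ) (γ : Γ) : (c • x) γ = c * x γ := rfl

theorem sum_smul_apply {ι : Type*} [Fintype ι] (c : ι → ℝ) (z : ι → EllInfty Γ) (γ : Γ) :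
    (∑ i, c i • z i : EllInfty Γ) γ = ∑ i, c i * z i γ := by
  rw [lp.coeFn_sum]
  exact Finset.sum_apply γ _ _

theorem norm_sum_smul_le {ι : Type*} [Fintype ι] {B : ι → Set Γ}
    (hB : Pairwise fun i j => Disjoint (B i) (B j)) {z : ι → EllInfty Γ}
    (hzB : ∀ i, ∀ γ ∉ B i, z i γ = 0) (hz : ∀ i, ‖z i‖ ≤ 1) {c : ι → ℝ} {r : ℝ} (hr : 0 ≤ r)
    (hc : ∀ i, |c i| ≤ r) : ‖(∑ i, c i • z i : EllInfty Γ)‖ ≤ r := by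
  refine lp.norm_le_of_forall_le hr fun γ => ?_
  rw [sum_smul_apply]
  by_cases h : ∃ i, γ ∈ B i
  · obtain ⟨i, hi⟩ := h
    rw [Finset.sum_eq_single i]
    · rw [norm_mul, Real.norm_eq_abs, Real.norm_eq_abs]
      calc |c i| * |z i γ| ≤ r * 1 :=
            mul_le_mul (hc i) ((abs_apply_le_norm _ _).trans (hz i)) (abs_nonneg _) hr
        _ = r := mul_one r
    · intro j _ hj
      rw [hzB j γ fun hjγ => Set.disjoint_left.1 (hB hj) hjγ hi, mul_zero]
    · simp
  · push Not at h
    simpa [fun i => hzB i γ (h i)] using hr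

theorem sum_abs_apply_le {ι : Type*} [Fintype ι] {B : ι → Set Γ}
    (hB : Pairwise fun i j => Disjoint (B i) (B j)) {z : ι → EllInfty Γ}
    (hzB : ∀ i, ∀ γ ∉ B i, z i γ = 0) (hz : ∀ i, ‖z i‖ ≤ 1) (L : EllInfty Γ →L[ℝ] ℝ) :
    ∑ i, |L (z i)| ≤ ‖L‖ := by
  have h1 : ∑ i, |L (z i)| = L (∑ i, (SignType.sign (L (z i)) : ℝ) • z i) := by
    simp [map_sum, sign_mul_self]
  rw [h1]
  refine (le_abs_self _).trans ((L.le_opNorm _).trans ?_)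
  refine mul_le_of_le_one_right (norm_nonneg _) (norm_sum_smul_le hB hzB hz zero_le_one fun i => ?_)
  rcases lt_trichotomy (L (z i)) 0 with h | h | h <;> simp [h]

variable [DecidableEq Γ]

/-- The multiple `t • e_γ` of a unit vector of `ℓ∞(Γ)`. -/
noncomputable abbrev single (γ : Γ) (t : ℝ) : EllInfty Γ := lp.single ⊤ γ t

theorem norm_add_single_le {z : EllInfty Γ} {γ : Γ} (hzγ : z γ = 0) {r t : ℝ} (hz : ‖z‖ ≤ r)
    (ht : |t| ≤ r) : ‖z + single γ t‖ ≤ r := by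
  refine lp.norm_le_of_forall_le ((norm_nonneg _).trans hz) fun β => ?_
  rcases eq_or_ne β γ with rfl | h
  · simpa [hzγ] using ht
  · simpa [h] using (abs_apply_le_norm z β).trans hz

end EllInfty

open EllInfty in
/-- For a map with uniformly continuous derivative, only boundedly many disjoint blocks of
coordinates can substantially decrease a functional of its increment in a direction `e_γ`. -/
theorem exists_card_forall_exists_increment_lt {Γ : Type u} [DecidableEq Γ] {X : Type v}
    [NormedAddCommGroup X] [NormedSpace ℝ X] {F : EllInfty Γ → X}
    {F' : EllInfty Γ → EllInfty Γ →L[ℝ] X} (hFcont : ContinuousOn F (closedBall 0 1))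
    (hFderiv : ∀ x ∈ ball (0 : EllInfty Γ) 1, HasFDerivAt F (F' x) x)
    (hF'unif : UniformContinuousOn F' (ball 0 1)) {r s p q : ℝ} (hr : r < 1) (hs0 : 0 ≤ s)
    (hsr : s ≤ r) (hp : |p| ≤ r) (hq : |q| ≤ r) {ε : ℝ} (hε : 0 < ε) :
    ∃ N : ℕ, ∀ (γ : Γ) (φ : StrongDual ℝ X), ‖φ‖ ≤ 1 → ∀ B : Fin N → Set Γ,
      Pairwise (fun i j => Disjoint (B i) (B j)) → (∀ i, γ ∉ B i) →
      ∃ i, φ (F (single γ p) - F (single γ q)) -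
        φ (F (s • ind (B i) + single γ p) - F (s • ind (B i) + single γ q)) < ε := by
  obtain ⟨C, hC0, hC⟩ := exists_norm_le_of_uniformContinuousOn_ball hF'unif
  obtain ⟨δ, hδ, hδF⟩ := Metric.uniformContinuousOn_iff.1 hF'unif (ε / 12) (by positivity)
  have hδF' : ∀ x ∈ ball (0 : EllInfty Γ) 1, ∀ y ∈ ball (0 : EllInfty Γ) 1, dist x y < δ →
      ‖F' x - F' y‖ ≤ ε / 12 := fun x hx y hy h => by
    simpa [dist_eq_norm] using (hδF x hx y hy h).le
  obtain ⟨n, hn⟩ := exists_nat_one_div_lt hδ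
  set m : ℕ := n + 1 with hm
  have hm0 : (0 : ℝ) < m := by rw [hm]; positivity
  set d : ℝ := s / m with hd
  have hd0 : 0 ≤ d := by positivity
  have hmd : m * d = s := mul_div_cancel₀ _ hm0.ne'
  have hdδ : d < δ := by
    refine lt_of_le_of_lt ?_ hn
    rw [hd, hm]
    push_cast
    exact div_le_div_of_nonneg_right (hsr.trans hr.le) (by positivity)
  obtain ⟨N, hN⟩ := exists_card_forall_exists_sub_single_lt m (C := d * (C + C))
    (η := ε / 12 * d + ε / 12 * d) (ε := ε) (by
      have : 3 * (m * (ε / 12 * d + ε / 12 * d)) = ε / 2 * (m * d) := by ring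
      rw [this, hmd]
      nlinarith)
  refine ⟨N, fun γ φ hφ B hB hγ => ?_⟩
  have hindB : ∀ i, ∀ β ∉ B i, ind (B i) β = 0 := fun i β => ind_apply_of_notMem
  have hind : ∀ i, ‖ind (B i)‖ ≤ 1 := fun i => norm_ind_le _
  -- points of the lattice spanned by the blocks
  let vec : (Fin N → ℕ) → EllInfty Γ := fun a => ∑ i, (d * a i) • ind (B i)
  have hvecγ : ∀ a, vec a γ = 0 := fun a => by
    simp only [vec]
    rw [sum_smul_apply]
    simp [fun i => ind_apply_of_notMem (hγ i)]
  have hvec : ∀ a : Fin N → ℕ, (∀ i, a i ≤ m) → ‖vec a‖ ≤ r := fun a ha =>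
    (norm_sum_smul_le hB hindB hind hs0 fun i => by
      rw [abs_of_nonneg (by positivity), ← hmd, mul_comm]
      exact mul_le_mul_of_nonneg_right (by exact_mod_cast ha i) hd0).trans hsr
  have hball : ∀ a : Fin N → ℕ, (∀ i, a i ≤ m) → ∀ t : ℝ, |t| ≤ r →
      vec a + single γ t ∈ ball (0 : EllInfty Γ) 1 := fun a ha t ht =>
    mem_ball_zero_iff.2 ((norm_add_single_le (hvecγ a) (hvec a ha) ht).trans_lt hr)
  let L : (Fin N → ℕ) → StrongDual ℝ (EllInfty Γ) := fun a =>
    φ.comp (F' (vec a + single γ p) - F' (vec a + single γ q))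
  have key := hN (fun a => φ (F (vec a + single γ p) - F (vec a + single γ q)))
    (fun a i => d * L a (ind (B i))) ?_ ?_
  · obtain ⟨j, hj⟩ := key
    refine ⟨j, ?_⟩
    have h0 : vec 0 = 0 := Finset.sum_eq_zero fun i _ => by
      rw [Pi.zero_apply, Nat.cast_zero, mul_zero, zero_smul]
    have h1 : vec (Pi.single j m) = s • ind (B j) := by
      simp only [vec]
      rw [Finset.sum_eq_single j]
      · rw [Pi.single_eq_same, mul_comm, hmd]
      · intro i _ hi
        rw [Pi.single_eq_of_ne hi, Nat.cast_zero, mul_zero, zero_smul]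
      · exact fun h => absurd (Finset.mem_univ j) h
    rwa [h0, h1, zero_add, zero_add] at hj
  · intro a b hab hb
    have ha : ∀ i, a i ≤ m := fun i => by
      rcases hab i with h | h <;> have := hb i <;> omega
    set h : EllInfty Γ := ∑ i, (d * ((b i : ℝ) - a i)) • ind (B i) with hh
    have hbvec : vec b = vec a + h := by
      simp only [vec, hh]
      rw [← Finset.sum_add_distrib]
      refine Finset.sum_congr rfl fun i _ => ?_
      rw [← add_smul]
      congr 1
      ring
    have hnorm : ‖h‖ ≤ d := norm_sum_smul_le hB hindB hind hd0 fun i => by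
      rcases hab i with h | h <;> simp [h, abs_of_nonneg hd0, hd0]
    have hL : ∑ i, ((b i : ℝ) - a i) * (d * L a (ind (B i))) = L a h := by
      rw [hh, map_sum]
      refine Finset.sum_congr rfl fun i _ => ?_
      rw [map_smul, smul_eq_mul]
      ring
    have hest : ∀ t : ℝ, |t| ≤ r → |φ (F (vec b + single γ t) - F (vec a + single γ t) -
        F' (vec a + single γ t) h)| ≤ ε / 12 * d := by
      intro t ht
      have e : vec b + single γ t = vec a + single γ t + h := by rw [hbvec]; abel
      rw [e]
      have h1 := norm_sub_sub_le_of_closedBall hFcont hFderiv hδF' (hball a ha t ht)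
        (h := h) (by rw [← e]; exact ball_subset_closedBall (hball b hb t ht))
        (hnorm.trans_lt hdδ)
      refine (φ.le_opNorm _).trans ((mul_le_of_le_one_left (norm_nonneg _) hφ).trans (h1.trans ?_))
      exact mul_le_mul_of_nonneg_left hnorm (by positivity)
    rw [hL]
    have e : φ (F (vec b + single γ p) - F (vec b + single γ q)) -
        φ (F (vec a + single γ p) - F (vec a + single γ q)) - L a h =
        φ (F (vec b + single γ p) - F (vec a + single γ p) - F' (vec a + single γ p) h) -
        φ (F (vec b + single γ q) - F (vec a + single γ q) - F' (vec a + single γ q) h) := by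
      simp only [L, ContinuousLinearMap.comp_apply, sub_apply, map_sub]
      ring
    rw [e]
    exact (abs_sub _ _).trans (add_le_add (hest p hp) (hest q hq))
  · intro a ha
    have hLC : ‖L a‖ ≤ C + C := by
      refine (ContinuousLinearMap.opNorm_comp_le _ _).trans ?_
      refine (mul_le_of_le_one_left (norm_nonneg _) hφ).trans ?_
      exact (norm_sub_le _ _).trans (add_le_add (hC _ (hball a ha p hp)) (hC _ (hball a ha q hq)))
    simp_rw [abs_mul, abs_of_nonneg hd0]
    rw [← Finset.mul_sum]
    exact mul_le_mul_of_nonneg_left ((sum_abs_apply_le hB hindB hind (L a)).trans hLC) hd0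

open EllInfty in
/-- **Rosenthal's theorem**: an operator on `ℓ∞(Γ)` bounded below on the unit vectors `e_γ` for
`γ` in a set of full cardinality is bounded below on `ℓ∞(Γ')` for a subset `Γ'` of it of full
cardinality. -/
theorem exists_subset_bounded_below {Γ : Type u} [DecidableEq Γ] [Infinite Γ] {X : Type v}
    [NormedAddCommGroup X] [NormedSpace ℝ X] (T : EllInfty Γ →L[ℝ] X) {A : Set Γ}
    (hA : Cardinal.mk A = Cardinal.mk Γ) {c : ℝ} (hc : 0 < c)
    (hT : ∀ γ ∈ A, c ≤ ‖T (single γ 1)‖) :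
    ∃ Γ' ⊆ A, Cardinal.mk Γ' = Cardinal.mk Γ ∧
      ∀ z : EllInfty Γ, (∀ γ ∉ Γ', z γ = 0) → c / 4 * ‖z‖ ≤ ‖T z‖ := by
  choose φ hφ hφT using fun γ => exists_dual_vector'' ℝ (T (single γ 1))
  obtain ⟨N, hN⟩ := exists_nat_gt (‖T‖ / (c / 2))
  rw [div_lt_iff₀ (by positivity)] at hN
  obtain ⟨Γ', hΓ'A, hcard, hgood⟩ := exists_subset_forall_not_bad
    (fun γ B => ∃ z : EllInfty Γ, ‖z‖ ≤ 1 ∧ (∀ β ∉ B, z β = 0) ∧ c / 2 ≤ φ γ (T z)) N A hA (by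
      intro γ _ B hB _ hbad
      choose z hz hzB hzc using hbad
      have h1 := sum_abs_apply_le hB hzB hz ((φ γ).comp T)
      have h2 : ‖(φ γ).comp T‖ ≤ ‖T‖ := (ContinuousLinearMap.opNorm_comp_le _ _).trans
        (mul_le_of_le_one_left (norm_nonneg _) (hφ γ))
      have h3 : (N : ℝ) * (c / 2) ≤ ∑ i, |((φ γ).comp T) (z i)| := by
        have : ∑ _i : Fin N, c / 2 = N * (c / 2) := by simp
        rw [← this]
        exact Finset.sum_le_sum fun i _ => (hzc i).trans (le_abs_self _)
      linarith)
  refine ⟨Γ', hΓ'A, hcard, fun z hz => ?_⟩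
  rcases (norm_nonneg z).eq_or_lt with h0 | h0
  · rw [← h0, mul_zero]
    exact norm_nonneg _
  obtain ⟨γ, hγ⟩ : ∃ γ, 3 / 4 * ‖z‖ < |z γ| := by
    by_contra! h
    have := lp.norm_le_of_forall_le (f := z) (C := 3 / 4 * ‖z‖) (by positivity) h
    linarith
  have hγΓ' : γ ∈ Γ' := by
    by_contra h
    rw [hz γ h, abs_zero] at hγ
    linarith
  set w : EllInfty Γ := z - single γ (z γ) with hw
  have hwB : ∀ β ∉ Γ' \ {γ}, w β = 0 := by
    intro β hβ
    rcases eq_or_ne β γ with rfl | hne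
    · simp [hw]
    · simp [hw, hne, hz β fun h => hβ ⟨h, hne⟩]
  have hwz : ‖w‖ ≤ ‖z‖ := by
    refine lp.norm_le_of_forall_le h0.le fun β => ?_
    rcases eq_or_ne β γ with rfl | hne
    · simp [hw]
    · simpa [hw, hne] using abs_apply_le_norm z β
  have hsmall : ∀ e : ℝ, |e| = 1 → e * φ γ (T w) < c / 2 * ‖z‖ := by
    intro e he
    by_contra! h
    refine hgood γ hγΓ' ⟨(e / ‖z‖) • w, ?_, fun β hβ => ?_, ?_⟩
    · rw [norm_smul, norm_div, norm_norm, Real.norm_eq_abs, he, one_div_mul_eq_div]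
      exact (div_le_one h0).2 hwz
    · simp [hwB β hβ]
    · rw [map_smul, map_smul, smul_eq_mul, div_mul_eq_mul_div]
      exact (le_div_iff₀ h0).2 h
  have h1 : |φ γ (T w)| ≤ c / 2 * ‖z‖ := by
    have e1 := hsmall 1 (by simp)
    have e2 := hsmall (-1) (by simp)
    exact abs_le.2 ⟨by linarith, by linarith⟩
  have h2 : φ γ (T z) = z γ * ‖T (single γ 1)‖ + φ γ (T w) := by
    have e1 : z = z γ • single γ (1 : ℝ) + w := by
      rw [hw, single, single, ← lp.single_smul, smul_eq_mul, mul_one, add_sub_cancel]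
    have e2 : (‖T (single γ 1)‖ : ℝ) = φ γ (T (single γ 1)) := (hφT γ).symm
    conv_lhs => rw [e1]
    rw [map_add, map_smul, map_add, map_smul, smul_eq_mul, e2]
  have h3 : |φ γ (T z)| ≤ ‖T z‖ :=
    ((φ γ).le_opNorm _).trans (mul_le_of_le_one_left (norm_nonneg _) (hφ γ))
  have h4 : |z γ * ‖T (single γ 1)‖| - |φ γ (T w)| ≤ |φ γ (T z)| := by
    rw [h2]
    have := abs_sub_abs_le_abs_sub (z γ * ‖T (single γ 1)‖) (-φ γ (T w))
    rwa [abs_neg, sub_neg_eq_add] at this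
  rw [abs_mul, abs_norm] at h4
  have h5 : 3 / 4 * ‖z‖ * c ≤ |z γ| * ‖T (single γ 1)‖ :=
    mul_le_mul hγ.le (hT γ (hΓ'A hγΓ')) hc.le (abs_nonneg _)
  linarith

open EllInfty in
/-- An operator bounded below on `ℓ∞(Γ')` with `Γ'` of full cardinality yields an isomorphic copy of
`ℓ∞(Γ)` in its codomain. -/
theorem exists_subspace_equiv_of_bounded_below {Γ : Type u} {X : Type v} [NormedAddCommGroup X]
    [NormedSpace ℝ X] (T : EllInfty Γ →L[ℝ] X) {Γ' : Set Γ}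
    (hcard : Cardinal.mk Γ' = Cardinal.mk Γ) {l : ℝ} (hl : 0 < l)
    (hT : ∀ z : EllInfty Γ, (∀ γ ∉ Γ', z γ = 0) → l * ‖z‖ ≤ ‖T z‖) :
    ∃ Y : Subspace ℝ X, Nonempty (EllInfty Γ ≃L[ℝ] Y) := by
  classical
  obtain ⟨e⟩ := Cardinal.eq.1 hcard
  have hbdd : ∀ z : EllInfty Γ, ∀ γ, ‖(if h : γ ∈ Γ' then z (e ⟨γ, h⟩) else 0 : ℝ)‖ ≤ ‖z‖ := by
    intro z γ
    split_ifs with h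
    · exact abs_apply_le_norm z _
    · simp
  let J : EllInfty Γ →ₗ[ℝ] EllInfty Γ :=
    { toFun := fun z => ⟨fun γ => if h : γ ∈ Γ' then z (e ⟨γ, h⟩) else 0,
        memℓp_infty ⟨‖z‖, by rintro _ ⟨γ, rfl⟩; exact hbdd z γ⟩⟩
      map_add' := fun x y => by
        ext γ
        rw [add_apply]
        by_cases h : γ ∈ Γ' <;> simp [h, add_apply]
      map_smul' := fun c x => by
        ext γ
        by_cases h : γ ∈ Γ' <;> simp [h] }
  have hJle : ∀ z, ‖J z‖ ≤ ‖z‖ := fun z => lp.norm_le_of_forall_le (norm_nonneg _) (hbdd z)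
  have hJge : ∀ z, ‖z‖ ≤ ‖J z‖ := fun z => by
    refine lp.norm_le_of_forall_le (norm_nonneg _) fun γ => ?_
    have h1 : J z (e.symm γ) = z γ := by
      change (if h : (e.symm γ : Γ) ∈ Γ' then z (e ⟨e.symm γ, h⟩) else 0) = z γ
      rw [dif_pos (e.symm γ).2, Subtype.coe_eta, Equiv.apply_symm_apply]
    rw [← h1]
    exact abs_apply_le_norm _ _
  have hlow : ∀ z, l * ‖z‖ ≤ ‖T (J z)‖ := fun z =>
    (mul_le_mul_of_nonneg_left (hJge z) hl.le).trans (hT (J z) fun γ hγ => dif_neg hγ)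
  let S : EllInfty Γ →ₗ[ℝ] X := T.toLinearMap ∘ₗ J
  have hinj : Function.Injective S := by
    rw [injective_iff_map_eq_zero]
    intro z hz
    have h1 := hlow z
    rw [show T (J z) = 0 from hz, norm_zero] at h1
    exact norm_le_zero_iff.1 (nonpos_of_mul_nonpos_right h1 hl)
  refine ⟨LinearMap.range S, ⟨(LinearEquiv.ofInjective S hinj).toContinuousLinearEquivOfBounds
    ‖T‖ l⁻¹ (fun z => ?_) (fun y => ?_)⟩⟩
  · exact (T.le_opNorm _).trans (mul_le_mul_of_nonneg_left (hJle z) (norm_nonneg _))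
  · obtain ⟨z, rfl⟩ := (LinearEquiv.ofInjective S hinj).surjective y
    rw [LinearEquiv.symm_apply_apply, inv_mul_eq_div, le_div_iff₀ hl, mul_comm]
    exact hlow z

open EllInfty in
/-- A map increasing by at least `c` between `0` and each `e_γ` has, on a set of indices of full
cardinality, a derivative at a common multiple `s • e_γ` that is large in the direction `e_γ`. -/
theorem exists_common_height {Γ : Type u} [DecidableEq Γ] (hΓ : (Cardinal.mk Γ).IsRegular)
    {X : Type v} [NormedAddCommGroup X] [NormedSpace ℝ X] {F : EllInfty Γ → X}
    {F' : EllInfty Γ → EllInfty Γ →L[ℝ] X} (hFcont : ContinuousOn F (closedBall 0 1))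
    (hFderiv : ∀ x ∈ ball (0 : EllInfty Γ) 1, HasFDerivAt F (F' x) x)
    {δ η c : ℝ} (hδ0 : 0 < δ) (hδ : ∀ x ∈ ball (0 : EllInfty Γ) 1,
      ∀ y ∈ ball (0 : EllInfty Γ) 1, dist x y < δ → ‖F' x - F' y‖ ≤ η)
    (hc : ∀ γ, c ≤ ‖F (single γ 1) - F 0‖) :
    ∃ s : ℝ, 0 ≤ s ∧ s < 1 ∧ ∃ A : Set Γ, Cardinal.mk A = Cardinal.mk Γ ∧
      ∀ γ ∈ A, c - η ≤ ‖F' (single γ s) (single γ 1)‖ := by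
  obtain ⟨n, hn⟩ := exists_nat_one_div_lt hδ0
  have hn0 : (0 : ℝ) < n + 1 := by positivity
  have hstep : ∀ γ, ∃ k : Fin (n + 1),
      c - η ≤ ‖F' (single γ ((k : ℕ) / (n + 1) : ℝ)) (single γ 1)‖ := by
    intro γ
    by_contra! hlt
    have h1 : ∀ k < n + 1, ‖F (single γ (((k + 1 : ℕ) : ℝ) / (n + 1))) -
        F (single γ ((k : ℝ) / (n + 1)))‖ < c / (n + 1) := by
      intro k hk
      have e : single γ (((k + 1 : ℕ) : ℝ) / (n + 1)) =
          single γ ((k : ℝ) / (n + 1)) + (1 / ((n : ℝ) + 1)) • single γ 1 := by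
        rw [single, single, single, ← lp.single_smul, ← lp.single_add]
        congr 1
        push_cast
        simp [add_div]
      have hk1 : (((k + 1 : ℕ) : ℝ) / (n + 1)) ≤ 1 :=
        (div_le_one hn0).2 (by exact_mod_cast hk)
      have hk2 : ((k : ℝ) / (n + 1)) < 1 :=
        (div_lt_one hn0).2 (by exact_mod_cast hk)
      have hh : ‖(1 / ((n : ℝ) + 1)) • single γ 1‖ = 1 / (n + 1) := by
        rw [norm_smul, lp.norm_single (by simp), norm_one, mul_one,
          Real.norm_of_nonneg (by positivity)]
      have h2 := norm_sub_sub_le_of_closedBall hFcont hFderiv hδ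
        (x := single γ ((k : ℝ) / (n + 1))) (h := (1 / ((n : ℝ) + 1)) • single γ 1)
        (by
          rw [mem_ball_zero_iff, lp.norm_single (by simp), Real.norm_of_nonneg (by positivity)]
          exact hk2)
        (by
          rw [← e, mem_closedBall_zero_iff, lp.norm_single (by simp),
            Real.norm_of_nonneg (by positivity)]
          exact hk1)
        (by rw [hh]; exact hn)
      rw [hh, ← e, map_smul] at h2
      have h3 := hlt ⟨k, hk⟩
      have h4 := norm_le_norm_add_norm_sub'
        (F (single γ (((k + 1 : ℕ) : ℝ) / (n + 1))) - F (single γ ((k : ℝ) / (n + 1))))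
        ((1 / ((n : ℝ) + 1)) • F' (single γ ((k : ℝ) / (n + 1))) (single γ 1))
      rw [norm_smul, Real.norm_of_nonneg (by positivity)] at h4
      have h5 := mul_lt_mul_of_pos_left h3 (show 0 < 1 / ((n : ℝ) + 1) by positivity)
      have h6 : 1 / ((n : ℝ) + 1) * (c - η) + η * (1 / (n + 1)) = c / (n + 1) := by ring
      simp only at h5
      linarith
    have h2 := Finset.sum_range_sub (fun k : ℕ => F (single γ ((k : ℝ) / (n + 1)))) (n + 1)
    have h3 : ‖F (single γ 1) - F 0‖ < c := by
      have e1 : single γ (((n + 1 : ℕ) : ℝ) / (n + 1)) = single γ 1 := by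
        push_cast; rw [div_self hn0.ne']
      have e2 : single γ (((0 : ℕ) : ℝ) / (n + 1)) = 0 := by simp [single]
      rw [e1, e2] at h2
      rw [← h2]
      refine (norm_sum_le _ _).trans_lt ((Finset.sum_lt_sum_of_nonempty ⟨0, by simp⟩
        fun k hk => h1 k (Finset.mem_range.1 hk)).trans_le ?_)
      rw [Finset.sum_const, Finset.card_range, nsmul_eq_mul]
      push_cast
      rw [mul_div_cancel₀ _ hn0.ne']
    exact absurd h3 (not_lt.2 (hc γ))
  choose k hk using hstep
  obtain ⟨a, ha⟩ := Cardinal.infinite_pigeonhole (fun γ => ULift.up.{u} (k γ)) hΓ.aleph0_le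
    (by
      rw [hΓ.cof_ord]
      exact (Cardinal.lt_aleph0_of_finite _).trans_le hΓ.aleph0_le)
  refine ⟨((a.down : ℕ) : ℝ) / (n + 1), by positivity,
    (div_lt_one hn0).2 (by exact_mod_cast a.down.2), _, ha, fun γ hγ => ?_⟩
  have : k γ = a.down := congrArg ULift.down hγ
  rw [← this]
  exact hk γ

open EllInfty in
/-- **Main theorem (Hájek–Pernecká), assuming GCH.** Let `Γ` be an infinite regular
cardinal and `F ∈ C^{1,+}(B_{ℓ∞(Γ)}; X)` with `inf_γ ‖F(e_γ) - F(0)‖ > 0`. Then there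
are a point `x` in the open unit ball and `Γ' ⊆ Γ` of full cardinality such that
`dF(x)` is bounded below on the subspace of functions supported in `Γ'`; in particular
`X` contains an isomorphic copy of `ℓ∞(Γ)`. -/
theorem derivative_isomorphic_on_ell_infty_subspace
    (hGCH : ∀ κ : Cardinal.{u}, Cardinal.aleph0 ≤ κ →
      ¬∃ μ : Cardinal.{u}, κ < μ ∧ μ < 2 ^ κ)
    {X : Type v} [NormedAddCommGroup X] [NormedSpace ℝ X] [CompleteSpace X]
    {Γ : Type u} [DecidableEq Γ] (hΓ : (Cardinal.mk Γ).IsRegular)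
    (F : lp (fun _ : Γ => ℝ) ⊤ → X)
    (F' : lp (fun _ : Γ => ℝ) ⊤ → (lp (fun _ : Γ => ℝ) ⊤ →L[ℝ] X))
    (hFcont : ContinuousOn F (closedBall 0 1))
    (hFderiv : ∀ x ∈ ball (0 : lp (fun _ : Γ => ℝ) ⊤) 1, HasFDerivAt F (F' x) x)
    (hF'unif : UniformContinuousOn F' (ball 0 1))
    (hinf : 0 < ⨅ γ : Γ, ‖F (lp.single ⊤ γ 1) - F 0‖) :
    ∃ x ∈ ball (0 : lp (fun _ : Γ => ℝ) ⊤) 1, ∃ Γ' : Set Γ,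
      Cardinal.mk Γ' = Cardinal.mk Γ ∧
      (∃ l : ℝ, 0 < l ∧ ∀ z : lp (fun _ : Γ => ℝ) ⊤,
        (∀ γ ∉ Γ', z γ = 0) → l * ‖z‖ ≤ ‖F' x z‖) ∧
      ∃ Y : Subspace ℝ X, Nonempty (lp (fun _ : Γ => ℝ) ⊤ ≃L[ℝ] Y) := by
  have : Infinite Γ := Cardinal.infinite_iff.2 hΓ.aleph0_le
  set c : ℝ := ⨅ γ : Γ, ‖F (lp.single ⊤ γ 1) - F 0‖ with hc
  have hcle : ∀ γ, c ≤ ‖F (single γ 1) - F 0‖ := fun γ =>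
    ciInf_le ⟨0, by rintro _ ⟨γ, rfl⟩; exact norm_nonneg _⟩ γ
  obtain ⟨δ, hδ0, hδF⟩ := Metric.uniformContinuousOn_iff.1 hF'unif (c / 8) (by positivity)
  have hδ : ∀ x ∈ ball (0 : EllInfty Γ) 1, ∀ y ∈ ball (0 : EllInfty Γ) 1, dist x y < δ →
      ‖F' x - F' y‖ ≤ c / 8 := fun x hx y hy h => by
    simpa [dist_eq_norm] using (hδF x hx y hy h).le
  obtain ⟨s, hs0, hs1, A, hA, hAc⟩ := exists_common_height hΓ hFcont hFderiv hδ0 hδ hcle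
  obtain ⟨σ, hσ0, hσ⟩ : ∃ σ : ℝ, 0 < σ ∧ σ < min δ (1 - s) :=
    exists_between (lt_min hδ0 (by linarith))
  have hσδ : σ < δ := hσ.trans_le (min_le_left _ _)
  have hσs : s + σ < 1 := by linarith [hσ.trans_le (min_le_right _ _)]
  have hsσ : |s + σ| ≤ s + σ := (abs_of_nonneg (by positivity)).le
  have hss : |s| ≤ s + σ := by rw [abs_of_nonneg hs0]; linarith
  choose φ hφ hφF using fun γ => exists_dual_vector'' ℝ (F' (single γ s) (single γ 1))
  -- the first-order expansion of an increment in the direction `e_γ`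
  have taylor : ∀ γ, ∀ z : EllInfty Γ, z γ = 0 → ‖z‖ ≤ s →
      |φ γ (F (z + single γ (s + σ)) - F (z + single γ s)) -
        σ * φ γ (F' (z + single γ s) (single γ 1))| ≤ c / 8 * σ := by
    intro γ z hzγ hz
    have e : z + single γ (s + σ) = z + single γ s + σ • single γ 1 := by
      rw [single, single, single, ← lp.single_smul, add_assoc, ← lp.single_add, smul_eq_mul,
        mul_one]
    have hn : ‖σ • single γ 1‖ = σ := by
      rw [norm_smul, lp.norm_single (by simp), norm_one, mul_one, Real.norm_of_nonneg hσ0.le]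
    have h1 := norm_sub_sub_le_of_closedBall hFcont hFderiv hδ (x := z + single γ s)
      (h := σ • single γ 1)
      (mem_ball_zero_iff.2 ((norm_add_single_le hzγ (hz.trans (by linarith)) hss).trans_lt hσs))
      (by
        rw [← e, mem_closedBall_zero_iff]
        exact (norm_add_single_le hzγ (hz.trans (by linarith)) hsσ).trans hσs.le)
      (by rwa [hn])
    rw [hn, ← e] at h1
    have h2 := ((φ γ).le_opNorm _).trans ((mul_le_of_le_one_left (norm_nonneg _) (hφ γ)).trans h1)
    rwa [map_sub, map_smul, map_smul, smul_eq_mul] at h2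
  obtain ⟨N, hN⟩ := exists_card_forall_exists_increment_lt hFcont hFderiv hF'unif hσs hs0
    (by linarith) hsσ hss (show 0 < σ * c / 4 by positivity)
  obtain ⟨A', hA'A, hA'card, hA'⟩ := exists_subset_forall_not_bad
    (fun γ B => σ * c / 4 ≤ φ γ (F (single γ (s + σ)) - F (single γ s)) -
      φ γ (F (s • ind B + single γ (s + σ)) - F (s • ind B + single γ s))) N A hA (by
      intro γ _ B hB hBsub hbad
      obtain ⟨i, hi⟩ := hN γ (φ γ) (hφ γ) B hB fun i hγ => (hBsub i hγ).2 rfl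
      exact absurd (hbad i) (not_le.2 hi))
  set x : EllInfty Γ := s • ind A' with hx
  have hxball : x ∈ ball (0 : EllInfty Γ) 1 := by
    rw [mem_ball_zero_iff, hx, norm_smul, Real.norm_of_nonneg hs0]
    exact (mul_le_of_le_one_right hs0 (norm_ind_le _)).trans_lt hs1
  have hxlow : ∀ γ ∈ A', 3 * c / 8 ≤ ‖F' x (single γ 1)‖ := by
    intro γ hγ
    have hγn : γ ∉ A' \ {γ} := fun h => h.2 rfl
    have h1 := not_le.1 (hA' γ hγ)
    have h2 := taylor γ 0 rfl (by simpa using hs0)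
    have h3 := taylor γ (s • ind (A' \ {γ})) (by simp [ind_apply_of_notMem hγn]) (by
      rw [norm_smul, Real.norm_of_nonneg hs0]
      exact mul_le_of_le_one_right hs0 (norm_ind_le _))
    have e : s • ind (A' \ {γ}) + single γ s = x := by
      ext β
      rcases eq_or_ne β γ with rfl | hne
      · simp [add_apply, smul_apply, hx, ind_apply_of_notMem hγn, ind_apply_of_mem hγ]
      · by_cases hβ : β ∈ A'
        · simp [add_apply, smul_apply, hx, hne, ind_apply_of_mem hβ, ind_apply_of_mem (show β ∈ A' \ {γ} from ⟨hβ, hne⟩)]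
        · simp [add_apply, smul_apply, hx, hne, ind_apply_of_notMem hβ,
            ind_apply_of_notMem (show β ∉ A' \ {γ} from fun h => hβ h.1)]
    rw [e] at h3 h1
    rw [zero_add, zero_add] at h2
    have h4 : φ γ (F' (single γ s) (single γ 1)) = ‖F' (single γ s) (single γ 1)‖ := hφF γ
    have h5 := hAc γ (hA'A hγ)
    have h6 : φ γ (F' x (single γ 1)) ≤ ‖F' x (single γ 1)‖ := (le_abs_self _).trans
      (((φ γ).le_opNorm _).trans (mul_le_of_le_one_left (norm_nonneg _) (hφ γ)))
    rw [h4] at h2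
    have h7 := (abs_le.1 h2).1
    have h8 := (abs_le.1 h3).2
    have h9 : σ * (c - c / 8) ≤ σ * ‖F' (single γ s) (single γ 1)‖ :=
      mul_le_mul_of_nonneg_left h5 hσ0.le
    have h10 : σ * (3 * c / 8) ≤ σ * φ γ (F' x (single γ 1)) := by nlinarith
    exact (le_of_mul_le_mul_left h10 hσ0).trans h6
  obtain ⟨Γ', -, hΓ'card, hΓ'⟩ := exists_subset_bounded_below (F' x) hA'card
    (show 0 < 3 * c / 8 by positivity) hxlow
  exact ⟨x, hxball, Γ', hΓ'card, ⟨3 * c / 8 / 4, by positivity, hΓ'⟩,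
    exists_subspace_equiv_of_bounded_below (F' x) hΓ'card (by positivity) hΓ'⟩
end

section
/- (In ZFC, without GCH.) Let X be a Banach space and let F ∈ C^{1,+}(B_{ℓ∞}; X) be L-Lipschitz with derivative dF having modulus of continuity ω, and suppose inf_{n∈ℕ} ‖F(e_n) − F(0)‖ ≥ ε > 0. Then there exist a point x in the open unit ball of ℓ∞ and an infinite subset M ⊆ ℕ such that dF(x) restricted to ℓ∞(M) satisfies l‖z‖ ≤ ‖dF(x)[z]‖ ≤ L‖z‖ for all z ∈ ℓ∞(M), where l = l(ω, ε, L) > 0 is a constant depending only on ω, ε and L (and not on F or X). -/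
open Metric

universe u

theorem exists_infinite_subset_forall_not_diff_singleton (bad : ℕ → Set ℕ → Prop) (N : ℕ)
    (S : Set ℕ) (hS : S.Infinite)
    (h : ∀ n ∈ S, ∀ A : Fin N → Set ℕ, (∀ i, A i ⊆ S \ {n}) →
      Pairwise (fun i j => Disjoint (A i) (A j)) → ∃ i, ¬ bad n (A i)) :
    ∃ M ⊆ S, M.Infinite ∧ ∀ n ∈ M, ¬ bad n (M \ {n}) := by
  induction N generalizing S with
  | zero =>
    obtain ⟨n, hn⟩ := hS.nonempty
    obtain ⟨i, -⟩ := h n hn (fun _ => ∅) (fun i => i.elim0) (fun i => i.elim0)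
    exact i.elim0
  | succ N ih =>
    let e := hS.natEmbedding
    let P : ℕ → Set ℕ := fun p => Set.range fun q => (e (Nat.pair p q) : ℕ)
    have hPinj : ∀ p, Function.Injective fun q => (e (Nat.pair p q) : ℕ) := fun p q q' hq => by
      have := e.injective (Subtype.ext hq)
      exact (Nat.pair_eq_pair.1 this).2
    have hPS : ∀ p, P p ⊆ S := by
      rintro p _ ⟨q, rfl⟩
      exact (e _).2
    have hPP : ∀ p p' x, x ∈ P p → x ∈ P p' → p = p' := by
      rintro p p' x ⟨q, rfl⟩ ⟨q', hq⟩
      have := e.injective (Subtype.ext hq)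
      exact (Nat.pair_eq_pair.1 this).1.symm
    by_cases hp : ∃ p, ∀ n ∈ P p, ¬ bad n (P p \ {n})
    · obtain ⟨p, hp⟩ := hp
      exact ⟨P p, hPS p, Set.infinite_range_of_injective (hPinj p), hp⟩
    · push Not at hp
      choose k hk hbad using hp
      have hkinj : Function.Injective k := fun p p' hpp =>
        hPP p p' (k p) (hk p) (hpp ▸ hk p')
      have hKS : Set.range k ⊆ S := by
        rintro _ ⟨p, rfl⟩
        exact hPS p (hk p)
      obtain ⟨M, hMK, hM⟩ := ih (Set.range k) (Set.infinite_range_of_injective hkinj) (by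
        rintro _ ⟨p, rfl⟩ A hA hdisj
        have hd : ∀ i, Disjoint (P p \ {k p}) (A i) := by
          intro i
          rw [Set.disjoint_left]
          rintro x ⟨hx, -⟩ hxA
          obtain ⟨⟨p', rfl⟩, hne⟩ := hA i hxA
          exact hne (by rw [hPP p p' _ hx (hk p')]; rfl)
        obtain ⟨i, hi⟩ := h (k p) (hPS p (hk p)) (Fin.cons (P p \ {k p}) A) (by
            intro i
            refine Fin.cases ?_ (fun i => ?_) i
            · exact Set.sdiff_subset_sdiff_left (hPS p)
            · exact (hA i).trans (Set.sdiff_subset_sdiff_left hKS)) (by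
            intro i j
            refine Fin.cases ?_ (fun i => ?_) i <;> refine Fin.cases ?_ (fun j => ?_) j
            · simp
            · intro _
              simpa using hd j
            · intro _
              simpa using (hd i).symm
            · intro hij
              simpa using hdisj (fun hh => hij (by rw [hh])))
        revert hi
        refine Fin.cases (fun hi => ?_) (fun i hi => ⟨i, by simpa using hi⟩) i
        exact absurd (hbad p) (by simpa using hi))
      exact ⟨M, hMK.trans hKS, hM⟩

theorem sum_sum_update {ι S : Type*} [Fintype ι] [DecidableEq ι] [Fintype S]
    (H : (ι → S) → ℝ) (j : ι) :
    ∑ σ, ∑ s, H (Function.update σ j s) = Fintype.card S * ∑ σ, H σ := by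
  let E : (ι → S) × S ≃ (ι → S) × S :=
    { toFun := fun x => (Function.update x.1 j x.2, x.1 j)
      invFun := fun x => (Function.update x.1 j x.2, x.1 j)
      left_inv := fun x => by simp
      right_inv := fun x => by simp }
  rw [← Fintype.sum_prod_type' (f := fun σ s => H (Function.update σ j s)),
    Fintype.sum_equiv E (fun x => H (Function.update x.1 j x.2)) (fun x => H x.1) (fun x => rfl),
    Fintype.sum_prod_type]
  simp [Finset.mul_sum]

theorem sum_sq_sum_update_sub_le {ι S : Type*} [Fintype ι] [DecidableEq ι] [Fintype S]
    (s₀ : S) (G : (ι → S) → ℝ) (C : ℝ) (hG : ∀ σ, |G σ| ≤ C) :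
    ∑ j, (∑ σ, G (Function.update σ j s₀) - ∑ σ, G σ) ^ 2
      ≤ C ^ 2 * (Fintype.card S : ℝ) * (Fintype.card (ι → S) : ℝ) ^ 2 := by
  classical
  set q : ℝ := (Fintype.card S : ℝ) with hq
  set Q : ℝ := (Fintype.card (ι → S) : ℝ) with hQ
  have hq1 : 1 ≤ q := by
    have : 0 < Fintype.card S := Fintype.card_pos_iff.2 ⟨s₀⟩
    rw [hq]
    exact_mod_cast this
  have hq0 : 0 < q := by linarith
  let u : S → ℝ := fun s => q * (if s = s₀ then 1 else 0) - 1
  have hu : ∑ s, u s = 0 := by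
    simp [u, Finset.sum_sub_distrib, ← hq]
  have hu2 : ∑ s, u s ^ 2 = q * (q - 1) := by
    have : ∀ s, u s ^ 2 = (q ^ 2 - 2 * q) * (if s = s₀ then 1 else 0) + 1 := by
      intro s
      by_cases hs : s = s₀ <;> simp [u, hs] 
      ring
    simp only [this, Finset.sum_add_distrib, ← Finset.mul_sum]
    simp [← hq]
    ring
  set c : ι → ℝ := fun j => ∑ σ, G (Function.update σ j s₀) - ∑ σ, G σ with hc
  have hcu : ∀ j, ∑ σ, G σ * u (σ j) = c j := by
    intro j
    have := sum_sum_update (fun σ => G σ * u (σ j)) j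
    have h2 := sum_sum_update G j
    simp only [Function.update_self, u, mul_sub, Finset.sum_sub_distrib, mul_one] at this
    rw [h2] at this
    simp only [mul_ite, mul_one, mul_zero, Finset.sum_ite_eq', Finset.mem_univ, if_true,
      ← Finset.sum_mul] at this
    have h3 : q * ∑ σ, G σ * u (σ j) = q * c j := by
      simp only [u, mul_sub, Finset.sum_sub_distrib, mul_one, hc, mul_ite, mul_zero]
      linarith
    exact mul_left_cancel₀ hq0.ne' h3
  have huu : ∀ i j, ∑ σ : ι → S, u (σ i) * u (σ j) = if i = j then (q - 1) * Q else 0 := by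
    intro i j
    have := sum_sum_update (fun σ : ι → S => u (σ i) * u (σ j)) i
    apply mul_left_cancel₀ hq0.ne'
    rw [← hq] at this
    rw [← this]
    split_ifs with hij
    · subst hij
      simp only [Function.update_self, ← pow_two, hu2, Finset.sum_const, Finset.card_univ,
        nsmul_eq_mul, ← hQ]
      ring
    · simp [Function.update_of_ne (Ne.symm hij), ← Finset.sum_mul, hu]
  have h1 : ∑ j, c j ^ 2 = ∑ σ, G σ * ∑ j, c j * u (σ j) := by
    simp only [Finset.mul_sum]
    rw [Finset.sum_comm]
    refine Finset.sum_congr rfl fun j _ => ?_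
    rw [pow_two]
    nth_rewrite 2 [← hcu j]
    rw [Finset.mul_sum]
    exact Finset.sum_congr rfl fun σ _ => by ring
  have h2 : ∑ σ : ι → S, (∑ j, c j * u (σ j)) ^ 2 = (q - 1) * Q * ∑ j, c j ^ 2 := by
    simp only [pow_two, Finset.sum_mul_sum]
    rw [Finset.sum_comm, Finset.mul_sum]
    refine Finset.sum_congr rfl fun i _ => ?_
    rw [Finset.sum_comm]
    have : ∀ j, ∑ σ : ι → S, c i * u (σ i) * (c j * u (σ j))
        = c i * c j * ∑ σ : ι → S, u (σ i) * u (σ j) := by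
      intro j
      rw [Finset.mul_sum]
      exact Finset.sum_congr rfl fun σ _ => by ring
    simp only [this, huu]
    simp
    ring
  have h3 : ∑ σ, G σ ^ 2 ≤ Q * C ^ 2 := by
    calc ∑ σ, G σ ^ 2 ≤ ∑ _σ : ι → S, C ^ 2 :=
          Finset.sum_le_sum fun σ _ => sq_le_sq' (abs_le.1 (hG σ)).1 (abs_le.1 (hG σ)).2
      _ = Q * C ^ 2 := by simp [hQ]
  have h4 := Finset.sum_mul_sq_le_sq_mul_sq Finset.univ G (fun σ => ∑ j, c j * u (σ j))
  rw [← h1, h2] at h4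
  set D := ∑ j, c j ^ 2 with hD
  have hD0 : 0 ≤ D := Finset.sum_nonneg fun j _ => sq_nonneg _
  have hQ0 : 0 ≤ Q := Nat.cast_nonneg _
  rcases hD0.eq_or_lt with h0 | h0
  · rw [← h0]; positivity
  · have h5 : D ^ 2 ≤ (C ^ 2 * q * Q ^ 2) * D := by
      refine h4.trans ((mul_le_mul_of_nonneg_right h3 ?_).trans ?_)
      · have : 0 ≤ q - 1 := by linarith
        positivity
      · have : 0 ≤ C ^ 2 * Q ^ 2 * D := by positivity
        nlinarith
    nlinarith

def sign (x : Bool) : ℝ := if x then 1 else -1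

theorem abs_sign (x : Bool) : |sign x| = 1 := by
  cases x <;> simp [sign]

theorem abs_sum_signs_sub_le {ι Q : Type*} [Fintype ι] [DecidableEq ι] [Fintype Q] [DecidableEq Q]
    (φ : (ι → ℝ) → ℝ) (s τ : ℝ) (hs : 0 ≤ s) (hsQ : s * (Fintype.card Q : ℝ) ≤ 1)
    (hφ : ∀ a h : ι → ℝ, (∀ i, |a i| + |h i| ≤ 1) → (∀ i, |h i| ≤ s) →
      |φ (a + h) + φ (a - h) - 2 * φ a| ≤ 2 * τ)
    (b w : ι → ℝ) (hbw : ∀ i, |b i| + |w i| ≤ 1) (R : Finset Q) :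
    |∑ σ : ι → Q → Bool, φ (fun i => b i + w i * (s * ∑ q ∈ R, sign (σ i q)))
        - (Fintype.card (ι → Q → Bool) : ℝ) * φ b|
      ≤ R.card * ((Fintype.card (ι → Q → Bool) : ℝ) * τ) := by
  induction R using Finset.induction_on with
  | empty => simp
  | insert q R hq ih =>
    set Ω : ℝ := (Fintype.card (ι → Q → Bool) : ℝ) with hΩ
    let y : (ι → Q → Bool) → ι → ℝ := fun σ i => b i + w i * (s * ∑ q ∈ R, sign (σ i q))
    let d : (ι → Q → Bool) → ι → ℝ := fun σ i => w i * (s * sign (σ i q))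
    have hins : ∀ σ : ι → Q → Bool,
        (fun i => b i + w i * (s * ∑ q ∈ insert q R, sign (σ i q))) = y σ + d σ := by
      intro σ
      funext i
      simp only [Finset.sum_insert hq, Pi.add_apply, y, d]
      ring
    let flip : (ι → Q → Bool) → ι → Q → Bool := fun σ i => Function.update (σ i) q (!(σ i q))
    have hflip : Function.Involutive flip := fun σ => by
      funext i
      simp [flip]
    have hy : ∀ σ, y (flip σ) = y σ := by
      intro σ
      funext i
      have : ∑ p ∈ R, sign (flip σ i p) = ∑ p ∈ R, sign (σ i p) :=
        Finset.sum_congr rfl fun p hp => by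
          simp [flip, Function.update_of_ne (ne_of_mem_of_not_mem hp hq)]
      simp only [y, this]
    have hd : ∀ σ, d (flip σ) = -d σ := by
      intro σ
      funext i
      have : sign (!(σ i q)) = -sign (σ i q) := by
        cases σ i q <;> simp [sign]
      simp [d, flip, this]
    have hsum : ∑ σ, φ (y σ + d σ) = ∑ σ, φ (y σ - d σ) := by
      rw [← Equiv.sum_comp hflip.toPerm]
      refine Finset.sum_congr rfl fun σ _ => ?_
      simp only [Function.Involutive.coe_toPerm, hy, hd, sub_eq_add_neg]
    have hdw : ∀ σ i, |d σ i| = |w i| * s := by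
      intro σ i
      simp [d, abs_mul, abs_sign, abs_of_nonneg hs]
    have hw1 : ∀ i, |w i| ≤ 1 := fun i => by linarith [hbw i, abs_nonneg (b i)]
    have hstep : ∀ σ, |φ (y σ + d σ) + φ (y σ - d σ) - 2 * φ (y σ)| ≤ 2 * τ := by
      intro σ
      refine hφ _ _ (fun i => ?_) (fun i => ?_)
      · have h1 : |∑ q ∈ R, sign (σ i q)| ≤ R.card :=
          (Finset.abs_sum_le_sum_abs _ _).trans (by simp [abs_sign])
        have h2 : (R.card : ℝ) + 1 ≤ Fintype.card Q := by
          have := Finset.card_le_univ (insert q R)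
          rw [Finset.card_insert_of_notMem hq] at this
          exact_mod_cast this
        have h3 : |y σ i| ≤ |b i| + |w i| * (s * R.card) := by
          refine (abs_add_le _ _).trans ?_
          rw [abs_mul, abs_mul, abs_of_nonneg hs]
          gcongr
        have h4 : s * (R.card + 1) ≤ 1 := (mul_le_mul_of_nonneg_left h2 hs).trans hsQ
        have h5 : |w i| * (s * (R.card + 1)) ≤ |w i| * 1 :=
          mul_le_mul_of_nonneg_left h4 (abs_nonneg _)
        rw [hdw]
        linarith [hbw i]
      · rw [hdw]
        exact mul_le_of_le_one_left hs (hw1 i)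
    have h1 : |∑ σ, φ (y σ + d σ) - ∑ σ, φ (y σ)| ≤ Ω * τ := by
      have h2 : 2 * (∑ σ, φ (y σ + d σ) - ∑ σ, φ (y σ))
          = ∑ σ, (φ (y σ + d σ) + φ (y σ - d σ) - 2 * φ (y σ)) := by
        rw [Finset.sum_sub_distrib, Finset.sum_add_distrib, ← hsum, ← Finset.mul_sum]
        ring
      have h3 : |2 * (∑ σ, φ (y σ + d σ) - ∑ σ, φ (y σ))| ≤ Ω * (2 * τ) := by
        rw [h2]
        refine (Finset.abs_sum_le_sum_abs _ _).trans
          ((Finset.sum_le_sum fun σ _ => hstep σ).trans ?_)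
        rw [Finset.sum_const, Finset.card_univ, nsmul_eq_mul]
      rw [abs_mul, abs_two] at h3
      linarith
    simp only [hins]
    rw [Finset.card_insert_of_notMem hq]
    push_cast
    have h6 := abs_sub_le (∑ σ, φ (y σ + d σ)) (∑ σ, φ (y σ)) (Ω * φ b)
    have h7 : |∑ σ, φ (y σ) - Ω * φ b| ≤ R.card * (Ω * τ) := ih
    linarith

/-- A bounded function on the cube with small second differences cannot have large increments
from the centre along many coordinate vectors. -/
theorem card_le_of_forall_le_abs_sub {ι : Type*} [Fintype ι] [DecidableEq ι]
    (φ : (ι → ℝ) → ℝ) (m : ℕ) (hm : 0 < m) (τ η C : ℝ) (hη : 0 < η) (hτη : 4 * (m * τ) ≤ η)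
    (hC : ∀ a : ι → ℝ, (∀ i, |a i| ≤ 1) → |φ a| ≤ C)
    (hφ : ∀ a h : ι → ℝ, (∀ i, |a i| + |h i| ≤ 1) → (∀ i, |h i| ≤ 1 / m) →
      |φ (a + h) + φ (a - h) - 2 * φ a| ≤ 2 * τ)
    (hbig : ∀ j, η ≤ |φ (Pi.single j 1) - φ 0|) :
    (Fintype.card ι : ℝ) * η ^ 2 ≤ 4 * (C ^ 2 * 2 ^ m) := by
  set Ω : ℝ := (Fintype.card (ι → Fin m → Bool) : ℝ) with hΩ
  have hΩ0 : 0 < Ω := by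
    have : 0 < Fintype.card (ι → Fin m → Bool) := Fintype.card_pos_iff.2 ⟨fun _ _ => true⟩
    rw [hΩ]
    exact_mod_cast this
  have hm0 : (0 : ℝ) < m := by exact_mod_cast hm
  let pos : (ι → Fin m → Bool) → ι → ℝ := fun σ i => 1 / m * ∑ q, sign (σ i q)
  have hpos : ∀ σ i, |pos σ i| ≤ 1 := by
    intro σ i
    have h1 : |∑ q, sign (σ i q)| ≤ m :=
      (Finset.abs_sum_le_sum_abs _ _).trans (by simp [abs_sign])
    simp only [pos]
    rw [abs_mul, abs_of_pos (by positivity), one_div, inv_mul_le_iff₀ hm0]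
    linarith
  have hmean := abs_sum_signs_sub_le (Q := Fin m) φ (1 / m) τ (by positivity)
    (by simp [hm0.ne']) hφ
  have h0 : |∑ σ, φ (pos σ) - Ω * φ 0| ≤ m * (Ω * τ) := by
    have := hmean 0 1 (by simp) Finset.univ
    simpa [pos, hΩ] using this
  have h1 : ∀ j, |∑ σ, φ (pos (Function.update σ j fun _ => true)) - Ω * φ (Pi.single j 1)|
      ≤ m * (Ω * τ) := by
    intro j
    have := hmean (Pi.single j 1) (1 - Pi.single j 1) (fun i => by
      by_cases hij : i = j
      · subst hij; simp
      · simp [hij]) Finset.univ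
    rw [Finset.card_univ, Fintype.card_fin] at this
    convert this using 5 with σ
    funext i
    by_cases hij : i = j
    · subst hij
      simp [pos, sign, hm0.ne']
    · simp [pos, hij]
  have hdiff : ∀ j, (Ω * (η / 2)) ^ 2 ≤
      (∑ σ, φ (pos (Function.update σ j fun _ => true)) - ∑ σ, φ (pos σ)) ^ 2 := by
    intro j
    rw [sq_le_sq, abs_of_pos (by positivity)]
    have h2 := abs_sub_le (Ω * φ (Pi.single j 1))
      (∑ σ, φ (pos (Function.update σ j fun _ => true))) (Ω * φ 0)
    have h3 := abs_sub_le (∑ σ, φ (pos (Function.update σ j fun _ => true)))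
      (∑ σ, φ (pos σ)) (Ω * φ 0)
    have h4 : Ω * η ≤ |Ω * φ (Pi.single j 1) - Ω * φ 0| := by
      rw [← mul_sub, abs_mul, abs_of_pos hΩ0]
      exact mul_le_mul_of_nonneg_left (hbig j) hΩ0.le
    have h5 := h1 j
    rw [abs_sub_comm] at h5
    have h6 : Ω * (4 * (m * τ)) ≤ Ω * η := mul_le_mul_of_nonneg_left hτη hΩ0.le
    linarith
  have hbessel := sum_sq_sum_update_sub_le (ι := ι) (fun _ : Fin m => true) (fun σ => φ (pos σ)) C
    (fun σ => hC _ (hpos σ))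
  have hsum := (Finset.sum_le_sum fun j (_ : j ∈ Finset.univ) => hdiff j).trans hbessel
  rw [Finset.sum_const, Finset.card_univ, nsmul_eq_mul, ← hΩ] at hsum
  have h7 : (Fintype.card (Fin m → Bool) : ℝ) = 2 ^ m := by simp
  rw [h7] at hsum
  have h8 : Ω ^ 2 * ((Fintype.card ι : ℝ) * η ^ 2) ≤ Ω ^ 2 * (4 * (C ^ 2 * 2 ^ m)) := by
    linarith
  exact le_of_mul_le_mul_left h8 (by positivity)

theorem norm_image_sub_sub_le_of_modulus {E G : Type*} [NormedAddCommGroup E] [NormedSpace ℝ E]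
    [NormedAddCommGroup G] [NormedSpace ℝ G] {ω : ℝ → ℝ} (hω : MonotoneOn ω (Set.Ici 0))
    {f : E → G} {f' : E → E →L[ℝ] G} (hf : ∀ x ∈ ball (0 : E) 1, HasFDerivAt f (f' x) x)
    (hf' : ∀ x ∈ ball (0 : E) 1, ∀ y ∈ ball (0 : E) 1, ‖f' x - f' y‖ ≤ ω ‖x - y‖)
    {x y : E} (hx : x ∈ ball (0 : E) 1) (hy : y ∈ ball (0 : E) 1) :
    ‖f y - f x - f' x (y - x)‖ ≤ ω ‖y - x‖ * ‖y - x‖ := by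
  refine Convex.norm_image_sub_le_of_norm_hasFDerivWithin_le' (𝕜 := ℝ)
    (s := ball (0 : E) 1 ∩ closedBall x ‖y - x‖) (f' := f')
    (fun z hz => (hf z hz.1).hasFDerivWithinAt) (fun z hz => ?_)
    ((convex_ball _ _).inter (convex_closedBall _ _)) ⟨hx, by simp⟩ ⟨hy, by simp [dist_eq_norm]⟩
  refine (hf' z hz.1 x hx).trans (hω (norm_nonneg _) (norm_nonneg _) ?_)
  simpa [dist_eq_norm] using hz.2

theorem abs_second_difference_le_of_modulus {E : Type*} [NormedAddCommGroup E] [NormedSpace ℝ E]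
    {ω : ℝ → ℝ} (hω : MonotoneOn ω (Set.Ici 0))
    {f : E → ℝ} {f' : E → E →L[ℝ] ℝ} (hf : ∀ x ∈ ball (0 : E) 1, HasFDerivAt f (f' x) x)
    (hf' : ∀ x ∈ ball (0 : E) 1, ∀ y ∈ ball (0 : E) 1, ‖f' x - f' y‖ ≤ ω ‖x - y‖)
    {z h : E} (hz : z ∈ ball (0 : E) 1) (hp : z + h ∈ ball (0 : E) 1)
    (hm : z - h ∈ ball (0 : E) 1) :
    |f (z + h) + f (z - h) - 2 * f z| ≤ 2 * (ω ‖h‖ * ‖h‖) := by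
  have h1 := norm_image_sub_sub_le_of_modulus hω hf hf' hz hp
  have h2 := norm_image_sub_sub_le_of_modulus hω hf hf' hz hm
  rw [add_sub_cancel_left, Real.norm_eq_abs, abs_le] at h1
  rw [show z - h - z = -h by abel, norm_neg, map_neg, Real.norm_eq_abs, abs_le] at h2
  rw [abs_le]
  constructor <;> linarith [h1.1, h1.2, h2.1, h2.2]

abbrev Linf : Type := lp (fun _ : ℕ => ℝ) ⊤

theorem Linf.abs_apply_le (z : Linf) (n : ℕ) : |z n| ≤ ‖z‖ :=
  lp.norm_apply_le_norm ENNReal.top_ne_zero z n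

theorem Linf.norm_le (z : Linf) {C : ℝ} (hC : 0 ≤ C) (h : ∀ n, |z n| ≤ C) : ‖z‖ ≤ C :=
  lp.norm_le_of_forall_le hC h

theorem Linf.sum_apply {ι : Type*} (s : Finset ι) (v : ι → Linf) (n : ℕ) :
    (∑ i ∈ s, v i) n = ∑ i ∈ s, v i n := by
  rw [lp.coeFn_sum, Finset.sum_apply]

theorem exists_linf_eq (t : ℕ → ℝ) (C : ℝ) (ht : ∀ n, |t n| ≤ C) :
    ∃ x : Linf, ∀ n, x n = t n :=
  ⟨⟨t, memℓp_infty ⟨C, by rintro _ ⟨n, rfl⟩; exact ht n⟩⟩, fun _ => rfl⟩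

theorem abs_sum_mul_le_of_disjoint {ι : Type*} [Fintype ι] {A : ι → Set ℕ}
    (hA : Pairwise fun i j => Disjoint (A i) (A j)) (a v : ι → ℝ) (n : ℕ)
    (hv : ∀ i, n ∉ A i → v i = 0) {c r : ℝ} (hc : ∀ i, |a i| ≤ c) (hr : ∀ i, |v i| ≤ r)
    (hcr : 0 ≤ c * r) : |∑ i, a i * v i| ≤ c * r := by
  by_cases h : ∃ i, n ∈ A i
  · obtain ⟨i, hi⟩ := h
    rw [Finset.sum_eq_single i]
    · rw [abs_mul]
      exact mul_le_mul (hc i) (hr i) (abs_nonneg _) ((abs_nonneg _).trans (hc i))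
    · intro j _ hj
      rw [hv j fun hn => Set.disjoint_left.1 (hA hj) hn hi, mul_zero]
    · simp
  · push Not at h
    rw [Finset.sum_eq_zero fun i _ => by rw [hv i (h i), mul_zero], abs_zero]
    exact hcr

/-- Rosenthal's theorem: an operator on `ℓ∞` that is bounded below along infinitely many unit
vectors is an isomorphism on some `ℓ∞(M)`. -/
theorem exists_infinite_isomorphic_of_le_norm_single {X : Type*} [NormedAddCommGroup X]
    [NormedSpace ℝ X] (T : Linf →L[ℝ] X) {δ : ℝ} (hδ : 0 < δ) (S : Set ℕ) (hS : S.Infinite)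
    (hT : ∀ n ∈ S, δ ≤ ‖T (lp.single ⊤ n 1)‖) :
    ∃ M ⊆ S, M.Infinite ∧ ∀ z : Linf, (∀ n ∉ M, z n = 0) → δ / 2 * ‖z‖ ≤ ‖T z‖ := by
  choose g hg1 hg using fun n : ℕ => exists_dual_vector'' ℝ (T (lp.single ⊤ n (1 : ℝ)))
  have hgT : ∀ n z, |g n (T z)| ≤ ‖T z‖ := fun n z => by
    simpa using (g n).le_of_opNorm_le (hg1 n) (T z)
  obtain ⟨N, hN⟩ := exists_nat_gt (‖T‖ / (δ / 2))
  rw [div_lt_iff₀ (by positivity)] at hN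
  obtain ⟨M, hMS, hM, hbad⟩ := exists_infinite_subset_forall_not_diff_singleton
    (fun n A => ∃ z : Linf, ‖z‖ ≤ 1 ∧ (∀ k ∉ A, z k = 0) ∧ δ / 2 ≤ |g n (T z)|) N S hS (by
      intro n _ A _ hdisj
      by_contra! hcon
      choose z hz1 hzA hz using hcon
      let a : Fin N → ℝ := fun i => SignType.sign (g n (T (z i)))
      have ha : ∀ i, |a i| ≤ 1 := fun i => by
        simp only [a]
        rcases lt_trichotomy (g n (T (z i))) 0 with h | h | h <;> simp [h]
      have hnorm : ‖∑ i, a i • z i‖ ≤ 1 := by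
        refine Linf.norm_le _ zero_le_one fun k => ?_
        rw [Linf.sum_apply]
        simpa using abs_sum_mul_le_of_disjoint hdisj a (fun i => z i k) k
          (fun i hi => hzA i k hi) ha (fun i => (Linf.abs_apply_le _ k).trans (hz1 i)) (by simp)
      have h1 : g n (T (∑ i, a i • z i)) = ∑ i, |g n (T (z i))| := by
        simp [map_sum, a, sign_mul_self]
      have h2 : N * (δ / 2) ≤ ∑ i, |g n (T (z i))| := by
        simpa using Finset.sum_le_sum fun i (_ : i ∈ Finset.univ) => hz i
      have h3 := (le_abs_self _).trans (hgT n (∑ i, a i • z i))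
      have h4 := T.le_opNorm (∑ i, a i • z i)
      have h5 : ‖T‖ * ‖∑ i, a i • z i‖ ≤ ‖T‖ := mul_le_of_le_one_right (norm_nonneg _) hnorm
      linarith)
  refine ⟨M, hMS, hM, fun z hz => ?_⟩
  have hmain : ∀ n, δ * |z n| ≤ ‖T z‖ + δ / 2 * ‖z‖ := by
    intro n
    by_cases hn : n ∈ M
    swap
    · rw [hz n hn, abs_zero, mul_zero]
      positivity
    rcases (norm_nonneg z).eq_or_lt with h0 | h0
    · have := Linf.abs_apply_le z n
      rw [← h0] at this ⊢
      rw [le_antisymm this (abs_nonneg _), mul_zero, mul_zero, add_zero]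
      exact norm_nonneg _
    set y : Linf := z - lp.single ⊤ n (z n) with hy
    have hyk : ∀ k, y k = if k = n then 0 else z k := by
      intro k
      by_cases hk : k = n
      · subst hk; simp [hy]
      · simp [hy, hk]
    have hynorm : ‖y‖ ≤ ‖z‖ := Linf.norm_le _ (norm_nonneg _) fun k => by
      rw [hyk]
      split_ifs
      · simp
      · exact Linf.abs_apply_le z k
    have h1 : |g n (T y)| ≤ δ / 2 * ‖z‖ := by
      by_contra! hcon
      refine hbad n hn ⟨‖z‖⁻¹ • y, ?_, fun k hk => ?_, ?_⟩
      · rw [norm_smul, norm_inv, norm_norm, inv_mul_le_iff₀ h0, mul_one]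
        exact hynorm
      · have : y k = 0 := by
          rw [hyk]
          split_ifs with hkn
          · rfl
          · exact hz k fun hkM => hk ⟨hkM, hkn⟩
        simp [this]
      · rw [map_smul, map_smul, smul_eq_mul, abs_mul, abs_inv, abs_norm, inv_mul_eq_div,
          le_div_iff₀ h0]
        exact hcon.le
    have h2 : g n (T z) = z n * ‖T (lp.single ⊤ n (1 : ℝ))‖ + g n (T y) := by
      have h3 : z = z n • lp.single ⊤ n (1 : ℝ) + y := by
        rw [hy, ← lp.single_smul]
        simp
      have h4 := hg n
      simp only [RCLike.ofReal_real_eq_id, id] at h4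
      conv_lhs => rw [h3]
      rw [map_add, map_smul, map_add, map_smul, smul_eq_mul, h4]
    have h5 : |z n| * δ ≤ |z n * ‖T (lp.single ⊤ n (1 : ℝ))‖| := by
      rw [abs_mul, abs_norm]
      exact mul_le_mul_of_nonneg_left (hT n (hMS hn)) (abs_nonneg _)
    have h6 : |z n * ‖T (lp.single ⊤ n (1 : ℝ))‖| ≤ |g n (T z)| + |g n (T y)| := by
      rw [show z n * ‖T (lp.single ⊤ n (1 : ℝ))‖ = g n (T z) - g n (T y) by rw [h2]; ring]
      exact abs_sub _ _
    linarith [hgT n z]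
  have h7 : ‖z‖ ≤ (‖T z‖ + δ / 2 * ‖z‖) / δ :=
    Linf.norm_le _ (by positivity) fun n => by
      rw [le_div_iff₀ hδ]
      linarith [hmain n]
  rw [le_div_iff₀ hδ] at h7
  linarith

/-- A smooth Lipschitz function on `ℓ∞` has a mixed increment that is large along only boundedly
many disjointly supported directions. -/
theorem card_mul_sq_le_of_disjoint_increments {ω : ℝ → ℝ} (hω : MonotoneOn ω (Set.Ici 0))
    (hω0 : ∀ r, 0 ≤ r → 0 ≤ ω r) {L : ℝ} {f : Linf → ℝ} {f' : Linf → Linf →L[ℝ] ℝ}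
    (hL : ∀ x ∈ ball (0 : Linf) 1, ∀ y ∈ ball (0 : Linf) 1, |f x - f y| ≤ L * ‖x - y‖)
    (hf : ∀ x ∈ ball (0 : Linf) 1, HasFDerivAt f (f' x) x)
    (hf' : ∀ x ∈ ball (0 : Linf) 1, ∀ y ∈ ball (0 : Linf) 1, ‖f' x - f' y‖ ≤ ω ‖x - y‖)
    {ρ s : ℝ} (hρ : ρ < 1) (hs : 0 < s) (hsρ : s < ρ) {t : ℕ → ℝ} (ht : ∀ k, |t k| ≤ 1 - ρ)
    (n : ℕ) {N : ℕ} {A : Fin N → Set ℕ} (hA : Pairwise fun i j => Disjoint (A i) (A j))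
    (hn : ∀ i, n ∉ A i) (v : Fin N → Linf) (hv : ∀ i k, v i k = (A i).indicator t k)
    {m : ℕ} (hm : 0 < m) {η : ℝ} (hη : 0 < η) (hmη : 8 * ω (1 / m) ≤ η)
    (hbig : ∀ i, η ≤ |f (lp.single ⊤ n (t n + s) + v i) - f (lp.single ⊤ n (t n) + v i)
      - (f (lp.single ⊤ n (t n + s)) - f (lp.single ⊤ n (t n)))|) :
    N * η ^ 2 ≤ 4 * ((L * s) ^ 2 * 2 ^ m) := by
  let Y : (Fin N → ℝ) → Linf := fun a => ∑ i, a i • v i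
  have hYadd : ∀ a b, Y (a + b) = Y a + Y b := fun a b => by
    simp [Y, add_smul, Finset.sum_add_distrib]
  have hYsub : ∀ a b, Y (a - b) = Y a - Y b := fun a b => by
    simp [Y, sub_smul, Finset.sum_sub_distrib]
  have hYk : ∀ a k, Y a k = ∑ i, a i * v i k := fun a k => by
    simp only [Y]
    rw [Linf.sum_apply]
    rfl
  have hYn : ∀ a, Y a n = 0 := fun a => by
    rw [hYk]
    exact Finset.sum_eq_zero fun i _ => by rw [hv, Set.indicator_of_notMem (hn i), mul_zero]
  have hYle : ∀ a c, 0 ≤ c → (∀ i, |a i| ≤ c) → ∀ k, |Y a k| ≤ c * (1 - ρ) := by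
    intro a c hc ha k
    rw [hYk]
    refine abs_sum_mul_le_of_disjoint hA a _ k (fun i hi => ?_) ha (fun i => ?_)
      (mul_nonneg hc (by linarith))
    · rw [hv, Set.indicator_of_notMem hi]
    · rw [hv]
      by_cases hi : k ∈ A i
      · rw [Set.indicator_of_mem hi]
        exact ht k
      · rw [Set.indicator_of_notMem hi, abs_zero]
        linarith
  have hball : ∀ a r, 0 ≤ r → r ≤ s → (∀ i, |a i| ≤ 1) →
      lp.single ⊤ n (t n + r) + Y a ∈ ball (0 : Linf) 1 := by
    intro a r hr hrs ha
    rw [mem_ball_zero_iff]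
    refine (Linf.norm_le _ (C := 1 - ρ + s) (by linarith) fun k => ?_).trans_lt (by linarith)
    by_cases hk : k = n
    · subst hk
      have h1 : (lp.single ⊤ k (t k + r) + Y a : Linf) k = t k + r := by
        rw [lp.coeFn_add, Pi.add_apply, hYn, lp.single_apply_self, add_zero]
      rw [h1]
      refine (abs_add_le _ _).trans ?_
      rw [abs_of_nonneg hr]
      linarith [ht k]
    · have h1 : (lp.single ⊤ n (t n + r) + Y a : Linf) k = Y a k := by
        rw [lp.coeFn_add, Pi.add_apply, lp.single_apply, Pi.single_eq_of_ne hk, zero_add]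
      rw [h1]
      linarith [hYle a 1 zero_le_one ha k]
  let φ : (Fin N → ℝ) → ℝ := fun a =>
    f (lp.single ⊤ n (t n + s) + Y a) - f (lp.single ⊤ n (t n + 0) + Y a)
  have hm0 : (0 : ℝ) < m := by exact_mod_cast hm
  have hsecond : ∀ a h : Fin N → ℝ, (∀ i, |a i| + |h i| ≤ 1) → (∀ i, |h i| ≤ 1 / m) →
      ∀ r, 0 ≤ r → r ≤ s →
      |f (lp.single ⊤ n (t n + r) + Y (a + h)) + f (lp.single ⊤ n (t n + r) + Y (a - h))
        - 2 * f (lp.single ⊤ n (t n + r) + Y a)| ≤ 2 * (ω (1 / m) * (1 / m)) := by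
    intro a h hah hh r hr hrs
    have hYh : ‖Y h‖ ≤ 1 / m := by
      refine Linf.norm_le _ (by positivity) fun k => (hYle h _ (by positivity) hh k).trans ?_
      exact mul_le_of_le_one_right (by positivity) (by linarith)
    have hp := hball (a + h) r hr hrs fun i => (abs_add_le _ _).trans (hah i)
    have hq := hball (a - h) r hr hrs fun i => (abs_sub _ _).trans (hah i)
    have hz := hball a r hr hrs fun i => by linarith [hah i, abs_nonneg (h i)]
    rw [hYadd, ← add_assoc] at hp ⊢
    rw [hYsub, ← add_sub_assoc] at hq ⊢
    refine (abs_second_difference_le_of_modulus hω hf hf' hz hp hq).trans ?_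
    have h1 : ω ‖Y h‖ ≤ ω (1 / m) :=
      hω (norm_nonneg _) (show (0 : ℝ) ≤ 1 / m by positivity) hYh
    have h2 := mul_le_mul h1 hYh (norm_nonneg _) (hω0 _ (by positivity))
    linarith
  have hcard := card_le_of_forall_le_abs_sub φ m hm (2 * (ω (1 / m) * (1 / m))) η (L * s) hη
    (by
      have : (m : ℝ) * (2 * (ω (1 / m) * (1 / m))) = 2 * ω (1 / m) := by
        field_simp
      rw [this]
      linarith)
    (fun a ha => by
      refine (hL _ (hball a s hs.le le_rfl ha) _ (hball a 0 le_rfl hs.le ha)).trans_eq ?_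
      rw [add_sub_add_right_eq_sub, ← lp.single_sub, lp.norm_single (by simp)]
      simp [abs_of_pos hs])
    (fun a h hah hh => by
      have h1 := abs_le.1 (hsecond a h hah hh s hs.le le_rfl)
      have h2 := abs_le.1 (hsecond a h hah hh 0 le_rfl hs.le)
      simp only [φ]
      rw [abs_le]
      constructor <;> linarith [h1.1, h1.2, h2.1, h2.2])
    (fun j => by
      have h1 : Y (Pi.single j 1) = v j := by
        simp [Y]
      have h2 : Y 0 = 0 := by simp [Y]
      simp only [φ, h1, h2, add_zero]
      exact hbig j)
  simpa using hcard

theorem IsModulus.exists_pos_forall_lt {ω : ℝ → ℝ} (hω : IsModulus ω) {κ : ℝ} (hκ : 0 < κ) :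
    ∃ r > 0, ∀ t, 0 ≤ t → t < r → ω t < κ := by
  obtain ⟨hnn, -, h0, hc⟩ := hω
  obtain ⟨r, hr, h⟩ := Metric.continuousWithinAt_iff.1 hc κ hκ
  refine ⟨r, hr, fun t ht htr => ?_⟩
  have := h (x := t) ht (by rwa [Real.dist_eq, sub_zero, abs_of_nonneg ht])
  rw [h0, Real.dist_eq, sub_zero] at this
  exact (le_abs_self _).trans_lt this

theorem lp_single_mem_ball (n : ℕ) {t : ℝ} (h0 : 0 ≤ t) (h1 : t < 1) :
    (lp.single ⊤ n t : Linf) ∈ ball (0 : Linf) 1 := by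
  rw [mem_ball_zero_iff, lp.norm_single (by simp), Real.norm_eq_abs, abs_of_nonneg h0]
  exact h1

/-- A smooth Lipschitz map that moves every unit vector by at least `ε` has, at a single point,
partial derivatives bounded below along infinitely many coordinates. -/
theorem exists_infinite_le_norm_partial {ω : ℝ → ℝ} (hω : IsModulus ω) {L ε : ℝ} (hL : 0 < L)
    (hε : 0 < ε) {X : Type*} [NormedAddCommGroup X] [NormedSpace ℝ X] {F : Linf → X}
    {F' : Linf → Linf →L[ℝ] X}
    (hlip : ∀ x ∈ closedBall (0 : Linf) 1, ∀ y ∈ closedBall (0 : Linf) 1,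
      ‖F x - F y‖ ≤ L * ‖x - y‖)
    (hF : ∀ x ∈ ball (0 : Linf) 1, HasFDerivAt F (F' x) x)
    (hF' : ∀ x ∈ ball (0 : Linf) 1, ∀ y ∈ ball (0 : Linf) 1, ‖F' x - F' y‖ ≤ ω ‖x - y‖)
    (hbig : ∀ n : ℕ, ε ≤ ‖F (lp.single ⊤ n 1) - F 0‖) :
    ∃ x ∈ ball (0 : Linf) 1, ∃ M : Set ℕ, M.Infinite ∧
      ∀ n ∈ M, ε / 4 ≤ ‖F' x (lp.single ⊤ n 1)‖ := by
  have hωmono := hω.2.1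
  have hωnn := hω.1
  obtain ⟨ρ, hρ0, hρ1, hρε⟩ : ∃ ρ : ℝ, 0 < ρ ∧ ρ < 1 ∧ L * ρ ≤ ε / 2 := by
    refine ⟨min (ε / (2 * L)) (1 / 2), by positivity,
      (min_le_right _ _).trans_lt (by norm_num), ?_⟩
    refine (mul_le_mul_of_nonneg_left (min_le_left _ _) hL.le).trans_eq ?_
    field_simp
  obtain ⟨r, hr, hωr⟩ := hω.exists_pos_forall_lt (show 0 < ε / 32 by positivity)
  obtain ⟨s, hs0, hs⟩ := exists_between (lt_min hr hρ0)
  obtain ⟨hsr, hsρ⟩ := lt_min_iff.1 hs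
  have hωs : ω s ≤ ε / 32 := (hωr s hs0.le hsr).le
  choose g hg1 hg using fun n : ℕ =>
    exists_dual_vector'' ℝ (F (lp.single ⊤ n (1 - ρ)) - F 0)
  have hgX : ∀ n z, |g n z| ≤ ‖z‖ := fun n z => by
    simpa using (g n).le_of_opNorm_le (hg1 n) z
  have hglip : ∀ n, ∀ x ∈ ball (0 : Linf) 1, ∀ y ∈ ball (0 : Linf) 1,
      |g n (F x) - g n (F y)| ≤ L * ‖x - y‖ := fun n x hx y hy => by
    rw [← map_sub]
    exact (hgX n _).trans (hlip x (ball_subset_closedBall hx) y (ball_subset_closedBall hy))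
  have hgF : ∀ n, ∀ x ∈ ball (0 : Linf) 1,
      HasFDerivAt (fun x => g n (F x)) ((g n).comp (F' x)) x := fun n x hx =>
    (g n).hasFDerivAt.comp x (hF x hx)
  have hgF' : ∀ n, ∀ x ∈ ball (0 : Linf) 1, ∀ y ∈ ball (0 : Linf) 1,
      ‖(g n).comp (F' x) - (g n).comp (F' y)‖ ≤ ω ‖x - y‖ := fun n x hx y hy => by
    rw [← ContinuousLinearMap.comp_sub]
    refine ((g n).opNorm_comp_le _).trans ((mul_le_of_le_one_left (norm_nonneg _) (hg1 n)).trans ?_)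
    exact hF' x hx y hy
  have hsmul : ∀ (n : ℕ) (a : ℝ), (lp.single ⊤ n a : Linf) = a • lp.single ⊤ n (1 : ℝ) :=
    fun n a => by
      rw [← lp.single_smul]
      simp
  have hslope : ∀ n, ∃ t ∈ Set.Ioo (0 : ℝ) (1 - ρ),
      ε / 2 ≤ g n (F' (lp.single ⊤ n t) (lp.single ⊤ n 1)) := by
    intro n
    have hder : ∀ a ∈ Set.Icc (0 : ℝ) (1 - ρ), HasDerivAt (fun a => g n (F (lp.single ⊤ n a)))
        (g n (F' (lp.single ⊤ n a) (lp.single ⊤ n 1))) a := by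
      intro a ha
      have h1 := hgF n _ (lp_single_mem_ball n ha.1 (by linarith [ha.2]))
      have h2 : HasDerivAt (fun a : ℝ => (lp.single ⊤ n a : Linf)) (lp.single ⊤ n 1) a := by
        have := (hasDerivAt_id a).smul_const (lp.single ⊤ n (1 : ℝ) : Linf)
        simp only [id, one_smul] at this
        exact this.congr_of_eventuallyEq (Filter.Eventually.of_forall fun b => hsmul n b)
      exact h1.comp_hasDerivAt a h2
    obtain ⟨t, ht, hslope⟩ := exists_hasDerivAt_eq_slope _ _ (sub_pos.2 hρ1)
      (fun a ha => (hder a ha).continuousAt.continuousWithinAt)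
      (fun a ha => hder a ⟨ha.1.le, ha.2.le⟩)
    refine ⟨t, ht, ?_⟩
    rw [hslope, sub_zero, le_div_iff₀ (sub_pos.2 hρ1), ← map_sub]
    have h0 : (lp.single ⊤ n (0 : ℝ) : Linf) = 0 := by rw [hsmul, zero_smul]
    have h1 := hg n
    rw [h0]
    simp only [RCLike.ofReal_real_eq_id, id] at h1
    rw [h1]
    have h2 := hlip (lp.single ⊤ n 1) (by simp [lp.norm_single])
      (lp.single ⊤ n (1 - ρ)) (ball_subset_closedBall
        (lp_single_mem_ball n (by linarith) (by linarith)))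
    rw [← lp.single_sub, lp.norm_single (by simp), sub_sub_cancel, Real.norm_eq_abs,
      abs_of_pos hρ0] at h2
    have h3 := norm_sub_le_norm_sub_add_norm_sub (F (lp.single ⊤ n 1))
      (F (lp.single ⊤ n (1 - ρ))) (F 0)
    have h4 : ε / 2 * (1 - ρ) ≤ ε / 2 := mul_le_of_le_one_right (by positivity) (by linarith)
    linarith [hbig n]
  choose t ht hslope using hslope
  have ht' : ∀ n, |t n| ≤ 1 - ρ := fun n => by
    rw [abs_of_pos (ht n).1]
    exact (ht n).2.le
  have htA : ∀ (A : Set ℕ) n, |A.indicator t n| ≤ 1 - ρ := fun A n => by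
    by_cases hn : n ∈ A
    · rw [Set.indicator_of_mem hn]
      exact ht' n
    · rw [Set.indicator_of_notMem hn, abs_zero]
      linarith
  choose v hv using fun A : Set ℕ => exists_linf_eq (A.indicator t) (1 - ρ) (htA A)
  obtain ⟨r', hr', hωr'⟩ := hω.exists_pos_forall_lt (show 0 < s * (ε / 16) / 8 by positivity)
  obtain ⟨k, hk⟩ := exists_nat_one_div_lt hr'
  obtain ⟨N, hN⟩ := exists_nat_gt (4 * ((L * s) ^ 2 * 2 ^ (k + 1)) / (s * (ε / 16)) ^ 2)
  rw [div_lt_iff₀ (by positivity)] at hN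
  obtain ⟨M, -, hM, hbad⟩ := exists_infinite_subset_forall_not_diff_singleton
    (fun n A => s * (ε / 16) ≤
      |g n (F (lp.single ⊤ n (t n + s) + v A)) - g n (F (lp.single ⊤ n (t n) + v A))
        - (g n (F (lp.single ⊤ n (t n + s))) - g n (F (lp.single ⊤ n (t n))))|)
    N Set.univ Set.infinite_univ (by
      intro n _ A hAn hA
      by_contra! hcon
      refine absurd hN (not_lt.2 ?_)
      refine card_mul_sq_le_of_disjoint_increments hωmono hωnn (hglip n) (hgF n) (hgF' n) hρ1 hs0
        hsρ ht' n hA (fun i hi => (hAn i hi).2 rfl) (fun i => v (A i)) (fun i k => hv _ k)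
        k.succ_pos (by positivity) ?_ hcon
      have h1 := hωr' (1 / ((k : ℝ) + 1)) (by positivity) hk
      push_cast
      linarith)
  have hball : ∀ n ∈ M, lp.single ⊤ n s + v M ∈ ball (0 : Linf) 1 := by
    intro n _
    rw [mem_ball_zero_iff]
    refine (norm_add_le _ _).trans_lt ?_
    rw [lp.norm_single (by simp), Real.norm_eq_abs, abs_of_pos hs0]
    have : ‖v M‖ ≤ 1 - ρ := Linf.norm_le _ (by linarith) fun k => by
      rw [hv]
      exact htA M k
    linarith
  have hvM : v M ∈ ball (0 : Linf) 1 := by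
    rw [mem_ball_zero_iff]
    refine (Linf.norm_le _ (by linarith) fun k => ?_).trans_lt (show 1 - ρ < 1 by linarith)
    rw [hv]
    exact htA M k
  refine ⟨v M, hvM, M, hM, fun n hn => ?_⟩
  have hsplit : lp.single ⊤ n (t n) + v (M \ {n}) = v M := by
    ext k
    rw [lp.coeFn_add, Pi.add_apply, hv, hv]
    by_cases hk : k = n
    · subst hk
      simp [hn]
    · by_cases hkM : k ∈ M <;> simp [hk, hkM]
  have hsplit' : lp.single ⊤ n (t n + s) + v (M \ {n}) = lp.single ⊤ n s + v M := by
    rw [← hsplit, lp.single_add]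
    abel
  have h1 := hbad n hn
  rw [hsplit, hsplit', not_le] at h1
  have hn1 := (ht n).1
  have hn2 := (ht n).2
  have h2 := norm_image_sub_sub_le_of_modulus hωmono (hgF n) (hgF' n)
    (lp_single_mem_ball n hn1.le (by linarith))
    (lp_single_mem_ball n (show 0 ≤ t n + s by linarith) (by linarith))
  have h3 := norm_image_sub_sub_le_of_modulus hωmono (hgF n) (hgF' n) hvM (hball n hn)
  rw [← lp.single_sub, add_sub_cancel_left, lp.norm_single (by simp), hsmul n s, map_smul,
    Real.norm_eq_abs, Real.norm_eq_abs, abs_of_pos hs0, smul_eq_mul,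
    ContinuousLinearMap.comp_apply] at h2
  rw [add_sub_cancel_right, lp.norm_single (by simp), hsmul n s, map_smul,
    Real.norm_eq_abs, Real.norm_eq_abs, abs_of_pos hs0, ← hsmul n s, smul_eq_mul,
    ContinuousLinearMap.comp_apply] at h3
  have h4 : ω s * s ≤ ε / 32 * s := mul_le_mul_of_nonneg_right hωs hs0.le
  have h5 : s * (ε / 2) ≤ s * g n (F' (lp.single ⊤ n (t n)) (lp.single ⊤ n 1)) :=
    mul_le_mul_of_nonneg_left (hslope n) hs0.le
  have h6 : s * (ε / 4) ≤ s * g n (F' (v M) (lp.single ⊤ n 1)) := by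
    have h7 := (abs_lt.1 h1).1
    have h8 := (abs_le.1 h2).1
    have h9 := (abs_le.1 h3).2
    have h10 : 0 < s * ε := by positivity
    linarith
  exact (le_of_mul_le_mul_left h6 hs0).trans ((le_abs_self _).trans (hgX n _))

/-- (ZFC version, `Γ = ω₀`.) For every modulus `ω`, `L > 0` and `ε > 0` there is a
constant `l = l(ω, ε, L) > 0` such that: for every Banach space `X` and every
`L`-Lipschitz `F ∈ C^{1,+}(B_{ℓ∞}; X)` whose derivative has modulus of continuity `ω`
and with `‖F(e_n) - F(0)‖ ≥ ε` for all `n`, there exist a point `x` in the open unit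
ball of `ℓ∞` and an infinite `M ⊆ ℕ` with `l‖z‖ ≤ ‖dF(x)[z]‖ ≤ L‖z‖` for every `z`
supported in `M`. -/
theorem derivative_isomorphic_on_ell_infty_of_nat
    (ω : ℝ → ℝ) (hω : IsModulus ω) (L ε : ℝ) (hL : 0 < L) (hε : 0 < ε) :
    ∃ l : ℝ, 0 < l ∧
      ∀ (X : Type u) [NormedAddCommGroup X] [NormedSpace ℝ X] [CompleteSpace X],
      ∀ (F : lp (fun _ : ℕ => ℝ) ⊤ → X)
        (F' : lp (fun _ : ℕ => ℝ) ⊤ → (lp (fun _ : ℕ => ℝ) ⊤ →L[ℝ] X)),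
        ContinuousOn F (closedBall 0 1) →
        (∀ x ∈ closedBall (0 : lp (fun _ : ℕ => ℝ) ⊤) 1,
          ∀ y ∈ closedBall (0 : lp (fun _ : ℕ => ℝ) ⊤) 1,
          ‖F x - F y‖ ≤ L * ‖x - y‖) →
        (∀ x ∈ ball (0 : lp (fun _ : ℕ => ℝ) ⊤) 1, HasFDerivAt F (F' x) x) →
        (∀ x ∈ ball (0 : lp (fun _ : ℕ => ℝ) ⊤) 1, ∀ y ∈ ball (0 : lp (fun _ : ℕ => ℝ) ⊤) 1,
          ‖F' x - F' y‖ ≤ ω ‖x - y‖) →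
        (∀ n : ℕ, ε ≤ ‖F (lp.single ⊤ n 1) - F 0‖) →
        ∃ x ∈ ball (0 : lp (fun _ : ℕ => ℝ) ⊤) 1, ∃ M : Set ℕ, M.Infinite ∧
          ∀ z : lp (fun _ : ℕ => ℝ) ⊤, (∀ n ∉ M, z n = 0) →
            l * ‖z‖ ≤ ‖F' x z‖ ∧ ‖F' x z‖ ≤ L * ‖z‖ := by
  refine ⟨ε / 4 / 2, by positivity, ?_⟩
  intro X _ _ _ F F' _ hlip hF hF' hbig
  obtain ⟨x, hx, S, hS, hpart⟩ := exists_infinite_le_norm_partial hω hL hε hlip hF hF' hbig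
  obtain ⟨M, -, hM, hiso⟩ := exists_infinite_isomorphic_of_le_norm_single (F' x)
    (show 0 < ε / 4 by positivity) S hS hpart
  have hnorm : ‖F' x‖ ≤ L := by
    refine (hF x hx).le_of_lip' hL.le ?_
    filter_upwards [isOpen_ball.mem_nhds hx] with y hy
    exact hlip y (ball_subset_closedBall hy) x (ball_subset_closedBall hx)
  exact ⟨x, hx, M, hM, fun z hz => ⟨hiso z hz, (F' x).le_of_opNorm_le hnorm z⟩⟩
end
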